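/- Stability on the subspace V₁: Assume a² ≥ 0, b², c² > 0, k = 1 or k = −1, and R ∈ (0,∞]. Let (u,v) be a profile solution on (0,R) with u > 0 and v < 0 on (0,R), and assume that B(ξ,η) ≥ 0 for every pair (ξ,η) of continuously differentiable real-valued functions with compact support contained in (0,R). Let Q be the associated k-radially symmetric map on B_R. Then L[Q](P) ≥ 0 for every smooth compactly supported map P : B_R → S₀ whose (1,3) and (2,3) matrix entries vanish identically. -/

import Mathlib

open Real MeasureTheory Filter Set Topology
open scoped ENNReal

noncomputable section

/-- `s₊ = (b² + √(b⁴ + 24 a² c²)) / (4c²)`, where `a2 = a²`, `b2 = b²`, `c2 = c²`. -/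
def sPlus (a2 b2 c2 : ℝ) : ℝ := (b2 + Real.sqrt (b2 ^ 2 + 24 * a2 * c2)) / (4 * c2)

/-- `h(p,q) = p(−a² + (2b²/√6)q + c²(p² + q²))`. -/
def hfun (a2 b2 c2 p q : ℝ) : ℝ :=
  p * (-a2 + 2 * b2 / Real.sqrt 6 * q + c2 * (p ^ 2 + q ^ 2))

/-- `g(p,q) = q(−a² − (b²/√6)q + c²(p² + q²)) + (b²/√6)p²`. -/
def gfun (a2 b2 c2 p q : ℝ) : ℝ :=
  q * (-a2 - b2 / Real.sqrt 6 * q + c2 * (p ^ 2 + q ^ 2)) + b2 / Real.sqrt 6 * p ^ 2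

/-- The interval `(0, R)` for `R ∈ (0,∞]`, as a subset of `ℝ`. -/
def Iset (R : ℝ≥0∞) : Set ℝ := {r : ℝ | 0 < r ∧ ENNReal.ofReal r < R}

/-- The filter of left-approach to the right endpoint `R`; `atTop` when `R = ∞`. -/
def endFilter (R : ℝ≥0∞) : Filter ℝ :=
  if R = ⊤ then Filter.atTop else nhdsWithin R.toReal (Set.Iio R.toReal)

/-- A profile solution on `(0,R)`: a C² pair `(u,v)` solving the radial ODE system with the
natural boundary conditions at `0` and at `R`. -/
structure ProfileSolution (a2 b2 c2 : ℝ) (k : ℤ) (R : ℝ≥0∞) (u v : ℝ → ℝ) : Prop where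
  smooth_u : ContDiffOn ℝ 2 u (Iset R)
  smooth_v : ContDiffOn ℝ 2 v (Iset R)
  ode_u : ∀ r ∈ Iset R,
    deriv (deriv u) r + deriv u r / r - (k : ℝ) ^ 2 / r ^ 2 * u r
      = hfun a2 b2 c2 (u r) (v r)
  ode_v : ∀ r ∈ Iset R,
    deriv (deriv v) r + deriv v r / r = gfun a2 b2 c2 (u r) (v r)
  bc0_u : Filter.Tendsto u (nhdsWithin 0 (Set.Ioi 0)) (nhds 0)
  bc0_v : Filter.Tendsto (deriv v) (nhdsWithin 0 (Set.Ioi 0)) (nhds 0)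
  bcR_u : Filter.Tendsto u (endFilter R) (nhds (sPlus a2 b2 c2 / Real.sqrt 2))
  bcR_v : Filter.Tendsto v (endFilter R) (nhds (-(sPlus a2 b2 c2 / Real.sqrt 6)))

/-- The second variation `B(ξ,η)` of the profile energy at `(u,v)`. -/
def Bform (a2 b2 c2 : ℝ) (k : ℤ) (R : ℝ≥0∞) (u v ξ η : ℝ → ℝ) : ℝ :=
  ∫ r in Iset R,
    (deriv ξ r ^ 2 + (k : ℝ) ^ 2 / r ^ 2 * ξ r ^ 2 + deriv η r ^ 2
      + (-a2 + 2 * b2 / Real.sqrt 6 * v r + c2 * (3 * u r ^ 2 + v r ^ 2)) * ξ r ^ 2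
      + (-a2 - 2 * b2 / Real.sqrt 6 * v r + c2 * (u r ^ 2 + 3 * v r ^ 2)) * η r ^ 2
      + 4 * u r * ξ r * η r * (b2 / Real.sqrt 6 + c2 * v r)) * r

/-- The matrix `e₃⊗e₃ − I₃/3`. -/
def E0base : Matrix (Fin 3) (Fin 3) ℝ :=
  !![-(1:ℝ)/3, 0, 0; 0, -1/3, 0; 0, 0, 2/3]

/-- The matrix `M_k(x)`, with upper-left 2×2 block `[[x₁, k x₂],[k x₂, −x₁]]` and all other
entries zero. -/
def Mk (k : ℤ) (x : EuclideanSpace ℝ (Fin 2)) : Matrix (Fin 3) (Fin 3) ℝ :=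
  !![x 0, (k : ℝ) * x 1, 0; (k : ℝ) * x 1, -(x 0), 0; 0, 0, 0]

open scoped Classical in
/-- The `k`-radially symmetric map associated with the profile `(u,v)`:
`Q(x) = (u(|x|)/(√2 |x|)) M_k(x) + v(|x|) √(3/2) (e₃⊗e₃ − I₃/3)` for `x ≠ 0`, and
`Q(0) = (lim_{r→0⁺} v(r)) √(3/2) (e₃⊗e₃ − I₃/3)`. -/
def Qmap (k : ℤ) (u v : ℝ → ℝ) (x : EuclideanSpace ℝ (Fin 2)) :
    Matrix (Fin 3) (Fin 3) ℝ :=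
  (u ‖x‖ / (Real.sqrt 2 * ‖x‖)) • Mk k x
    + (Real.sqrt (3 / 2) *
        (if x = 0 then limUnder (nhdsWithin 0 (Set.Ioi 0)) v else v ‖x‖)) • E0base

/-- The open disk `B_R ⊆ ℝ²` centered at the origin (all of `ℝ²` when `R = ∞`). -/
def ball2 (R : ℝ≥0∞) : Set (EuclideanSpace ℝ (Fin 2)) := {x | ENNReal.ofReal ‖x‖ < R}

/-- `|∇P|²`: the sum of squares of all first partial derivatives of the entries of `P`. -/
def gradSq (P : EuclideanSpace ℝ (Fin 2) → Matrix (Fin 3) (Fin 3) ℝ)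
    (x : EuclideanSpace ℝ (Fin 2)) : ℝ :=
  ∑ α : Fin 2, ∑ i : Fin 3, ∑ j : Fin 3,
    (fderiv ℝ (fun y => P y i j) x (EuclideanSpace.single α 1)) ^ 2

/-- The second variation of the Landau–de Gennes energy at `Q` in direction `P`:
`L[Q](P) = ∫_{B_R} (|∇P|² − a²|P|² − 2b² tr(P²Q) + c²(|Q|²|P|² + 2 tr(QP)²))`. -/
def Lform (a2 b2 c2 : ℝ) (R : ℝ≥0∞)
    (Q P : EuclideanSpace ℝ (Fin 2) → Matrix (Fin 3) (Fin 3) ℝ) : ℝ :=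
  ∫ x in ball2 R,
    (gradSq P x - a2 * (P x * P x).trace - 2 * b2 * (P x * P x * Q x).trace
      + c2 * ((Q x * Q x).trace * (P x * P x).trace + 2 * ((Q x * P x).trace) ^ 2))

theorem isOpen_Iset (R : ℝ≥0∞) : IsOpen (Iset R) :=
  isOpen_Ioi.inter (isOpen_Iio.preimage ENNReal.continuous_ofReal)

theorem Iset_of_le {R : ℝ≥0∞} {r t : ℝ} (hr : r ∈ Iset R) (ht : 0 < t) (htr : t ≤ r) :
    t ∈ Iset R :=
  ⟨ht, (ENNReal.ofReal_le_ofReal htr).trans_lt hr.2⟩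

theorem ordConnected_Iset (R : ℝ≥0∞) : (Iset R).OrdConnected :=
  ⟨fun _ hx _ hy _ hz => Iset_of_le hy (hx.1.trans_le hz.1) hz.2⟩

theorem convex_Iset (R : ℝ≥0∞) : Convex ℝ (Iset R) := (ordConnected_Iset R).convex

theorem Icc_subset_Iset {R : ℝ≥0∞} {x y : ℝ} (hx : x ∈ Iset R) (hy : y ∈ Iset R) :
    Icc x y ⊆ Iset R := (ordConnected_Iset R).out hx hy

theorem exists_mem_Iset {R : ℝ≥0∞} (hR : 0 < R) : ∃ r, r ∈ Iset R := by
  rcases eq_or_ne R ⊤ with rfl | h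
  · exact ⟨1, one_pos, ENNReal.ofReal_lt_top⟩
  · have := ENNReal.toReal_pos hR.ne' h
    refine ⟨R.toReal / 2, by positivity, ?_⟩
    rw [ENNReal.ofReal_lt_iff_lt_toReal (by positivity) h]
    linarith

theorem eventually_nhdsGT_zero_Iset {R : ℝ≥0∞} {r₀ : ℝ} (h : r₀ ∈ Iset R) :
    ∀ᶠ r in 𝓝[>] (0 : ℝ), r ∈ Iset R ∧ r < r₀ := by
  filter_upwards [Ioo_mem_nhdsGT h.1] with r hr
  exact ⟨Iset_of_le h hr.1 hr.2.le, hr.2⟩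

theorem mem_Iset_of_ne_top {R : ℝ≥0∞} (h : R ≠ ⊤) {r : ℝ} :
    r ∈ Iset R ↔ 0 < r ∧ r < R.toReal := by
  constructor
  · rintro ⟨h0, h1⟩
    exact ⟨h0, (ENNReal.ofReal_lt_iff_lt_toReal h0.le h).1 h1⟩
  · rintro ⟨h0, h1⟩
    exact ⟨h0, (ENNReal.ofReal_lt_iff_lt_toReal h0.le h).2 h1⟩

theorem eventually_endFilter {R : ℝ≥0∞} {r₀ : ℝ} (h : r₀ ∈ Iset R) :
    ∀ᶠ r in endFilter R, r ∈ Iset R ∧ r₀ < r := by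
  by_cases hR : R = ⊤
  · subst hR
    simp only [endFilter, if_true]
    filter_upwards [eventually_gt_atTop r₀] with r hr
    exact ⟨⟨h.1.trans hr, ENNReal.ofReal_lt_top⟩, hr⟩
  · simp only [endFilter, if_neg hR]
    have h' := (mem_Iset_of_ne_top hR).1 h
    filter_upwards [Ioo_mem_nhdsLT h'.2] with r hr
    exact ⟨(mem_Iset_of_ne_top hR).2 ⟨h.1.trans hr.1, hr.2⟩, hr.1⟩

instance endFilter_neBot (R : ℝ≥0∞) : (endFilter R).NeBot := by
  unfold endFilter
  split_ifs <;> infer_instance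

theorem exists_of_eventually_endFilter {R : ℝ≥0∞} (hR : 0 < R) {Q : ℝ → Prop}
    (h : ∀ᶠ r in endFilter R, Q r) : ∃ β ∈ Iset R, ∀ r ∈ Iset R, β ≤ r → Q r := by
  by_cases hT : R = ⊤
  · subst hT
    simp only [endFilter, if_true] at h
    obtain ⟨β, hβ⟩ := eventually_atTop.1 h
    exact ⟨max β 1, ⟨by positivity, ENNReal.ofReal_lt_top⟩,
      fun r _ h => hβ r ((le_max_left _ _).trans h)⟩
  · simp only [endFilter, if_neg hT] at h
    have hpos := ENNReal.toReal_pos hR.ne' hT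
    obtain ⟨l, hl, hl'⟩ := (mem_nhdsLT_iff_exists_Ioo_subset' hpos).1 h
    have hl : l < R.toReal := hl
    refine ⟨max ((l + R.toReal) / 2) (R.toReal / 2), ?_, ?_⟩
    · rw [mem_Iset_of_ne_top hT]
      exact ⟨lt_max_of_lt_right (by positivity), max_lt (by linarith) (by linarith)⟩
    · intro r hr hβ
      have := (mem_Iset_of_ne_top hT).1 hr
      exact hl' ⟨by linarith [(le_max_left _ _).trans hβ], this.2⟩

theorem exists_of_eventually_nhdsGT_zero {R : ℝ≥0∞} (hR : 0 < R) {Q : ℝ → Prop}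
    (h : ∀ᶠ r in 𝓝[>] (0 : ℝ), Q r) : ∃ α ∈ Iset R, ∀ r ∈ Iset R, r ≤ α → Q r := by
  obtain ⟨r₀, hr₀⟩ := exists_mem_Iset hR
  obtain ⟨l, hl, hl'⟩ := (mem_nhdsGT_iff_exists_Ioo_subset' hr₀.1).1 h
  have hl : 0 < l := hl
  have hr₁ := hr₀.1
  refine ⟨min (l / 2) r₀, Iset_of_le hr₀ (by positivity) (min_le_right _ _), ?_⟩
  intro r hr h
  exact hl' ⟨hr.1, by linarith [h.trans (min_le_left _ _)]⟩

theorem hasDerivAt_comp_max_zero {F F' : ℝ → ℝ} (hF : ∀ x, 0 ≤ x → HasDerivAt F (F' x) x)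
    (h0 : F' 0 = 0) (x : ℝ) :
    HasDerivAt (fun x => F (max x 0)) (F' (max x 0)) x := by
  rcases lt_trichotomy x 0 with hx | rfl | hx
  · rw [max_eq_right hx.le, h0]
    apply (hasDerivAt_const x (F 0)).congr_of_eventuallyEq
    filter_upwards [Iio_mem_nhds hx] with y hy
    rw [max_eq_right (le_of_lt hy)]
  · rw [max_self, h0]
    have h1 : HasDerivWithinAt (fun x => F (max x 0)) 0 (Iic 0) 0 := by
      apply (hasDerivWithinAt_const (0 : ℝ) (Iic 0) (F 0)).congr
      · intro y hy
        rw [max_eq_right hy]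
      · simp
    have h2 : HasDerivWithinAt (fun x => F (max x 0)) 0 (Ici 0) 0 := by
      have := (hF 0 le_rfl).hasDerivWithinAt (s := Ici 0)
      rw [h0] at this
      apply this.congr
      · intro y hy
        rw [max_eq_left hy]
      · simp
    have := h1.union h2
    rwa [Iic_union_Ici, hasDerivWithinAt_univ] at this
  · rw [max_eq_left hx.le]
    apply (hF x hx.le).congr_of_eventuallyEq
    filter_upwards [Ioi_mem_nhds hx] with y hy
    rw [max_eq_left (le_of_lt hy)]

theorem monotoneOn_Iset {R : ℝ≥0∞} {f f' : ℝ → ℝ} (hf : ∀ r ∈ Iset R, HasDerivAt f (f' r) r)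
    (h : ∀ r ∈ Iset R, 0 ≤ f' r) : MonotoneOn f (Iset R) := by
  apply monotoneOn_of_deriv_nonneg (convex_Iset R)
  · exact fun r hr => (hf r hr).continuousAt.continuousWithinAt
  · rw [(isOpen_Iset R).interior_eq]
    exact fun r hr => (hf r hr).differentiableAt.differentiableWithinAt
  · rw [(isOpen_Iset R).interior_eq]
    intro r hr
    rw [(hf r hr).deriv]
    exact h r hr

/-- A maximum principle: `F` plays the role of a positive multiple of `f'`. -/
theorem nonpos_of_flux_monotone {R : ℝ≥0∞} {f f' F F' : ℝ → ℝ}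
    (hf : ∀ r ∈ Iset R, HasDerivAt f (f' r) r)
    (hF : ∀ r ∈ Iset R, HasDerivAt F (F' r) r)
    (hs : ∀ r ∈ Iset R, 0 ≤ F r * f' r) (hs' : ∀ r ∈ Iset R, 0 ≤ F r → 0 ≤ f' r)
    (hF' : ∀ r ∈ Iset R, 0 < f r → 0 ≤ F' r)
    (h0 : Tendsto F (𝓝[>] 0) (𝓝 0)) {K : ℝ} (hK : ∀ᶠ r in 𝓝[>] (0 : ℝ), f r ≤ K)
    {l : ℝ} (hl : l ≤ 0) (hend : Tendsto f (endFilter R) (𝓝 l)) :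
    ∀ r ∈ Iset R, f r ≤ 0 := by
  have hsq : ∀ x : ℝ, HasDerivAt (fun x : ℝ => (max x 0) ^ 2) (2 * max x 0) x :=
    hasDerivAt_comp_max_zero (F := fun x => x ^ 2) (F' := fun x => 2 * x)
      (fun x _ => by simpa using hasDerivAt_pow 2 x) (by simp)
  have hcu : ∀ x : ℝ, HasDerivAt (fun x : ℝ => (max x 0) ^ 3) (3 * (max x 0) ^ 2) x :=
    hasDerivAt_comp_max_zero (F := fun x => x ^ 3) (F' := fun x => 3 * x ^ 2)
      (fun x _ => by simpa using hasDerivAt_pow 3 x) (by simp)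
  have hG : ∀ r ∈ Iset R, HasDerivAt (fun r => F r * (max (f r) 0) ^ 2)
      (F' r * (max (f r) 0) ^ 2 + F r * (2 * max (f r) 0 * f' r)) r := fun r hr =>
    (hF r hr).mul ((hsq (f r)).comp r (hf r hr))
  have hGmono := monotoneOn_Iset hG (by
    intro r hr
    rcases le_or_gt (f r) 0 with h | h
    · simp [max_eq_right h]
    · rw [max_eq_left h.le]
      have := mul_nonneg h.le (hs r hr)
      have := mul_nonneg (hF' r hr h) (sq_nonneg (f r))
      nlinarith)
  have hG0 : Tendsto (fun r => F r * (max (f r) 0) ^ 2) (𝓝[>] 0) (𝓝 0) := by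
    apply h0.zero_mul_isBoundedUnder_le
    refine ⟨(max K 0) ^ 2, ?_⟩
    rw [eventually_map]
    filter_upwards [hK] with r hr
    simp only [Function.comp_apply]
    rw [Real.norm_of_nonneg (by positivity)]
    exact pow_le_pow_left₀ (le_max_right _ _) (max_le_max hr le_rfl) 2
  have hGnn : ∀ r ∈ Iset R, 0 ≤ F r * (max (f r) 0) ^ 2 := by
    intro r hr
    apply le_of_tendsto hG0
    filter_upwards [eventually_nhdsGT_zero_Iset hr] with t ht
    exact hGmono ht.1 hr ht.2.le
  have hMmono := monotoneOn_Iset (fun r hr => (hcu (f r)).comp r (hf r hr)) (by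
    intro r hr
    rcases le_or_gt (f r) 0 with h | h
    · simp [max_eq_right h]
    · have h1 := hGnn r hr
      rw [max_eq_left h.le] at h1 ⊢
      have : 0 ≤ F r := nonneg_of_mul_nonneg_left h1 (by positivity)
      have := hs' r hr this
      positivity)
  intro r hr
  have hlim : Tendsto (fun r => (max (f r) 0) ^ 3) (endFilter R) (𝓝 0) := by
    have : Tendsto (fun r => (max (f r) 0) ^ 3) (endFilter R) (𝓝 ((max l 0) ^ 3)) :=
      (hend.max tendsto_const_nhds).pow 3
    simpa [max_eq_right hl] using this
  have h3 : (max (f r) 0) ^ 3 ≤ 0 := by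
    apply ge_of_tendsto hlim
    filter_upwards [eventually_endFilter hr] with t ht
    exact hMmono hr ht.1 ht.2.le
  by_contra! hc
  rw [max_eq_left hc.le] at h3
  have : 0 < f r ^ 3 := by positivity
  linarith

/-- A radial profile with its first derivatives `p = u'` and `q = v'`, in the normalized
parameters `a = a²`, `B = b²/√6`, `c = c²`, `T = s₊/√6`, for `k² = 1`. -/
structure IsProfile (a B c T : ℝ) (R : ℝ≥0∞) (u v p q : ℝ → ℝ) : Prop where
  B_pos : 0 < B
  c_pos : 0 < c
  T_pos : 0 < T
  a_nonneg : 0 ≤ a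
  a_eq : a = 4 * c * T ^ 2 - 2 * B * T
  R_pos : 0 < R
  u_pos : ∀ r ∈ Iset R, 0 < u r
  v_neg : ∀ r ∈ Iset R, v r < 0
  hasDerivAt_u : ∀ r ∈ Iset R, HasDerivAt u (p r) r
  hasDerivAt_v : ∀ r ∈ Iset R, HasDerivAt v (q r) r
  hasDerivAt_p : ∀ r ∈ Iset R, HasDerivAt p (-p r / r + u r / r ^ 2 +
    u r * (-a + 2 * B * v r + c * (u r ^ 2 + v r ^ 2))) r
  hasDerivAt_q : ∀ r ∈ Iset R, HasDerivAt q (-q r / r +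
    (v r * (-a - B * v r + c * (u r ^ 2 + v r ^ 2)) + B * u r ^ 2)) r
  tendsto_zero_u : Tendsto u (𝓝[>] 0) (𝓝 0)
  tendsto_zero_q : Tendsto q (𝓝[>] 0) (𝓝 0)
  tendsto_end_u : Tendsto u (endFilter R) (𝓝 (√3 * T))
  tendsto_end_v : Tendsto v (endFilter R) (𝓝 (-T))

theorem flux_le_of_source_le {u p k : ℝ → ℝ} {r₀ H : ℝ} (hH : 0 ≤ H)
    (hu : ∀ r ∈ Ioo 0 r₀, HasDerivAt u (p r) r)
    (hp : ∀ r ∈ Ioo 0 r₀, HasDerivAt p (-p r / r + u r / r ^ 2 + k r) r)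
    (hk : ∀ r ∈ Ioo 0 r₀, k r ≤ H) (h0 : Tendsto u (𝓝[>] 0) (𝓝 0)) :
    ∀ r ∈ Ioo 0 r₀, r ^ 2 * p r - r * u r ≤ H * r ^ 3 := by
  intro r₁ hr₁
  by_contra! hc
  have hanti : AntitoneOn (fun r => r ^ 2 * p r - r * u r - H * r ^ 3) (Ioo 0 r₀) := by
    have hd : ∀ r ∈ Ioo 0 r₀, HasDerivAt (fun r => r ^ 2 * p r - r * u r - H * r ^ 3)
        (r ^ 2 * k r - 3 * H * r ^ 2) r := by
      intro r hr
      have h := ((((hasDerivAt_id r).pow 2).mul (hp r hr)).sub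
        ((hasDerivAt_id r).mul (hu r hr))).sub (((hasDerivAt_id r).pow 3).const_mul H)
      refine h.congr_deriv ?_
      have := hr.1.ne'
      simp only [id, Pi.pow_apply]
      field_simp
      push_cast
      ring
    apply antitoneOn_of_deriv_nonpos (convex_Ioo _ _)
    · exact fun r hr => (hd r hr).continuousAt.continuousWithinAt
    · rw [interior_Ioo]
      exact fun r hr => (hd r hr).differentiableAt.differentiableWithinAt
    · rw [interior_Ioo]
      intro r hr
      rw [(hd r hr).deriv]
      nlinarith [hk r hr, sq_nonneg r, mul_nonneg (sub_nonneg.2 (hk r hr)) (sq_nonneg r),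
        mul_nonneg hH (sq_nonneg r)]
  set d := r₁ ^ 2 * p r₁ - r₁ * u r₁ - H * r₁ ^ 3 with hd
  have hdpos : 0 < d := by rw [hd]; linarith
  have hev : ∀ᶠ r in 𝓝[>] (0 : ℝ), |u r| < 1 / 2 := by
    have := h0.abs
    rw [abs_zero] at this
    exact this.eventually (gt_mem_nhds (by norm_num))
  obtain ⟨l, hl, hl'⟩ := (mem_nhdsGT_iff_exists_Ioo_subset' hr₁.1).1 hev
  have hl : 0 < l := hl
  set m := min (min l (d / 2)) r₁ with hm
  have hr₁0 := hr₁.1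
  have hmpos : 0 < m := by positivity
  have hmem : ∀ r ∈ Ioo 0 m, r < l ∧ r < d / 2 ∧ r < r₁ := fun r hr =>
    ⟨hr.2.trans_le ((min_le_left _ _).trans (min_le_left _ _)),
      hr.2.trans_le ((min_le_left _ _).trans (min_le_right _ _)), hr.2.trans_le (min_le_right _ _)⟩
  have hmono : MonotoneOn (fun r => r * u r - r) (Ioo 0 m) := by
    have hder : ∀ r ∈ Ioo 0 m, HasDerivAt (fun r => r * u r - r) (u r + r * p r - 1) r := by
      intro r hr
      have h3 := (hmem r hr).2.2
      have h := ((hasDerivAt_id r).mul (hu r ⟨hr.1, h3.trans hr₁.2⟩)).sub (hasDerivAt_id r)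
      refine h.congr_deriv ?_
      simp
    apply monotoneOn_of_deriv_nonneg (convex_Ioo _ _)
    · exact fun r hr => (hder r hr).continuousAt.continuousWithinAt
    · rw [interior_Ioo]
      exact fun r hr => (hder r hr).differentiableAt.differentiableWithinAt
    · rw [interior_Ioo]
      intro r hr
      rw [(hder r hr).deriv]
      obtain ⟨h1, h2, h3⟩ := hmem r hr
      have ha : d ≤ r ^ 2 * p r - r * u r - H * r ^ 3 :=
        hanti ⟨hr.1, h3.trans hr₁.2⟩ hr₁ h3.le
      have hub : |u r| < 1 / 2 := hl' ⟨hr.1, h1⟩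
      have hub' := abs_lt.1 hub
      have h5 : 2 * r ≤ r * (r * p r - u r) := by
        have : 0 ≤ H * r ^ 3 := by have := hr.1.le; positivity
        nlinarith
      have h6 : 2 ≤ r * p r - u r := by
        by_contra! h
        nlinarith [hr.1]
      linarith
  have hlim : Tendsto (fun r => r * u r - r) (𝓝[>] 0) (𝓝 0) := by
    have h1 : Tendsto (fun r : ℝ => r) (𝓝[>] 0) (𝓝 0) := tendsto_nhdsWithin_of_tendsto_nhds tendsto_id
    simpa using (h1.mul h0).sub h1
  have hmid : m / 2 ∈ Ioo 0 m := ⟨by positivity, by linarith⟩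
  have hge : 0 ≤ m / 2 * u (m / 2) - m / 2 := by
    apply le_of_tendsto hlim
    filter_upwards [Ioo_mem_nhdsGT hmid.1] with t ht
    exact hmono ⟨ht.1, ht.2.trans hmid.2⟩ hmid ht.2.le
  have hub : |u (m / 2)| < 1 / 2 := hl' ⟨hmid.1, (hmem _ hmid).1⟩
  have := (abs_lt.1 hub).2
  nlinarith [hmid.1]

theorem bounded_near_zero_of_hasDerivAt {f f' : ℝ → ℝ} {r₀ K : ℝ} (h0 : 0 < r₀)
    (hf : ∀ r ∈ Ioo 0 r₀, HasDerivAt f (f' r) r) (hK : ∀ r ∈ Ioo 0 r₀, |f' r| ≤ K) :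
    ∃ C, ∀ r ∈ Ioo 0 r₀, |f r| ≤ C := by
  have hm : r₀ / 2 ∈ Ioo 0 r₀ := ⟨by positivity, by linarith⟩
  have hK0 : 0 ≤ K := (abs_nonneg _).trans (hK _ hm)
  refine ⟨K * r₀ + |f (r₀ / 2)|, fun r hr => ?_⟩
  have := (convex_Ioo 0 r₀).norm_image_sub_le_of_norm_hasDerivWithin_le
    (fun x hx => (hf x hx).hasDerivWithinAt) hK hm hr
  simp only [Real.norm_eq_abs] at this
  have h2 : |r - r₀ / 2| ≤ r₀ := by
    rw [abs_le]
    constructor <;> linarith [hr.1, hr.2]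
  have h3 := abs_sub_abs_le_abs_sub (f r) (f (r₀ / 2))
  nlinarith [mul_le_mul_of_nonneg_left h2 hK0]

namespace IsProfile

variable {a B c T : ℝ} {R : ℝ≥0∞} {u v p q : ℝ → ℝ}

/-- Control of the profile near the origin. -/
theorem exists_origin_bounds (h : IsProfile a B c T R u v p q) :
    ∃ K > 0, ∃ r₀ ∈ Iset R, ∀ r ∈ Ioo 0 r₀, |u r| ≤ K ∧ |v r| ≤ K ∧ |p r| ≤ K ∧ -(K * r) ≤ p r := by
  have hq : ∀ᶠ r in 𝓝[>] (0 : ℝ), |q r| ≤ 1 := by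
    have := h.tendsto_zero_q.abs
    rw [abs_zero] at this
    exact (this.eventually (gt_mem_nhds one_pos)).mono fun _ h => h.le
  have hu : ∀ᶠ r in 𝓝[>] (0 : ℝ), |u r| ≤ 1 := by
    have := h.tendsto_zero_u.abs
    rw [abs_zero] at this
    exact (this.eventually (gt_mem_nhds one_pos)).mono fun _ h => h.le
  obtain ⟨r₁, hr₁, hr₁'⟩ := exists_of_eventually_nhdsGT_zero h.R_pos (hq.and hu)
  have hIoo : ∀ r ∈ Ioo 0 r₁, r ∈ Iset R := fun r hr => Iset_of_le hr₁ hr.1 hr.2.le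
  obtain ⟨V, hV⟩ := bounded_near_zero_of_hasDerivAt hr₁.1 (fun r hr => h.hasDerivAt_v r (hIoo r hr))
    (fun r hr => (hr₁' r (hIoo r hr) hr.2.le).1)
  have hk : ∃ H ≥ 0, ∀ r ∈ Ioo 0 r₁,
      |u r * (-a + 2 * B * v r + c * (u r ^ 2 + v r ^ 2))| ≤ H := by
    refine ⟨1 * (a + 2 * B * V + c * (1 ^ 2 + V ^ 2)), ?_, ?_⟩
    · have : 0 ≤ V := (abs_nonneg _).trans (hV (r₁ / 2) ⟨half_pos hr₁.1, half_lt_self hr₁.1⟩)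
      have := h.a_nonneg
      have := h.B_pos
      have := h.c_pos
      positivity
    · intro r hr
      have h1 := hV r hr
      have h2 := (hr₁' r (hIoo r hr) hr.2.le).2
      have h3 := h.a_nonneg
      have h4 := h.B_pos
      have h5 := h.c_pos
      rw [abs_mul]
      gcongr
      calc |-a + 2 * B * v r + c * (u r ^ 2 + v r ^ 2)|
          ≤ |-a| + |2 * B * v r| + |c * (u r ^ 2 + v r ^ 2)| := abs_add_three _ _ _
        _ = a + 2 * B * |v r| + c * (|u r| ^ 2 + |v r| ^ 2) := by
            rw [abs_neg, abs_of_nonneg h3, abs_mul, abs_of_pos (by positivity : 0 < 2 * B),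
              abs_of_nonneg (by positivity : 0 ≤ c * (u r ^ 2 + v r ^ 2)), sq_abs, sq_abs]
        _ ≤ _ := by gcongr
  obtain ⟨H, hH, hkH⟩ := hk
  have hup := flux_le_of_source_le hH (fun r hr => h.hasDerivAt_u r (hIoo r hr))
    (fun r hr => h.hasDerivAt_p r (hIoo r hr)) (fun r hr => (abs_le.1 (hkH r hr)).2)
    h.tendsto_zero_u
  have hlo := flux_le_of_source_le (u := fun r => -u r) (p := fun r => -p r)
    (k := fun r => -(u r * (-a + 2 * B * v r + c * (u r ^ 2 + v r ^ 2)))) hH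
    (fun r hr => (h.hasDerivAt_u r (hIoo r hr)).neg)
    (fun r hr => (h.hasDerivAt_p r (hIoo r hr)).neg.congr_deriv (by ring))
    (fun r hr => by linarith [(abs_le.1 (hkH r hr)).1]) (by simpa using h.tendsto_zero_u.neg)
  obtain ⟨W, hW⟩ := bounded_near_zero_of_hasDerivAt (f := fun r => u r / r)
    (f' := fun r => (p r * r - u r) / r ^ 2) (K := H) hr₁.1
    (fun r hr => by
      simpa using (h.hasDerivAt_u r (hIoo r hr)).fun_div (hasDerivAt_id' r) hr.1.ne')
    (fun r hr => by
      have h1 := hup r hr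
      have h2 := hlo r hr
      have h0 := hr.1
      rw [abs_le, le_div_iff₀ (by positivity), div_le_iff₀ (by positivity)]
      constructor <;> nlinarith)
  refine ⟨1 + max V 0 + max W 0 + H * (1 + r₁), by have := hr₁.1; positivity, r₁, hr₁,
    fun r hr => ?_⟩
  have h0 := hr.1
  have hW' := abs_le.1 (hW r hr)
  have hV' := hV r hr
  have hu' := (hr₁' r (hIoo r hr) hr.2.le).2
  have hHr : 0 ≤ H * (1 + r₁) := by have := hr₁.1; positivity
  have e1 : V ≤ max V 0 := le_max_left _ _
  have e2 : W ≤ max W 0 := le_max_left _ _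
  have e3 : (0 : ℝ) ≤ max V 0 := le_max_right _ _
  have e4 : (0 : ℝ) ≤ max W 0 := le_max_right _ _
  have hp1 : p r ≤ H * r + u r / r := by
    have h1 := hup r hr
    have : r ^ 2 * p r ≤ r ^ 2 * (H * r + u r / r) := by
      have : r ^ 2 * (H * r + u r / r) = H * r ^ 3 + r * u r := by field_simp
      linarith
    exact le_of_mul_le_mul_left this (by positivity)
  have hp2 : -(H * r) + u r / r ≤ p r := by
    have h1 := hlo r hr
    have : r ^ 2 * (-(H * r) + u r / r) ≤ r ^ 2 * p r := by
      have : r ^ 2 * (-(H * r) + u r / r) = -(H * r ^ 3) + r * u r := by field_simp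
      linarith
    exact le_of_mul_le_mul_left this (by positivity)
  have hup' := div_pos (h.u_pos r (hIoo r hr)) h0
  have hHr' : H * r ≤ H * r₁ := by have := hr.2.le; gcongr
  refine ⟨by linarith, by linarith, ?_, ?_⟩
  · rw [abs_le]
    constructor <;> linarith
  · have : H * r ≤ (1 + max V 0 + max W 0 + H * (1 + r₁)) * r := by
      gcongr
      have := mul_nonneg hH hr₁.1.le
      nlinarith
    linarith

end IsProfile

namespace IsProfile

variable {a B c T : ℝ} {R : ℝ≥0∞} {u v p q : ℝ → ℝ}

theorem bulk_source_nonneg (h : IsProfile a B c T R u v p q) {x y : ℝ}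
    (hxy : 4 * T ^ 2 < x ^ 2 + y ^ 2) :
    0 ≤ x * (x * (-a + 2 * B * y + c * (x ^ 2 + y ^ 2))) +
      y * (y * (-a - B * y + c * (x ^ 2 + y ^ 2)) + B * x ^ 2) := by
  have hB := h.B_pos
  have hc := h.c_pos
  have hT := h.T_pos
  set ρ := √(x ^ 2 + y ^ 2) with hρ
  have hρ2 : ρ ^ 2 = x ^ 2 + y ^ 2 := Real.sq_sqrt (by positivity)
  have hρ0 : 0 ≤ ρ := Real.sqrt_nonneg _
  have hρT : 2 * T ≤ ρ := by
    exact Real.le_sqrt_of_sq_le (by nlinarith)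
  have h3 : -(ρ ^ 3) ≤ 3 * x ^ 2 * y - y ^ 3 := by
    have h1 : (ρ ^ 3) ^ 2 = (x ^ 2 + y ^ 2) ^ 3 := by rw [← hρ2]; ring
    have h2 : (3 * x ^ 2 * y - y ^ 3) ^ 2 ≤ (ρ ^ 3) ^ 2 := by
      rw [h1]
      nlinarith [sq_nonneg (x ^ 3 - 3 * x * y ^ 2)]
    exact (abs_le.1 (abs_le_of_sq_le_sq h2 (by positivity))).1
  have hBT : B ≤ 2 * c * T := by
    have h1 := h.a_nonneg
    rw [h.a_eq] at h1
    by_contra! hlt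
    nlinarith
  have h5 : 0 ≤ (ρ - 2 * T) * (c * (ρ + 2 * T) - B) := by
    apply mul_nonneg (by linarith)
    nlinarith
  have h6 : x * (x * (-a + 2 * B * y + c * (x ^ 2 + y ^ 2))) +
      y * (y * (-a - B * y + c * (x ^ 2 + y ^ 2)) + B * x ^ 2) =
      -a * ρ ^ 2 + B * (3 * x ^ 2 * y - y ^ 3) + c * (ρ ^ 2) ^ 2 := by
    rw [hρ2]; ring
  rw [h6, h.a_eq]
  have h7 := mul_le_mul_of_nonneg_left h3 hB.le
  have h8 := mul_nonneg (sq_nonneg ρ) h5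
  nlinarith

theorem sq_add_sq_le (h : IsProfile a B c T R u v p q) :
    ∀ r ∈ Iset R, u r ^ 2 + v r ^ 2 ≤ 4 * T ^ 2 := by
  obtain ⟨K, hK, r₀, hr₀, hb⟩ := h.exists_origin_bounds
  have hev : ∀ᶠ r in 𝓝[>] (0 : ℝ), r ∈ Ioo 0 r₀ := Ioo_mem_nhdsGT hr₀.1
  have hid : Tendsto (fun r : ℝ => r) (𝓝[>] 0) (𝓝 0) :=
    tendsto_nhdsWithin_of_tendsto_nhds tendsto_id
  have key := nonpos_of_flux_monotone (R := R) (f := fun r => u r ^ 2 + v r ^ 2 - 4 * T ^ 2)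
    (f' := fun r => 2 * (u r * p r + v r * q r))
    (F := fun r => 2 * (r * (u r * p r + v r * q r)))
    (F' := fun r => 2 * (r * (p r ^ 2 + q r ^ 2) + u r ^ 2 / r +
      r * (u r * (u r * (-a + 2 * B * v r + c * (u r ^ 2 + v r ^ 2))) +
      v r * (v r * (-a - B * v r + c * (u r ^ 2 + v r ^ 2)) + B * u r ^ 2))))
    (K := 2 * K ^ 2 - 4 * T ^ 2) (l := 0) ?_ ?_ ?_ ?_ ?_ ?_ ?_ le_rfl ?_
  · intro r hr
    linarith [key r hr]
  · intro r hr
    refine ((((h.hasDerivAt_u r hr).fun_pow 2).fun_add ((h.hasDerivAt_v r hr).fun_pow 2)).sub_const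
      (4 * T ^ 2)).congr_deriv ?_
    push_cast; ring
  · intro r hr
    refine (((hasDerivAt_id' r).fun_mul (((h.hasDerivAt_u r hr).fun_mul (h.hasDerivAt_p r hr)).fun_add
      ((h.hasDerivAt_v r hr).fun_mul (h.hasDerivAt_q r hr)))).const_mul 2).congr_deriv ?_
    have := hr.1.ne'
    field_simp
    ring
  · intro r hr
    have := hr.1
    have : 0 ≤ r * (u r * p r + v r * q r) ^ 2 := by positivity
    nlinarith
  · intro r hr hF
    have := hr.1
    exact mul_nonneg zero_le_two (nonneg_of_mul_nonneg_right (by linarith) this)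
  · intro r hr hf
    have := hr.1
    have := h.bulk_source_nonneg (x := u r) (y := v r) (by linarith)
    positivity
  · have h1 : Tendsto (fun r => r * (u r * p r)) (𝓝[>] 0) (𝓝 0) := by
      have h2 : Tendsto (fun r => r * u r) (𝓝[>] 0) (𝓝 0) := by
        simpa using hid.mul h.tendsto_zero_u
      have h3 := h2.zero_mul_isBoundedUnder_le (g := p) ⟨K, by
        rw [eventually_map]
        filter_upwards [hev] with r hr
        exact (hb r hr).2.2.1⟩
      exact h3.congr fun r => by ring
    have h2 : Tendsto (fun r => r * (v r * q r)) (𝓝[>] 0) (𝓝 0) := by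
      have h2 : Tendsto (fun r => r * q r) (𝓝[>] 0) (𝓝 0) := by
        simpa using hid.mul h.tendsto_zero_q
      have h3 := h2.zero_mul_isBoundedUnder_le (g := v) ⟨K, by
        rw [eventually_map]
        filter_upwards [hev] with r hr
        exact (hb r hr).2.1⟩
      exact h3.congr fun r => by ring
    have := (h1.add h2).const_mul 2
    simp only [add_zero, mul_zero] at this
    exact this.congr fun r => by ring
  · filter_upwards [hev] with r hr
    obtain ⟨h1, h2, -⟩ := hb r hr
    have h3 := sq_le_sq' (neg_le_of_abs_le h1) (le_of_abs_le h1)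
    have h4 := sq_le_sq' (neg_le_of_abs_le h2) (le_of_abs_le h2)
    linarith
  · have := ((h.tendsto_end_u.pow 2).add (h.tendsto_end_v.pow 2)).sub_const (4 * T ^ 2)
    convert this using 2
    rw [mul_pow, Real.sq_sqrt (by norm_num)]
    ring

theorem u_le_neg_v (h : IsProfile a B c T R u v p q) : ∀ r ∈ Iset R, u r ≤ -(√3 * v r) := by
  obtain ⟨K, hK, r₀, hr₀, hb⟩ := h.exists_origin_bounds
  have hev : ∀ᶠ r in 𝓝[>] (0 : ℝ), r ∈ Ioo 0 r₀ := Ioo_mem_nhdsGT hr₀.1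
  have hid : Tendsto (fun r : ℝ => r) (𝓝[>] 0) (𝓝 0) :=
    tendsto_nhdsWithin_of_tendsto_nhds tendsto_id
  have h3 : (0 : ℝ) < √3 := by positivity
  have h3' : √3 ^ 2 = (3 : ℝ) := Real.sq_sqrt (by norm_num)
  have key := nonpos_of_flux_monotone (R := R) (f := fun r => 1 + √3 * (v r / u r))
    (f' := fun r => √3 * ((q r * u r - v r * p r) / u r ^ 2))
    (F := fun r => √3 * (r * (q r * u r - v r * p r)))
    (F' := fun r => √3 * (r * (B * u r * (u r ^ 2 - 3 * v r ^ 2)) - u r * v r / r))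
    (K := 1) (l := 0) ?_ ?_ ?_ ?_ ?_ ?_ ?_ le_rfl ?_
  · intro r hr
    have h1 := key r hr
    have hu := h.u_pos r hr
    have h2 := mul_le_mul_of_nonneg_right h1 hu.le
    rw [add_mul, one_mul, mul_assoc, div_mul_cancel₀ _ hu.ne'] at h2
    linarith
  · intro r hr
    exact (((h.hasDerivAt_v r hr).fun_div (h.hasDerivAt_u r hr) (h.u_pos r hr).ne').const_mul
      (√3)).const_add 1
  · intro r hr
    refine (((hasDerivAt_id' r).fun_mul (((h.hasDerivAt_q r hr).fun_mul (h.hasDerivAt_u r hr)).fun_sub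
      ((h.hasDerivAt_v r hr).fun_mul (h.hasDerivAt_p r hr)))).const_mul √3).congr_deriv ?_
    have := hr.1.ne'
    field_simp
    ring
  · intro r hr
    have := hr.1
    have hu := h.u_pos r hr
    have : √3 * (r * (q r * u r - v r * p r)) * (√3 * ((q r * u r - v r * p r) / u r ^ 2)) =
      √3 ^ 2 * r * (q r * u r - v r * p r) ^ 2 / u r ^ 2 := by ring
    rw [this]
    positivity
  · intro r hr hF
    have h0 := hr.1
    have h1 : 0 ≤ q r * u r - v r * p r :=
      nonneg_of_mul_nonneg_right (nonneg_of_mul_nonneg_right hF h3) h0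
    positivity
  · intro r hr hf
    have h0 := hr.1
    have hu := h.u_pos r hr
    have hv := h.v_neg r hr
    have h1 : 0 < u r + √3 * v r := by
      have := mul_pos hf hu
      rwa [add_mul, one_mul, mul_assoc, div_mul_cancel₀ _ hu.ne'] at this
    have h2 : 0 ≤ u r ^ 2 - 3 * v r ^ 2 := by
      have : u r ^ 2 - 3 * v r ^ 2 = (u r + √3 * v r) * (u r - √3 * v r) := by
        linear_combination (-(v r ^ 2)) * (-h3')
      rw [this]
      apply mul_nonneg h1.le
      nlinarith
    have h4 := h.B_pos
    have h5 : u r * v r / r ≤ 0 := div_nonpos_of_nonpos_of_nonneg (by nlinarith) h0.le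
    have : 0 ≤ r * (B * u r * (u r ^ 2 - 3 * v r ^ 2)) := by positivity
    apply mul_nonneg h3.le
    linarith
  · have h1 : Tendsto (fun r => r * (q r * u r)) (𝓝[>] 0) (𝓝 0) := by
      simpa using hid.mul (h.tendsto_zero_q.mul h.tendsto_zero_u)
    have h2 : Tendsto (fun r => r * (v r * p r)) (𝓝[>] 0) (𝓝 0) := by
      apply hid.zero_mul_isBoundedUnder_le (g := fun r => v r * p r) ⟨K * K, ?_⟩
      rw [eventually_map]
      filter_upwards [hev] with r hr
      rw [Function.comp_apply, Real.norm_eq_abs, abs_mul]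
      exact mul_le_mul (hb r hr).2.1 (hb r hr).2.2.1 (abs_nonneg _) hK.le
    have := (h1.sub h2).const_mul √3
    simp only [sub_zero, mul_zero] at this
    exact this.congr fun r => by ring
  · filter_upwards [hev] with r hr
    have hI := Iset_of_le hr₀ hr.1 hr.2.le
    have : v r / u r ≤ 0 := div_nonpos_of_nonpos_of_nonneg (h.v_neg r hI).le (h.u_pos r hI).le
    nlinarith
  · have hT := h.T_pos
    have := ((h.tendsto_end_v.div h.tendsto_end_u (by positivity)).const_mul √3).const_add 1
    have e : 1 + √3 * (-T / (√3 * T)) = 0 := by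
      field_simp
      ring
    rw [e] at this
    exact this

theorem u_sq_le (h : IsProfile a B c T R u v p q) : ∀ r ∈ Iset R, u r ^ 2 ≤ 3 * T ^ 2 := by
  intro r hr
  have h1 := h.sq_add_sq_le r hr
  have h2 := h.u_le_neg_v r hr
  have h3' : √3 ^ 2 = (3 : ℝ) := Real.sq_sqrt (by norm_num)
  have hu := h.u_pos r hr
  have : u r ^ 2 ≤ 3 * v r ^ 2 := by
    have := pow_le_pow_left₀ hu.le h2 2
    rw [neg_sq, mul_pow, h3'] at this
    exact this
  linarith

theorem neg_T_le_v (h : IsProfile a B c T R u v p q) (hcT : c * T ≤ B) :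
    ∀ r ∈ Iset R, -T ≤ v r := by
  obtain ⟨K, hK, r₀, hr₀, hb⟩ := h.exists_origin_bounds
  have hev : ∀ᶠ r in 𝓝[>] (0 : ℝ), r ∈ Ioo 0 r₀ := Ioo_mem_nhdsGT hr₀.1
  have hid : Tendsto (fun r : ℝ => r) (𝓝[>] 0) (𝓝 0) :=
    tendsto_nhdsWithin_of_tendsto_nhds tendsto_id
  have hB := h.B_pos
  have hc := h.c_pos
  have hT := h.T_pos
  have key := nonpos_of_flux_monotone (R := R) (f := fun r => -T - v r) (f' := fun r => -q r)
    (F := fun r => r * -q r)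
    (F' := fun r => -(r * (v r * (-a - B * v r + c * (u r ^ 2 + v r ^ 2)) + B * u r ^ 2)))
    (K := K - T) (l := 0) ?_ ?_ ?_ ?_ ?_ ?_ ?_ le_rfl ?_
  · intro r hr
    linarith [key r hr]
  · intro r hr
    exact (h.hasDerivAt_v r hr).const_sub (-T)
  · intro r hr
    refine ((hasDerivAt_id' r).fun_mul (h.hasDerivAt_q r hr).fun_neg).congr_deriv ?_
    have := hr.1.ne'
    field_simp
    ring
  · intro r hr
    have := hr.1
    have : 0 ≤ r * (q r) ^ 2 := by positivity
    nlinarith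
  · intro r hr hF
    exact nonneg_of_mul_nonneg_right hF hr.1
  · intro r hr hf
    have h0 := hr.1
    have hu := h.u_sq_le r hr
    have hv : v r < -T := by linarith
    rw [← mul_neg]
    apply mul_nonneg h0.le
    have e : v r * (-a - B * v r + c * (u r ^ 2 + v r ^ 2)) + B * u r ^ 2 =
      u r ^ 2 * (c * v r + B) + v r * (c * v r ^ 2 - B * v r - a) := by ring
    rw [e, h.a_eq]
    have huu := sq_nonneg (u r)
    rcases le_or_gt 0 (c * v r + B) with hs | hs
    · have h1 := mul_le_mul_of_nonneg_right hu hs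
      have h2 : 0 ≤ c * v r ^ 2 - (B + c * T) * v r + 3 * B * T := by
        have : 0 ≤ (B + c * T) * (-v r) := by
          have : 0 < -v r := by linarith
          positivity
        nlinarith [mul_nonneg hc.le (sq_nonneg (v r)), mul_pos hB hT]
      have h3 : 0 ≤ (-(v r + T)) * (c * v r ^ 2 - (B + c * T) * v r + 3 * B * T) :=
        mul_nonneg (by linarith) h2
      nlinarith
    · have h1 : u r ^ 2 * (c * v r + B) ≤ 0 := mul_nonpos_of_nonneg_of_nonpos huu hs.le
      have h2 : 0 ≤ c * v r ^ 2 - B * v r - (4 * c * T ^ 2 - 2 * B * T) := by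
        have e1 : T ^ 2 ≤ v r ^ 2 := by nlinarith
        have e2 : T * (c * T) ≤ -v r * B := by
          apply mul_le_mul (by linarith) hcT (by positivity) (by linarith)
        have e3 : T * (c * T) ≤ T * B := by gcongr
        nlinarith [mul_le_mul_of_nonneg_left e1 hc.le]
      have h3 : v r * (c * v r ^ 2 - B * v r - (4 * c * T ^ 2 - 2 * B * T)) ≤ 0 :=
        mul_nonpos_of_nonpos_of_nonneg (by linarith) h2
      linarith
  · simpa using hid.mul h.tendsto_zero_q.neg
  · filter_upwards [hev] with r hr
    have := abs_le.1 (hb r hr).2.1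
    linarith
  · simpa using h.tendsto_end_v.const_sub (-T)

theorem v_le_neg_T (h : IsProfile a B c T R u v p q) (hcT : B ≤ c * T) :
    ∀ r ∈ Iset R, v r ≤ -T := by
  obtain ⟨K, hK, r₀, hr₀, hb⟩ := h.exists_origin_bounds
  have hev : ∀ᶠ r in 𝓝[>] (0 : ℝ), r ∈ Ioo 0 r₀ := Ioo_mem_nhdsGT hr₀.1
  have hid : Tendsto (fun r : ℝ => r) (𝓝[>] 0) (𝓝 0) :=
    tendsto_nhdsWithin_of_tendsto_nhds tendsto_id
  have hB := h.B_pos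
  have hc := h.c_pos
  have hT := h.T_pos
  have key := nonpos_of_flux_monotone (R := R) (f := fun r => v r + T) (f' := fun r => q r)
    (F := fun r => r * q r)
    (F' := fun r => r * (v r * (-a - B * v r + c * (u r ^ 2 + v r ^ 2)) + B * u r ^ 2))
    (K := K + T) (l := 0) ?_ ?_ ?_ ?_ ?_ ?_ ?_ le_rfl ?_
  · intro r hr
    linarith [key r hr]
  · intro r hr
    exact (h.hasDerivAt_v r hr).add_const T
  · intro r hr
    refine ((hasDerivAt_id' r).fun_mul (h.hasDerivAt_q r hr)).congr_deriv ?_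
    have := hr.1.ne'
    field_simp
    ring
  · intro r hr
    have := hr.1
    have : 0 ≤ r * (q r) ^ 2 := by positivity
    nlinarith
  · intro r hr hF
    exact nonneg_of_mul_nonneg_right hF hr.1
  · intro r hr hf
    have h0 := hr.1
    have hu := h.u_sq_le r hr
    have hv : -T < v r := by linarith
    have hv0 := h.v_neg r hr
    apply mul_nonneg h0.le
    have e : v r * (-a - B * v r + c * (u r ^ 2 + v r ^ 2)) + B * u r ^ 2 =
      u r ^ 2 * (c * v r + B) + v r * (c * v r ^ 2 - B * v r - a) := by ring
    rw [e, h.a_eq]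
    have huu := sq_nonneg (u r)
    rcases le_or_gt (c * v r + B) 0 with hs | hs
    · have h1 := mul_le_mul_of_nonpos_right hu hs
      have h2 : 0 ≤ c * v r ^ 2 - (B + c * T) * v r + 3 * B * T := by
        have : 0 ≤ (B + c * T) * (-v r) := by
          have : 0 < -v r := by linarith
          positivity
        nlinarith [mul_nonneg hc.le (sq_nonneg (v r)), mul_pos hB hT]
      have h3 : 0 ≤ (v r + T) * (c * v r ^ 2 - (B + c * T) * v r + 3 * B * T) :=
        mul_nonneg (by linarith) h2
      nlinarith
    · have h1 : 0 ≤ u r ^ 2 * (c * v r + B) := mul_nonneg huu hs.le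
      have h2 : c * v r ^ 2 - B * v r - (4 * c * T ^ 2 - 2 * B * T) ≤ 0 := by
        have e1 : v r ^ 2 ≤ T ^ 2 := by nlinarith
        have e2 : -v r * B ≤ T * (c * T) := by
          apply mul_le_mul (by linarith) hcT (by positivity) (by linarith)
        have e3 : T * B ≤ T * (c * T) := by gcongr
        nlinarith [mul_le_mul_of_nonneg_left e1 hc.le]
      have h3 : 0 ≤ v r * (c * v r ^ 2 - B * v r - (4 * c * T ^ 2 - 2 * B * T)) :=
        mul_nonneg_of_nonpos_of_nonpos hv0.le h2
      linarith
  · simpa using hid.mul h.tendsto_zero_q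
  · filter_upwards [hev] with r hr
    have := abs_le.1 (hb r hr).2.1
    linarith
  · simpa using h.tendsto_end_v.add_const T

end IsProfile

theorem eventually_neg_lt_deriv_of_tendsto_atTop {f g k : ℝ → ℝ} {l δ : ℝ} (hδ : 0 < δ)
    (hf : ∀ r ∈ Ioi (0 : ℝ), HasDerivAt f (g r) r)
    (hg : ∀ r ∈ Ioi (0 : ℝ), HasDerivAt (fun r => r * g r) (r * k r) r)
    (hlim : Tendsto f atTop (𝓝 l)) (hk : Tendsto k atTop (𝓝 0)) :
    ∀ᶠ r in atTop, -δ < g r := by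
  have h1 : ∀ᶠ r in atTop, k r < δ / 3 := hk.eventually_lt_const (by positivity)
  have h2 : ∀ᶠ r in atTop, f r < l + δ / 16 := hlim.eventually_lt_const (by linarith)
  have h3 : ∀ᶠ r in atTop, l - δ / 16 < f r := hlim.eventually_const_lt (by linarith)
  obtain ⟨ρ, hρ⟩ := eventually_atTop.1 (h1.and (h2.and h3))
  filter_upwards [eventually_ge_atTop ρ, eventually_ge_atTop 1] with r₀ hr₀ hr₁
  by_contra! hc
  have hanti : AntitoneOn (fun r => r * g r - δ / 6 * r ^ 2) (Icc r₀ (r₀ + 1)) := by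
    have hd : ∀ r ∈ Icc r₀ (r₀ + 1), HasDerivAt (fun r => r * g r - δ / 6 * r ^ 2)
        (r * (k r - δ / 3)) r := by
      intro r hr
      refine ((hg r (by simp only [mem_Ioi]; linarith [hr.1])).fun_sub
        (((hasDerivAt_id' r).fun_pow 2).const_mul (δ / 6))).congr_deriv ?_
      push_cast; ring
    apply antitoneOn_of_deriv_nonpos (convex_Icc _ _)
    · exact fun r hr => (hd r hr).continuousAt.continuousWithinAt
    · exact fun r hr => (hd r (interior_subset hr)).differentiableAt.differentiableWithinAt
    · intro r hr
      have hr' := interior_subset hr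
      rw [(hd r hr').deriv]
      exact mul_nonpos_of_nonneg_of_nonpos (by linarith [hr'.1])
        (by linarith [(hρ r (by linarith [hr'.1])).1])
  have hgl : ∀ r ∈ Icc r₀ (r₀ + 1), g r ≤ -(δ / 4) := by
    intro r hr
    have h := hanti (left_mem_Icc.2 (by linarith)) hr hr.1
    simp only at h
    have h4 : r * g r ≤ -(δ / 2) * r₀ := by
      have e1 : r₀ * g r₀ ≤ r₀ * -δ := mul_le_mul_of_nonneg_left hc (by linarith)
      have e2 : r ^ 2 - r₀ ^ 2 ≤ 2 * r₀ + 1 := by nlinarith [hr.1, hr.2]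
      have e3 : δ / 6 * (r ^ 2 - r₀ ^ 2) ≤ δ / 6 * (3 * r₀) := by
        apply mul_le_mul_of_nonneg_left _ (by positivity); linarith
      linarith
    by_contra! h5
    have h6 : r * -(δ / 4) < r * g r := mul_lt_mul_of_pos_left h5 (by linarith [hr.1])
    nlinarith [hr.1, hr.2]
  have hmono : AntitoneOn (fun r => f r + δ / 4 * r) (Icc r₀ (r₀ + 1)) := by
    have hd : ∀ r ∈ Icc r₀ (r₀ + 1), HasDerivAt (fun r => f r + δ / 4 * r)
        (g r + δ / 4) r := by
      intro r hr
      refine ((hf r (by simp only [mem_Ioi]; linarith [hr.1])).fun_add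
        ((hasDerivAt_id' r).const_mul (δ / 4))).congr_deriv (by ring)
    apply antitoneOn_of_deriv_nonpos (convex_Icc _ _)
    · exact fun r hr => (hd r hr).continuousAt.continuousWithinAt
    · exact fun r hr => (hd r (interior_subset hr)).differentiableAt.differentiableWithinAt
    · intro r hr
      rw [(hd r (interior_subset hr)).deriv]
      linarith [hgl r (interior_subset hr)]
  have h := hmono (left_mem_Icc.2 (by linarith)) (right_mem_Icc.2 (by linarith))
    (by linarith : r₀ ≤ r₀ + 1)
  simp only at h
  have e1 := (hρ r₀ hr₀).2.1
  have e2 := (hρ (r₀ + 1) (by linarith)).2.2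
  linarith

theorem eventually_neg_lt_deriv_of_tendsto_left {f g k : ℝ → ℝ} {l δ ρ C : ℝ} (hδ : 0 < δ)
    (hρ : 0 < ρ)
    (hf : ∀ r ∈ Ioo 0 ρ, HasDerivAt f (g r) r)
    (hg : ∀ r ∈ Ioo 0 ρ, HasDerivAt (fun r => r * g r) (r * k r) r)
    (hlim : Tendsto f (𝓝[<] ρ) (𝓝 l)) (hk : ∀ᶠ r in 𝓝[<] ρ, k r ≤ C)
    (hle : ∀ r ∈ Ioo 0 ρ, f r ≤ l) :
    ∀ᶠ r in 𝓝[<] ρ, -δ < g r := by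
  obtain ⟨β, hβ, hkβ⟩ := (mem_nhdsLT_iff_exists_Ioo_subset' hρ).1 hk
  have hev : ∀ᶠ r in 𝓝[<] ρ, |C| * ρ * (ρ - r) < δ * r := by
    have hc : Continuous fun r => δ * r - |C| * ρ * (ρ - r) := by fun_prop
    have : ∀ᶠ r in 𝓝 ρ, 0 < δ * r - |C| * ρ * (ρ - r) :=
      hc.continuousAt.eventually (lt_mem_nhds (by simp only [sub_self, mul_zero, sub_zero]; positivity))
    filter_upwards [this.filter_mono nhdsWithin_le_nhds] with r hr
    linarith
  filter_upwards [hev, Ioo_mem_nhdsLT hβ, Ioo_mem_nhdsLT hρ] with r₀ h₀ hr₀β hr₀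
  by_contra! hc
  have hsub : Ico r₀ ρ ⊆ Ioo 0 ρ := fun r hr => ⟨hr₀.1.trans_le hr.1, hr.2⟩
  have hanti : AntitoneOn (fun r => r * g r - |C| * ρ * r) (Ico r₀ ρ) := by
    have hd : ∀ r ∈ Ico r₀ ρ, HasDerivAt (fun r => r * g r - |C| * ρ * r)
        (r * k r - |C| * ρ) r := by
      intro r hr
      refine ((hg r (hsub hr)).fun_sub ((hasDerivAt_id' r).const_mul (|C| * ρ))).congr_deriv ?_
      ring
    apply antitoneOn_of_deriv_nonpos (convex_Ico _ _)
    · exact fun r hr => (hd r hr).continuousAt.continuousWithinAt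
    · exact fun r hr => (hd r (interior_subset hr)).differentiableAt.differentiableWithinAt
    · intro r hr
      have hr' := interior_subset hr
      rw [(hd r hr').deriv]
      have e1 : k r ≤ |C| := (hkβ ⟨hr₀β.1.trans_le hr'.1, hr'.2⟩ : k r ≤ C).trans (le_abs_self C)
      have e2 : r * k r ≤ r * |C| := mul_le_mul_of_nonneg_left e1 (hsub hr').1.le
      have e3 : r * |C| ≤ ρ * |C| := mul_le_mul_of_nonneg_right hr'.2.le (abs_nonneg C)
      linarith
  have hgneg : ∀ r ∈ Ico r₀ ρ, g r < 0 := by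
    intro r hr
    have h := hanti (left_mem_Ico.2 hr₀.2) hr hr.1
    simp only at h
    have e1 : r₀ * g r₀ ≤ r₀ * -δ := mul_le_mul_of_nonneg_left hc hr₀.1.le
    have e2 : |C| * ρ * (r - r₀) ≤ |C| * ρ * (ρ - r₀) :=
      mul_le_mul_of_nonneg_left (by linarith [hr.2]) (by positivity)
    have e3 : r * g r < 0 := by linarith
    exact (pos_iff_neg_of_mul_neg e3).1 (hsub hr).1
  have hmono : StrictAntiOn f (Ico r₀ ρ) := by
    apply strictAntiOn_of_deriv_neg (convex_Ico _ _)
    · exact fun r hr => (hf r (hsub hr)).continuousAt.continuousWithinAt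
    · intro r hr
      rw [(hf r (hsub (interior_subset hr))).deriv]
      exact hgneg r (interior_subset hr)
  obtain ⟨r₁, h01, h1ρ⟩ := exists_between hr₀.2
  have h1 : f r₁ < f r₀ := hmono (left_mem_Ico.2 hr₀.2) ⟨h01.le, h1ρ⟩ h01
  have h2 : l ≤ f r₁ := by
    apply le_of_tendsto hlim
    filter_upwards [Ioo_mem_nhdsLT h1ρ] with r hr
    exact (hmono ⟨h01.le, h1ρ⟩ ⟨(h01.trans hr.1).le, hr.2⟩ hr.1).le
  linarith [hle r₀ hr₀]

/-- If `f` converges at the right end of `(0,R)` and `(r f')' = r k`, then `f'` is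
asymptotically nonnegative there. -/
theorem eventually_neg_lt_deriv_endFilter {R : ℝ≥0∞} {f g k : ℝ → ℝ} {l δ C : ℝ} (hδ : 0 < δ)
    (hR : 0 < R) (hf : ∀ r ∈ Iset R, HasDerivAt f (g r) r)
    (hg : ∀ r ∈ Iset R, HasDerivAt (fun r => r * g r) (r * k r) r)
    (hlim : Tendsto f (endFilter R) (𝓝 l)) (hk : R = ⊤ → Tendsto k (endFilter R) (𝓝 0))
    (hkC : R ≠ ⊤ → ∀ᶠ r in endFilter R, k r ≤ C)
    (hle : ∀ r ∈ Iset R, f r ≤ l) :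
    ∀ᶠ r in endFilter R, -δ < g r := by
  by_cases hT : R = ⊤
  · have hI : ∀ r ∈ Ioi (0 : ℝ), r ∈ Iset R := fun r hr => ⟨hr, by simp [hT]⟩
    have hE : endFilter R = atTop := by simp [endFilter, hT]
    rw [hE] at hlim hk ⊢
    exact eventually_neg_lt_deriv_of_tendsto_atTop hδ (fun r hr => hf r (hI r hr))
      (fun r hr => hg r (hI r hr)) hlim (hk hT)
  · have hI : ∀ r ∈ Ioo 0 R.toReal, r ∈ Iset R := fun r hr => (mem_Iset_of_ne_top hT).2 hr
    have hE : endFilter R = 𝓝[<] R.toReal := by simp [endFilter, hT]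
    have hkC' := hkC hT
    rw [hE] at hlim hkC' ⊢
    exact eventually_neg_lt_deriv_of_tendsto_left hδ (ENNReal.toReal_pos hR.ne' hT)
      (fun r hr => hf r (hI r hr)) (fun r hr => hg r (hI r hr)) hlim hkC'
      (fun r hr => hle r (hI r hr))

namespace IsProfile

variable {a B c T : ℝ} {R : ℝ≥0∞} {u v p q : ℝ → ℝ}

theorem u_le (h : IsProfile a B c T R u v p q) : ∀ r ∈ Iset R, u r ≤ √3 * T := by
  intro r hr
  have hT := h.T_pos
  refine (abs_le.1 (abs_le_of_sq_le_sq (b := √3 * T) ?_ (by positivity))).2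
  rw [mul_pow, Real.sq_sqrt (by norm_num)]
  exact h.u_sq_le r hr

theorem eventually_neg_lt_p (h : IsProfile a B c T R u v p q) {δ : ℝ} (hδ : 0 < δ) :
    ∀ᶠ r in endFilter R, -δ < p r := by
  have hT := h.T_pos
  have h3' : √3 ^ 2 = (3 : ℝ) := Real.sq_sqrt (by norm_num)
  have hh : Tendsto (fun r => u r * (-a + 2 * B * v r + c * (u r ^ 2 + v r ^ 2)))
      (endFilter R) (𝓝 0) := by
    have := h.tendsto_end_u.mul (((h.tendsto_end_v.const_mul (2 * B)).const_add (-a)).add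
      (((h.tendsto_end_u.pow 2).add (h.tendsto_end_v.pow 2)).const_mul c))
    have e : √3 * T * (-a + 2 * B * -T + c * ((√3 * T) ^ 2 + (-T) ^ 2)) = 0 := by
      rw [mul_pow, h3', h.a_eq]; ring
    rwa [e] at this
  obtain ⟨r₁, hr₁⟩ := exists_mem_Iset h.R_pos
  refine eventually_neg_lt_deriv_endFilter (f := u) (C := √3 * T / r₁ ^ 2 + 1)
    (k := fun r => u r / r ^ 2 + u r * (-a + 2 * B * v r + c * (u r ^ 2 + v r ^ 2)))
    hδ h.R_pos h.hasDerivAt_u ?_ h.tendsto_end_u ?_ ?_ ?_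
  · intro r hr
    refine ((hasDerivAt_id' r).fun_mul (h.hasDerivAt_p r hr)).congr_deriv ?_
    have := hr.1.ne'
    field_simp
    ring
  · intro hR
    have h1 : Tendsto (fun r => u r / r ^ 2) (endFilter R) (𝓝 0) := by
      have : Tendsto (fun r : ℝ => r ^ 2) (endFilter R) atTop := by
        simp only [endFilter, hR, if_true]
        exact tendsto_pow_atTop two_ne_zero
      exact h.tendsto_end_u.div_atTop this
    simpa using h1.add hh
  · intro _
    filter_upwards [hh.eventually_lt_const one_pos, eventually_endFilter hr₁] with r h1 h2
    have hu := h.u_le r h2.1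
    have hr1 : 0 < r₁ := hr₁.1
    have : u r / r ^ 2 ≤ √3 * T / r₁ ^ 2 := by
      gcongr
      exact h2.2.le
    linarith
  · exact h.u_le

theorem eventually_neg_lt_mul_q (h : IsProfile a B c T R u v p q) {δ σ : ℝ} (hδ : 0 < δ)
    (hσ : ∀ r ∈ Iset R, σ * v r ≤ σ * -T) :
    ∀ᶠ r in endFilter R, -δ < σ * q r := by
  have h3' : √3 ^ 2 = (3 : ℝ) := Real.sq_sqrt (by norm_num)
  have hh : Tendsto (fun r => σ * (v r * (-a - B * v r + c * (u r ^ 2 + v r ^ 2)) + B * u r ^ 2))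
      (endFilter R) (𝓝 0) := by
    have := ((h.tendsto_end_v.mul (((h.tendsto_end_v.const_mul B).const_sub (-a)).add
      (((h.tendsto_end_u.pow 2).add (h.tendsto_end_v.pow 2)).const_mul c))).add
      ((h.tendsto_end_u.pow 2).const_mul B)).const_mul σ
    have e : σ * (-T * (-a - B * -T + c * ((√3 * T) ^ 2 + (-T) ^ 2)) + B * (√3 * T) ^ 2) = 0 := by
      rw [mul_pow, h3', h.a_eq]; ring
    rwa [e] at this
  refine eventually_neg_lt_deriv_endFilter (f := fun r => σ * v r) (C := 1)
    (k := fun r => σ * (v r * (-a - B * v r + c * (u r ^ 2 + v r ^ 2)) + B * u r ^ 2))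
    hδ h.R_pos (fun r hr => (h.hasDerivAt_v r hr).const_mul σ) ?_
    (h.tendsto_end_v.const_mul σ) (fun _ => hh) (fun _ => ?_) hσ
  · intro r hr
    refine ((hasDerivAt_id' r).fun_mul ((h.hasDerivAt_q r hr).const_mul σ)).congr_deriv ?_
    have := hr.1.ne'
    field_simp
    ring
  · filter_upwards [hh.eventually_lt_const one_pos] with r h1
    exact h1.le

end IsProfile

/-- Nonnegativity of the second variation of the profile energy, in normalized parameters and
with explicit derivatives of the test functions. -/
def ProfileStable (a B c : ℝ) (R : ℝ≥0∞) (u v : ℝ → ℝ) : Prop :=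
  ∀ (α β : ℝ) (ξ η ξ' η' : ℝ → ℝ), α ∈ Iset R → β ∈ Iset R → α ≤ β →
    (∀ r, HasDerivAt ξ (ξ' r) r) → (∀ r, HasDerivAt η (η' r) r) →
    Continuous ξ' → Continuous η' →
    (∀ r, r ∉ Icc α β → ξ r = 0) → (∀ r, r ∉ Icc α β → η r = 0) →
    0 ≤ ∫ r in α..β, (ξ' r ^ 2 + ξ r ^ 2 / r ^ 2 + η' r ^ 2
      + (-a + 2 * B * v r + c * (3 * u r ^ 2 + v r ^ 2)) * ξ r ^ 2
      + (-a - 2 * B * v r + c * (u r ^ 2 + 3 * v r ^ 2)) * η r ^ 2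
      + 4 * u r * ξ r * η r * (B + c * v r)) * r

theorem hasDerivAt_indicator {I K : Set ℝ} (hI : IsOpen I) (hK : IsClosed K) (hKI : K ⊆ I)
    {f f' : ℝ → ℝ} (hf : ∀ r ∈ I, HasDerivAt f (f' r) r) (hz : ∀ r ∈ I, r ∉ K → f r = 0)
    (r : ℝ) : HasDerivAt (K.indicator f) (K.indicator f' r) r := by
  by_cases hr : r ∈ K
  · rw [indicator_of_mem hr]
    refine (hf r (hKI hr)).congr_of_eventuallyEq ?_
    filter_upwards [hI.mem_nhds (hKI hr)] with s hs
    by_cases hsK : s ∈ K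
    · rw [indicator_of_mem hsK]
    · rw [indicator_of_notMem hsK, hz s hs hsK]
  · rw [indicator_of_notMem hr]
    refine (hasDerivAt_const r (0 : ℝ)).congr_of_eventuallyEq ?_
    filter_upwards [hK.isOpen_compl.mem_nhds hr] with s hs
    rw [indicator_of_notMem hs]

theorem continuous_indicator_deriv {I K : Set ℝ} (hI : IsOpen I) (hK : IsClosed K) (hKI : K ⊆ I)
    {f f' : ℝ → ℝ} (hf : ∀ r ∈ I, HasDerivAt f (f' r) r) (hz : ∀ r ∈ I, r ∉ K → f r = 0)
    (hf' : ContinuousOn f' I) : Continuous (K.indicator f') := by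
  have hz' : ∀ r ∈ I, r ∉ K → f' r = 0 := by
    intro r hr hrK
    have h1 := hasDerivAt_indicator hI hK hKI hf hz r
    rw [indicator_of_notMem hrK] at h1
    refine (hf r hr).unique (h1.congr_of_eventuallyEq ?_)
    filter_upwards [hI.mem_nhds hr] with s hs
    by_cases hsK : s ∈ K
    · rw [indicator_of_mem hsK]
    · rw [indicator_of_notMem hsK, hz s hs hsK]
  rw [continuous_iff_continuousAt]
  intro r
  by_cases hr : r ∈ K
  · refine (hf'.continuousAt (hI.mem_nhds (hKI hr))).congr ?_
    filter_upwards [hI.mem_nhds (hKI hr)] with s hs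
    by_cases hsK : s ∈ K
    · rw [indicator_of_mem hsK]
    · rw [indicator_of_notMem hsK, hz' s hs hsK]
  · refine (continuousAt_const (y := (0 : ℝ))).congr ?_
    filter_upwards [hK.isOpen_compl.mem_nhds hr] with s hs
    rw [indicator_of_notMem hs]

/-- A `C¹` regularization of the positive part, evaluated at `x ≥ 0`. -/
def softPos (ε x : ℝ) : ℝ := x ^ 2 / (x + ε)

/-- The derivative of `softPos`. -/
def softPosDeriv (ε x : ℝ) : ℝ := (x ^ 2 + 2 * x * ε) / (x + ε) ^ 2

theorem hasDerivAt_softPos {ε : ℝ} (hε : 0 < ε) (x : ℝ) (hx : 0 ≤ x) :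
    HasDerivAt (softPos ε) (softPosDeriv ε x) x := by
  have h : x + ε ≠ 0 := by positivity
  refine (((hasDerivAt_id' x).fun_pow 2).fun_div ((hasDerivAt_id' x).add_const ε) h).congr_deriv ?_
  unfold softPosDeriv
  congr 1
  push_cast
  ring

theorem hasDerivAt_softPosDeriv {ε : ℝ} (hε : 0 < ε) (x : ℝ) (hx : 0 ≤ x) :
    HasDerivAt (softPosDeriv ε) (2 * ε ^ 2 / (x + ε) ^ 3) x := by
  have h : x + ε ≠ 0 := by positivity
  refine ((((hasDerivAt_id' x).fun_pow 2).fun_add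
    (((hasDerivAt_id' x).const_mul 2).mul_const ε)).fun_div
    (((hasDerivAt_id' x).add_const ε).fun_pow 2) (pow_ne_zero 2 h)).congr_deriv ?_
  field_simp
  push_cast
  ring

theorem softPos_nonneg {ε x : ℝ} (hε : 0 < ε) (hx : 0 ≤ x) : 0 ≤ softPos ε x := by
  unfold softPos; positivity

theorem softPosDeriv_nonneg {ε x : ℝ} (hε : 0 < ε) (hx : 0 ≤ x) : 0 ≤ softPosDeriv ε x := by
  unfold softPosDeriv; positivity

theorem softPos_le {ε x : ℝ} (hε : 0 < ε) (hx : 0 ≤ x) : softPos ε x ≤ x := by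
  unfold softPos
  rw [div_le_iff₀ (by positivity)]
  nlinarith

theorem softPosDeriv_le_one {ε x : ℝ} (hε : 0 < ε) (hx : 0 ≤ x) : softPosDeriv ε x ≤ 1 := by
  unfold softPosDeriv
  rw [div_le_iff₀ (by positivity)]
  nlinarith

theorem tendsto_softPos {x : ℝ} (hx : 0 ≤ x) :
    Tendsto (fun ε => softPos ε x) (𝓝[>] 0) (𝓝 x) := by
  rcases hx.eq_or_lt with rfl | hx
  · simp [softPos]
  · have : Tendsto (fun ε => x ^ 2 / (x + ε)) (𝓝 0) (𝓝 (x ^ 2 / (x + 0))) := by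
      apply Tendsto.div tendsto_const_nhds (tendsto_const_nhds.add tendsto_id)
      simpa using hx.ne'
    have e : x ^ 2 / (x + 0) = x := by field_simp; ring
    rw [e] at this
    exact this.mono_left nhdsWithin_le_nhds

theorem tendsto_softPos_mul_deriv {x : ℝ} (hx : 0 ≤ x) :
    Tendsto (fun ε => softPos ε x * softPosDeriv ε x) (𝓝[>] 0) (𝓝 x) := by
  rcases hx.eq_or_lt with rfl | hx
  · simp [softPos]
  · have : Tendsto (fun ε => (x ^ 2 + 2 * x * ε) / (x + ε) ^ 2) (𝓝 0)
        (𝓝 ((x ^ 2 + 2 * x * 0) / (x + 0) ^ 2)) := by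
      apply Tendsto.div (tendsto_const_nhds.add (tendsto_const_nhds.mul tendsto_id))
        ((tendsto_const_nhds.add tendsto_id).pow 2)
      simpa using hx.ne'
    have e : (x ^ 2 + 2 * x * 0) / (x + 0) ^ 2 = 1 := by field_simp; ring
    rw [e] at this
    simpa [softPosDeriv] using (tendsto_softPos hx.le).mul (this.mono_left nhdsWithin_le_nhds)

theorem hasDerivAt_softPos_comp {ε : ℝ} (hε : 0 < ε) {X : ℝ → ℝ} {X' r : ℝ}
    (hX : HasDerivAt X X' r) :
    HasDerivAt (fun r => softPos ε (max (X r) 0)) (softPosDeriv ε (max (X r) 0) * X') r :=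
  (hasDerivAt_comp_max_zero (hasDerivAt_softPos hε) (by simp [softPosDeriv]) (X r)).comp r hX

theorem continuousOn_softPos {ε : ℝ} (hε : 0 < ε) {X : ℝ → ℝ} {s : Set ℝ}
    (hX : ContinuousOn X s) : ContinuousOn (fun r => softPos ε (max (X r) 0)) s := by
  have h1 : ContinuousOn (fun r => max (X r) 0) s := hX.sup continuousOn_const
  exact (h1.pow 2).div (h1.add continuousOn_const) fun r _ => by
    have := le_max_right (X r) 0
    positivity

theorem continuousOn_softPosDeriv {ε : ℝ} (hε : 0 < ε) {X : ℝ → ℝ} {s : Set ℝ}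
    (hX : ContinuousOn X s) : ContinuousOn (fun r => softPosDeriv ε (max (X r) 0)) s := by
  have h1 : ContinuousOn (fun r => max (X r) 0) s := hX.sup continuousOn_const
  exact ((h1.pow 2).add ((continuousOn_const.mul h1).mul continuousOn_const)).div
    ((h1.add continuousOn_const).pow 2) fun r _ => by
    have := le_max_right (X r) 0
    positivity

theorem integral_softPos_deriv_sq_le {ε α β : ℝ} (hε : 0 < ε) (hα : 0 < α) (hαβ : α ≤ β)
    {X X' S : ℝ → ℝ} (hX : ∀ r ∈ Icc α β, HasDerivAt X (X' r) r)
    (hS : ∀ r ∈ Icc α β, HasDerivAt (fun r => r * X' r) (S r) r)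
    (hX'c : ContinuousOn X' (Icc α β)) (hSc : ContinuousOn S (Icc α β))
    (hXα : X α ≤ 0) (hXβ : X β ≤ 0) :
    ∫ r in α..β, r * (softPosDeriv ε (max (X r) 0) * X' r) ^ 2 ≤
      ∫ r in α..β, -(softPos ε (max (X r) 0) * softPosDeriv ε (max (X r) 0) * S r) := by
  have hXc : ContinuousOn X (Icc α β) := fun r hr => (hX r hr).continuousAt.continuousWithinAt
  have hXpc : ContinuousOn (fun r => max (X r) 0) (Icc α β) := hXc.sup continuousOn_const
  have c1 := continuousOn_softPos hε hXc
  have c2 := continuousOn_softPosDeriv hε hXc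
  have c3 : ContinuousOn (fun r => 2 * ε ^ 2 / (max (X r) 0 + ε) ^ 3) (Icc α β) :=
    continuousOn_const.div ((hXpc.add continuousOn_const).pow 3) fun r _ => by
      have := le_max_right (X r) 0
      positivity
  have hd : ∀ r ∈ uIcc α β, HasDerivAt
      (fun r => softPos ε (max (X r) 0) * softPosDeriv ε (max (X r) 0) * (r * X' r))
      ((softPosDeriv ε (max (X r) 0) * softPosDeriv ε (max (X r) 0) +
        softPos ε (max (X r) 0) * (2 * ε ^ 2 / (max (X r) 0 + ε) ^ 3)) * X' r * (r * X' r) +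
        softPos ε (max (X r) 0) * softPosDeriv ε (max (X r) 0) * S r) r := by
    rw [uIcc_of_le hαβ]
    intro r hr
    have h1 := (hasDerivAt_comp_max_zero (F := fun x => softPos ε x * softPosDeriv ε x)
      (F' := fun x => softPosDeriv ε x * softPosDeriv ε x +
        softPos ε x * (2 * ε ^ 2 / (x + ε) ^ 3))
      (fun x hx => (hasDerivAt_softPos hε x hx).fun_mul (hasDerivAt_softPosDeriv hε x hx))
      (by simp [softPosDeriv, softPos]) (X r)).comp r (hX r hr)
    exact h1.fun_mul (hS r hr)
  have hcont1 : ContinuousOn (fun r => (softPosDeriv ε (max (X r) 0) * softPosDeriv ε (max (X r) 0) +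
        softPos ε (max (X r) 0) * (2 * ε ^ 2 / (max (X r) 0 + ε) ^ 3)) * X' r * (r * X' r))
      (uIcc α β) := by
    rw [uIcc_of_le hαβ]
    exact (((c2.mul c2).add (c1.mul c3)).mul hX'c).mul (continuousOn_id.mul hX'c)
  have hcont2 : ContinuousOn (fun r =>
        softPos ε (max (X r) 0) * softPosDeriv ε (max (X r) 0) * S r) (uIcc α β) := by
    rw [uIcc_of_le hαβ]
    exact (c1.mul c2).mul hSc
  have hint := intervalIntegral.integral_eq_sub_of_hasDerivAt hd
    (hcont1.add hcont2).intervalIntegrable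
  rw [intervalIntegral.integral_add hcont1.intervalIntegrable hcont2.intervalIntegrable,
    max_eq_right hXα, max_eq_right hXβ] at hint
  have s0 : softPos ε 0 = 0 := by simp [softPos]
  rw [s0, zero_mul, zero_mul, zero_mul, sub_self] at hint
  rw [intervalIntegral.integral_neg, ← sub_nonneg]
  have hle : ∫ r in α..β, r * (softPosDeriv ε (max (X r) 0) * X' r) ^ 2 ≤
      ∫ r in α..β, (softPosDeriv ε (max (X r) 0) * softPosDeriv ε (max (X r) 0) +
        softPos ε (max (X r) 0) * (2 * ε ^ 2 / (max (X r) 0 + ε) ^ 3)) * X' r * (r * X' r) := by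
    apply intervalIntegral.integral_mono_on hαβ _ hcont1.intervalIntegrable
    · intro r hr
      have h0 : 0 < r := hα.trans_le hr.1
      have h1 := le_max_right (X r) 0
      have h2 := softPos_nonneg hε h1
      have : 0 ≤ softPos ε (max (X r) 0) * (2 * ε ^ 2 / (max (X r) 0 + ε) ^ 3) * (r * X' r ^ 2) := by
        positivity
      linarith
    · apply ContinuousOn.intervalIntegrable
      rw [uIcc_of_le hαβ]
      exact continuousOn_id.mul ((c2.mul hX'c).pow 2)
  linarith


/-- Testing the stability inequality with (regularized) positive parts of functions whose fluxes
are controlled. -/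
theorem ProfileStable.integral_posPart_nonneg {a B c : ℝ} {R : ℝ≥0∞} {u v : ℝ → ℝ}
    (hst : ProfileStable a B c R u v) (huc : ContinuousOn u (Iset R))
    (hvc : ContinuousOn v (Iset R)) {τ : ℝ} (hτ : τ ^ 2 = 1) {W : ℝ → ℝ}
    (hW : ∀ r ∈ Iset R, 2 * u r * (B + c * v r) = τ * W r) {α β : ℝ} (hα : α ∈ Iset R)
    (hβ : β ∈ Iset R) (hαβ : α ≤ β) {X X' S Z Z' S₂ : ℝ → ℝ}
    (hX : ∀ r ∈ Iset R, HasDerivAt X (X' r) r) (hZ : ∀ r ∈ Iset R, HasDerivAt Z (Z' r) r)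
    (hS : ∀ r ∈ Iset R, HasDerivAt (fun r => r * X' r) (S r) r)
    (hS₂ : ∀ r ∈ Iset R, HasDerivAt (fun r => r * Z' r) (S₂ r) r)
    (hX'c : ContinuousOn X' (Iset R)) (hZ'c : ContinuousOn Z' (Iset R))
    (hSc : ContinuousOn S (Iset R)) (hS₂c : ContinuousOn S₂ (Iset R))
    (hX0 : ∀ r ∈ Iset R, r ∉ Ioo α β → X r ≤ 0) (hZ0 : ∀ r ∈ Iset R, r ∉ Ioo α β → Z r ≤ 0) :
    0 ≤ ∫ r in α..β, (-(max (X r) 0 * S r) + -(max (Z r) 0 * S₂ r) +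
      (max (X r) 0 ^ 2 / r ^ 2
        + (-a + 2 * B * v r + c * (3 * u r ^ 2 + v r ^ 2)) * max (X r) 0 ^ 2
        + (-a - 2 * B * v r + c * (u r ^ 2 + 3 * v r ^ 2)) * max (Z r) 0 ^ 2
        - 2 * W r * max (X r) 0 * max (Z r) 0) * r) := by
  have hsub : Icc α β ⊆ Iset R := Icc_subset_Iset hα hβ
  have hα0 : 0 < α := hα.1
  have hXc : ContinuousOn X (Iset R) := fun r hr => (hX r hr).continuousAt.continuousWithinAt
  have hZc : ContinuousOn Z (Iset R) := fun r hr => (hZ r hr).continuousAt.continuousWithinAt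
  set A : ℝ → ℝ := fun r => -a + 2 * B * v r + c * (3 * u r ^ 2 + v r ^ 2) with hA
  set D : ℝ → ℝ := fun r => -a - 2 * B * v r + c * (u r ^ 2 + 3 * v r ^ 2) with hD
  have hAc : ContinuousOn A (Iset R) := by fun_prop
  have hDc : ContinuousOn D (Iset R) := by fun_prop
  have hWc : ContinuousOn W (Iset R) := by
    have : ContinuousOn (fun r => τ * (2 * u r * (B + c * v r))) (Iset R) := by fun_prop
    refine this.congr fun r hr => ?_
    simp only
    rw [hW r hr, ← mul_assoc, ← sq, hτ, one_mul]
  -- the regularized integrand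
  let G : ℝ → ℝ → ℝ := fun ε r =>
    -(softPos ε (max (X r) 0) * softPosDeriv ε (max (X r) 0) * S r) +
    -(softPos ε (max (Z r) 0) * softPosDeriv ε (max (Z r) 0) * S₂ r) +
      (softPos ε (max (X r) 0) ^ 2 / r ^ 2 + A r * softPos ε (max (X r) 0) ^ 2
        + D r * softPos ε (max (Z r) 0) ^ 2
        - 2 * W r * softPos ε (max (X r) 0) * softPos ε (max (Z r) 0)) * r
  have hinv : ContinuousOn (fun r : ℝ => r ^ 2) (Icc α β) := by fun_prop
  have hinv0 : ∀ r ∈ Icc α β, r ^ 2 ≠ 0 := fun r hr =>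
    pow_ne_zero 2 (hα0.trans_le hr.1).ne'
  have hGc : ∀ ε, 0 < ε → ContinuousOn (G ε) (Icc α β) := by
    intro ε hε
    have c1 := (continuousOn_softPos hε hXc).mono hsub
    have c2 := (continuousOn_softPosDeriv hε hXc).mono hsub
    have c3 := (continuousOn_softPos hε hZc).mono hsub
    have c4 := (continuousOn_softPosDeriv hε hZc).mono hsub
    exact (((c1.mul c2).mul (hSc.mono hsub)).neg.add ((c3.mul c4).mul (hS₂c.mono hsub)).neg).add
      ((((((c1.pow 2).div hinv hinv0).add ((hAc.mono hsub).mul (c1.pow 2))).add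
        ((hDc.mono hsub).mul (c3.pow 2))).sub
        (((continuousOn_const.mul (hWc.mono hsub)).mul c1).mul c3)).mul continuousOn_id)
  have hpos : ∀ ε, 0 < ε → 0 ≤ ∫ r in α..β, G ε r := by
    intro ε hε
    have s0 : softPos ε 0 = 0 := by simp [softPos]
    have zX : ∀ r ∈ Iset R, r ∉ Icc α β → softPos ε (max (X r) 0) = 0 := fun r hr hr' => by
      rw [max_eq_right (hX0 r hr fun h => hr' (Ioo_subset_Icc_self h)), s0]
    have zZ : ∀ r ∈ Iset R, r ∉ Icc α β → -τ * softPos ε (max (Z r) 0) = 0 := fun r hr hr' => by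
      rw [max_eq_right (hZ0 r hr fun h => hr' (Ioo_subset_Icc_self h)), s0, mul_zero]
    have dX : ∀ r ∈ Iset R, HasDerivAt (fun r => softPos ε (max (X r) 0))
      (softPosDeriv ε (max (X r) 0) * X' r) r := fun r hr => hasDerivAt_softPos_comp hε (hX r hr)
    have dZ : ∀ r ∈ Iset R, HasDerivAt (fun r => -τ * softPos ε (max (Z r) 0))
      (-τ * (softPosDeriv ε (max (Z r) 0) * Z' r)) r := fun r hr =>
      (hasDerivAt_softPos_comp hε (hZ r hr)).const_mul (-τ)
    have cX : ContinuousOn (fun r => softPosDeriv ε (max (X r) 0) * X' r) (Iset R) :=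
      (continuousOn_softPosDeriv hε hXc).mul hX'c
    have cZ : ContinuousOn (fun r => softPosDeriv ε (max (Z r) 0) * Z' r) (Iset R) :=
      (continuousOn_softPosDeriv hε hZc).mul hZ'c
    have cZ' : ContinuousOn (fun r => -τ * (softPosDeriv ε (max (Z r) 0) * Z' r)) (Iset R) :=
      continuousOn_const.mul cZ
    have key := hst α β _ _ _ _ hα hβ hαβ
      (hasDerivAt_indicator (isOpen_Iset R) isClosed_Icc hsub dX zX)
      (hasDerivAt_indicator (isOpen_Iset R) isClosed_Icc hsub dZ zZ)
      (continuous_indicator_deriv (isOpen_Iset R) isClosed_Icc hsub dX zX cX)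
      (continuous_indicator_deriv (isOpen_Iset R) isClosed_Icc hsub dZ zZ cZ')
      (fun r hr => indicator_of_notMem hr _) (fun r hr => indicator_of_notMem hr _)
    have nα : α ∉ Ioo α β := by simp
    have nβ : β ∉ Ioo α β := by simp
    have i1 := integral_softPos_deriv_sq_le hε hα0 hαβ (fun r hr => hX r (hsub hr))
      (fun r hr => hS r (hsub hr)) (hX'c.mono hsub) (hSc.mono hsub) (hX0 α hα nα) (hX0 β hβ nβ)
    have i2 := integral_softPos_deriv_sq_le hε hα0 hαβ (fun r hr => hZ r (hsub hr))
      (fun r hr => hS₂ r (hsub hr)) (hZ'c.mono hsub) (hS₂c.mono hsub) (hZ0 α hα nα) (hZ0 β hβ nβ)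
    have c1 := (continuousOn_softPos hε hXc).mono hsub
    have c3 := (continuousOn_softPos hε hZc).mono hsub
    have hU : uIcc α β = Icc α β := uIcc_of_le hαβ
    have ii1 : IntervalIntegrable (fun r => r * (softPosDeriv ε (max (X r) 0) * X' r) ^ 2)
        volume α β := by
      apply ContinuousOn.intervalIntegrable
      rw [hU]
      exact continuousOn_id.mul ((cX.mono hsub).pow 2)
    have ii2 : IntervalIntegrable (fun r => r * (softPosDeriv ε (max (Z r) 0) * Z' r) ^ 2)
        volume α β := by
      apply ContinuousOn.intervalIntegrable
      rw [hU]
      exact continuousOn_id.mul ((cZ.mono hsub).pow 2)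
    have ii3 : IntervalIntegrable (fun r => (softPos ε (max (X r) 0) ^ 2 / r ^ 2
        + A r * softPos ε (max (X r) 0) ^ 2 + D r * softPos ε (max (Z r) 0) ^ 2
        - 2 * W r * softPos ε (max (X r) 0) * softPos ε (max (Z r) 0)) * r) volume α β := by
      apply ContinuousOn.intervalIntegrable
      rw [hU]
      exact ((((((c1.pow 2).div hinv hinv0).add ((hAc.mono hsub).mul (c1.pow 2))).add
        ((hDc.mono hsub).mul (c3.pow 2))).sub
        (((continuousOn_const.mul (hWc.mono hsub)).mul c1).mul c3)).mul continuousOn_id)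
    have ii4 : IntervalIntegrable (fun r => -(softPos ε (max (X r) 0) *
        softPosDeriv ε (max (X r) 0) * S r)) volume α β := by
      apply ContinuousOn.intervalIntegrable
      rw [hU]
      exact ((c1.mul ((continuousOn_softPosDeriv hε hXc).mono hsub)).mul (hSc.mono hsub)).neg
    have ii5 : IntervalIntegrable (fun r => -(softPos ε (max (Z r) 0) *
        softPosDeriv ε (max (Z r) 0) * S₂ r)) volume α β := by
      apply ContinuousOn.intervalIntegrable
      rw [hU]
      exact ((c3.mul ((continuousOn_softPosDeriv hε hZc).mono hsub)).mul (hS₂c.mono hsub)).neg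
    have e : ∫ r in α..β, G ε r =
        ((∫ r in α..β, -(softPos ε (max (X r) 0) * softPosDeriv ε (max (X r) 0) * S r)) +
        ∫ r in α..β, -(softPos ε (max (Z r) 0) * softPosDeriv ε (max (Z r) 0) * S₂ r)) +
        ∫ r in α..β, (softPos ε (max (X r) 0) ^ 2 / r ^ 2
        + A r * softPos ε (max (X r) 0) ^ 2 + D r * softPos ε (max (Z r) 0) ^ 2
        - 2 * W r * softPos ε (max (X r) 0) * softPos ε (max (Z r) 0)) * r := by
      rw [← intervalIntegral.integral_add ii4 ii5, ← intervalIntegral.integral_add (ii4.add ii5) ii3]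
    rw [e]
    refine key.trans ?_
    refine le_trans (le_of_eq ?_) (add_le_add (add_le_add i1 i2) le_rfl)
    rw [← intervalIntegral.integral_add ii1 ii2, ← intervalIntegral.integral_add (ii1.add ii2) ii3]
    apply intervalIntegral.integral_congr
    rw [hU]
    intro r hr
    simp only [indicator_of_mem hr]
    linear_combination (softPosDeriv ε (max (Z r) 0) ^ 2 * Z' r ^ 2 * r +
      D r * softPos ε (max (Z r) 0) ^ 2 * r -
      2 * W r * softPos ε (max (X r) 0) * softPos ε (max (Z r) 0) * r) * hτ -
      2 * r * τ * softPos ε (max (X r) 0) * softPos ε (max (Z r) 0) * hW r (hsub hr)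
  have hlim : Tendsto (fun ε => ∫ r in α..β, G ε r) (𝓝[>] 0)
      (𝓝 (∫ r in α..β, (-(max (X r) 0 * S r) + -(max (Z r) 0 * S₂ r) +
      (max (X r) 0 ^ 2 / r ^ 2 + A r * max (X r) 0 ^ 2 + D r * max (Z r) 0 ^ 2
        - 2 * W r * max (X r) 0 * max (Z r) 0) * r))) := by
    have pX : ContinuousOn (fun r => max (X r) 0) (Icc α β) :=
      (hXc.mono hsub).sup continuousOn_const
    have pZ : ContinuousOn (fun r => max (Z r) 0) (Icc α β) :=
      (hZc.mono hsub).sup continuousOn_const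
    apply intervalIntegral.tendsto_integral_filter_of_dominated_convergence
      (fun r => max (X r) 0 * |S r| + max (Z r) 0 * |S₂ r| +
      (max (X r) 0 ^ 2 / r ^ 2 + |A r| * max (X r) 0 ^ 2 + |D r| * max (Z r) 0 ^ 2
        + 2 * |W r| * max (X r) 0 * max (Z r) 0) * r)
    · filter_upwards [self_mem_nhdsWithin] with ε hε
      exact ((hGc ε hε).mono (by rw [uIoc_of_le hαβ]; exact Ioc_subset_Icc_self)).aestronglyMeasurable
        measurableSet_uIoc
    · filter_upwards [self_mem_nhdsWithin] with ε hε
      refine Eventually.of_forall fun r hr => ?_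
      rw [uIoc_of_le hαβ] at hr
      have hr0 : 0 < r := hα0.trans hr.1
      have h1 := le_max_right (X r) 0
      have h2 := le_max_right (Z r) 0
      have a1 := softPos_nonneg hε h1
      have a2 := softPos_nonneg hε h2
      have b1 := softPosDeriv_nonneg hε h1
      have b2 := softPosDeriv_nonneg hε h2
      have d1 := softPos_le hε h1
      have d2 := softPos_le hε h2
      have e1 : softPos ε (max (X r) 0) * softPosDeriv ε (max (X r) 0) ≤ max (X r) 0 :=
        (mul_le_of_le_one_right a1 (softPosDeriv_le_one hε h1)).trans d1
      have e2 : softPos ε (max (Z r) 0) * softPosDeriv ε (max (Z r) 0) ≤ max (Z r) 0 :=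
        (mul_le_of_le_one_right a2 (softPosDeriv_le_one hε h2)).trans d2
      simp only [G, Real.norm_eq_abs]
      refine (abs_add_le _ _).trans (add_le_add ((abs_add_le _ _).trans (add_le_add ?_ ?_)) ?_)
      · rw [abs_neg, abs_mul, abs_of_nonneg (mul_nonneg a1 b1)]
        gcongr
      · rw [abs_neg, abs_mul, abs_of_nonneg (mul_nonneg a2 b2)]
        gcongr
      · rw [abs_mul, abs_of_pos hr0]
        gcongr
        refine (abs_sub _ _).trans (add_le_add ((abs_add_le _ _).trans (add_le_add
          ((abs_add_le _ _).trans (add_le_add ?_ ?_)) ?_)) ?_)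
        · rw [abs_of_nonneg (by positivity)]
          gcongr
        · rw [abs_mul, abs_of_nonneg (sq_nonneg (softPos _ _))]
          gcongr
        · rw [abs_mul, abs_of_nonneg (sq_nonneg (softPos _ _))]
          gcongr
        · rw [abs_mul, abs_mul, abs_mul, abs_of_nonneg a1, abs_of_nonneg a2, abs_two]
          gcongr
    · apply ContinuousOn.intervalIntegrable
      rw [uIcc_of_le hαβ]
      exact ((pX.mul (hSc.mono hsub).abs).add (pZ.mul (hS₂c.mono hsub).abs)).add
        ((((((pX.pow 2).div hinv hinv0).add ((hAc.mono hsub).abs.mul (pX.pow 2))).add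
        ((hDc.mono hsub).abs.mul (pZ.pow 2))).add
        (((continuousOn_const.mul (hWc.mono hsub).abs).mul pX).mul pZ)).mul continuousOn_id)
    · refine Eventually.of_forall fun r _ => ?_
      have t1 := tendsto_softPos (le_max_right (X r) 0)
      have t2 := tendsto_softPos (le_max_right (Z r) 0)
      have t3 := tendsto_softPos_mul_deriv (le_max_right (X r) 0)
      have t4 := tendsto_softPos_mul_deriv (le_max_right (Z r) 0)
      exact ((t3.mul_const (S r)).neg.add (t4.mul_const (S₂ r)).neg).add
        ((((((t1.pow 2).div_const (r ^ 2)).add ((t1.pow 2).const_mul (A r))).add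
        ((t2.pow 2).const_mul (D r))).sub ((t1.const_mul (2 * W r)).mul t2)).mul_const r)
  refine ge_of_tendsto hlim ?_
  filter_upwards [self_mem_nhdsWithin] with ε hε
  exact hpos ε hε

theorem cooperative_pointwise_bound {r u A D W P Y δ m₁ m₂ x z : ℝ} (hr : 0 < r) (hu : 0 ≤ u)
    (hW : 0 ≤ W) (hδ : 0 ≤ δ) (hm₁ : 0 ≤ m₁) (hm₂ : 0 ≤ m₂)
    (hx : x = max (P - δ * m₁) 0) (hz : z = max (Y - δ * m₂) 0) :
    -(x * (2 * P / r + r * (A * P) - r * (W * Y) + 2 * u / r ^ 2)) +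
      -(z * (Y / r + r * (D * Y) - r * (W * P))) +
      (x ^ 2 / r ^ 2 + A * x ^ 2 + D * z ^ 2 - 2 * W * x * z) * r ≤
    -((x ^ 2 + z ^ 2) / r) +
      δ * (r * (x * (W * m₂ - A * m₁) + z * (W * m₁ - D * m₂))) := by
  have hx0 : 0 ≤ x := hx ▸ le_max_right _ _
  have hz0 : 0 ≤ z := hz ▸ le_max_right _ _
  have h1 : x * P = x ^ 2 + δ * m₁ * x := by
    rcases le_total (P - δ * m₁) 0 with h | h
    · rw [max_eq_right h] at hx; simp [hx]
    · rw [max_eq_left h] at hx; rw [hx]; ring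
  have h2 : z * Y = z ^ 2 + δ * m₂ * z := by
    rcases le_total (Y - δ * m₂) 0 with h | h
    · rw [max_eq_right h] at hz; simp [hz]
    · rw [max_eq_left h] at hz; rw [hz]; ring
  have h3 : x * Y ≤ x * (z + δ * m₂) :=
    mul_le_mul_of_nonneg_left (by linarith [hz ▸ le_max_left (Y - δ * m₂) 0]) hx0
  have h4 : z * P ≤ z * (x + δ * m₁) :=
    mul_le_mul_of_nonneg_left (by linarith [hx ▸ le_max_left (P - δ * m₁) 0]) hz0
  have e1 : -(x * (2 * P / r + r * (A * P) - r * (W * Y) + 2 * u / r ^ 2)) =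
      -(2 * (x * P) / r) - r * A * (x * P) + r * W * (x * Y) - 2 * x * u / r ^ 2 := by ring
  have e2 : -(z * (Y / r + r * (D * Y) - r * (W * P))) =
      -((z * Y) / r) - r * D * (z * Y) + r * W * (z * P) := by ring
  have h5 : r * W * (x * Y) ≤ r * W * (x * (z + δ * m₂)) :=
    mul_le_mul_of_nonneg_left h3 (by positivity)
  have h6 : r * W * (z * P) ≤ r * W * (z * (x + δ * m₁)) :=
    mul_le_mul_of_nonneg_left h4 (by positivity)
  have h7 : 0 ≤ 2 * x * u / r ^ 2 := by positivity
  have h8 : 0 ≤ 2 * (δ * m₁ * x) / r + (δ * m₂ * z) / r := by positivity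
  have e3 : x ^ 2 / r ^ 2 * r = x ^ 2 / r := by field_simp
  have e7 : (x ^ 2 / r ^ 2 + A * x ^ 2 + D * z ^ 2 - 2 * W * x * z) * r =
      x ^ 2 / r + (A * x ^ 2 + D * z ^ 2 - 2 * W * x * z) * r := by rw [← e3]; ring
  rw [e1, e2, h1, h2, e7]
  have e4 : -(2 * (x ^ 2 + δ * m₁ * x) / r) = -(2 * (x ^ 2 / r)) - 2 * (δ * m₁ * x) / r := by ring
  have e5 : -((z ^ 2 + δ * m₂ * z) / r) = -(z ^ 2 / r) - δ * m₂ * z / r := by ring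
  have e6 : -((x ^ 2 + z ^ 2) / r) = -(x ^ 2 / r) - z ^ 2 / r := by ring
  rw [e4, e5, e6]
  linarith

namespace IsProfile

variable {a B c T : ℝ} {R : ℝ≥0∞} {u v p q : ℝ → ℝ}

theorem continuousOn_u (h : IsProfile a B c T R u v p q) : ContinuousOn u (Iset R) :=
  fun r hr => (h.hasDerivAt_u r hr).continuousAt.continuousWithinAt

theorem continuousOn_v (h : IsProfile a B c T R u v p q) : ContinuousOn v (Iset R) :=
  fun r hr => (h.hasDerivAt_v r hr).continuousAt.continuousWithinAt

theorem continuousOn_p (h : IsProfile a B c T R u v p q) : ContinuousOn p (Iset R) :=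
  fun r hr => (h.hasDerivAt_p r hr).continuousAt.continuousWithinAt

theorem continuousOn_q (h : IsProfile a B c T R u v p q) : ContinuousOn q (Iset R) :=
  fun r hr => (h.hasDerivAt_q r hr).continuousAt.continuousWithinAt

theorem le_two_mul (h : IsProfile a B c T R u v p q) : B ≤ 2 * c * T := by
  have h1 := h.a_nonneg
  have hT := h.T_pos
  rw [h.a_eq] at h1
  by_contra! hlt
  nlinarith

/-- The flux of `u'` satisfies the linearized equation. -/
theorem hasDerivAt_flux_p (h : IsProfile a B c T R u v p q) : ∀ r ∈ Iset R,
    HasDerivAt (fun r => r * (-p r / r + u r / r ^ 2 +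
      u r * (-a + 2 * B * v r + c * (u r ^ 2 + v r ^ 2))))
      (2 * p r / r + r * ((-a + 2 * B * v r + c * (3 * u r ^ 2 + v r ^ 2)) * p r) +
        r * (2 * u r * (B + c * v r) * q r) - 2 * u r / r ^ 2) r := by
  intro r hr
  have h0 := hr.1.ne'
  have hu := h.hasDerivAt_u r hr
  have hv := h.hasDerivAt_v r hr
  have hp := h.hasDerivAt_p r hr
  refine ((hasDerivAt_id' r).fun_mul (((hp.fun_neg.fun_div (hasDerivAt_id' r) h0).fun_add
    (hu.fun_div ((hasDerivAt_id' r).fun_pow 2) (pow_ne_zero 2 h0))).fun_add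
    (hu.fun_mul (((hv.const_mul (2 * B)).const_add (-a)).fun_add
      (((hu.fun_pow 2).fun_add (hv.fun_pow 2)).const_mul c))))).congr_deriv ?_
  push_cast
  field_simp
  ring

/-- The flux of `v'` satisfies the linearized equation. -/
theorem hasDerivAt_flux_q (h : IsProfile a B c T R u v p q) : ∀ r ∈ Iset R,
    HasDerivAt (fun r => r * (-q r / r +
      (v r * (-a - B * v r + c * (u r ^ 2 + v r ^ 2)) + B * u r ^ 2)))
      (q r / r + r * ((-a - 2 * B * v r + c * (u r ^ 2 + 3 * v r ^ 2)) * q r) +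
        r * (2 * u r * (B + c * v r) * p r)) r := by
  intro r hr
  have h0 := hr.1.ne'
  have hu := h.hasDerivAt_u r hr
  have hv := h.hasDerivAt_v r hr
  have hq := h.hasDerivAt_q r hr
  refine ((hasDerivAt_id' r).fun_mul ((hq.fun_neg.fun_div (hasDerivAt_id' r) h0).fun_add
    ((hv.fun_mul (((hv.const_mul B).const_sub (-a)).fun_add
      (((hu.fun_pow 2).fun_add (hv.fun_pow 2)).const_mul c))).fun_add
      ((hu.fun_pow 2).const_mul B)))).congr_deriv ?_
  push_cast
  field_simp
  ring

theorem exists_sign (h : IsProfile a B c T R u v p q) : ∃ τ : ℝ, τ ^ 2 = 1 ∧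
    (∀ r ∈ Iset R, 0 ≤ τ * (B + c * v r)) ∧ (∀ r ∈ Iset R, -τ * v r ≤ -τ * -T) := by
  have hc := h.c_pos
  rcases le_total (c * T) B with hcT | hcT
  · refine ⟨1, by norm_num, fun r hr => ?_, fun r hr => ?_⟩
    · nlinarith [h.neg_T_le_v hcT r hr]
    · linarith [h.neg_T_le_v hcT r hr]
  · refine ⟨-1, by norm_num, fun r hr => ?_, fun r hr => ?_⟩
    · nlinarith [h.v_le_neg_T hcT r hr]
    · linarith [h.v_le_neg_T hcT r hr]

theorem potential_bound (h : IsProfile a B c T R u v p q) : ∃ N > 0, ∀ r ∈ Iset R,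
    |-a + 2 * B * v r + c * (3 * u r ^ 2 + v r ^ 2)| ≤ N ∧
    |-a - 2 * B * v r + c * (u r ^ 2 + 3 * v r ^ 2)| ≤ N ∧ |2 * u r * (B + c * v r)| ≤ N := by
  have hB := h.B_pos
  have hc := h.c_pos
  have hT := h.T_pos
  have ha := h.a_nonneg
  refine ⟨a + 4 * B * T + 4 * T * (B + c * (2 * T)) + 16 * c * T ^ 2, by positivity,
    fun r hr => ?_⟩
  have h1 := h.sq_add_sq_le r hr
  have hu : |u r| ≤ 2 * T := abs_le_of_sq_le_sq (by nlinarith [sq_nonneg (v r)]) (by positivity)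
  have hv : |v r| ≤ 2 * T := abs_le_of_sq_le_sq (by nlinarith [sq_nonneg (u r)]) (by positivity)
  obtain ⟨hv1, hv2⟩ := abs_le.1 hv
  have e1 := mul_le_mul_of_nonneg_left hv1 hB.le
  have e2 := mul_le_mul_of_nonneg_left hv2 hB.le
  have e3 := mul_le_mul_of_nonneg_left h1 hc.le
  have p1 := mul_nonneg hc.le (sq_nonneg (u r))
  have p2 := mul_nonneg hc.le (sq_nonneg (v r))
  have p3 : 0 ≤ 4 * T * (B + c * (2 * T)) := by positivity
  have p4 : 0 ≤ B * T := by positivity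
  have p5 : 0 ≤ c * T ^ 2 := by positivity
  refine ⟨abs_le.2 ⟨by linarith, by linarith⟩, abs_le.2 ⟨by linarith, by linarith⟩, ?_⟩
  rw [abs_mul, abs_mul, abs_two]
  have : |B + c * v r| ≤ B + c * (2 * T) := by
    refine (abs_add_le _ _).trans ?_
    rw [abs_of_pos hB, abs_mul, abs_of_pos hc]
    gcongr
  have : 2 * |u r| * |B + c * v r| ≤ 2 * (2 * T) * (B + c * (2 * T)) := by gcongr
  linarith

/-- Weights `m₁, m₂ > 0` making the limiting Hessian strictly dominate. -/
theorem exists_weights (h : IsProfile a B c T R u v p q) {τ : ℝ}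
    (hκ : ∀ r ∈ Iset R, 0 ≤ τ * (B + c * v r)) (hτ : τ ^ 2 = 1) :
    ∃ m₁ > 0, ∃ m₂ > 0, ∀ᶠ r in endFilter R,
      2 * u r * (τ * (B + c * v r)) * m₂ -
        (-a + 2 * B * v r + c * (3 * u r ^ 2 + v r ^ 2)) * m₁ < 0 ∧
      2 * u r * (τ * (B + c * v r)) * m₁ -
        (-a - 2 * B * v r + c * (u r ^ 2 + 3 * v r ^ 2)) * m₂ < 0 := by
  have hB := h.B_pos
  have hc := h.c_pos
  have hT := h.T_pos
  have hBT := h.le_two_mul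
  have h3 : (0 : ℝ) < √3 := by positivity
  have h3' : √3 ^ 2 = (3 : ℝ) := Real.sq_sqrt (by norm_num)
  have tu := h.tendsto_end_u
  have tv := h.tendsto_end_v
  have lκ : Tendsto (fun r => τ * (B + c * v r)) (endFilter R) (𝓝 (τ * (B + c * -T))) :=
    ((tv.const_mul c).const_add B).const_mul τ
  have lW : Tendsto (fun r => 2 * u r * (τ * (B + c * v r))) (endFilter R)
      (𝓝 (2 * (√3 * T) * (τ * (B + c * -T)))) := (tu.const_mul 2).mul lκ
  have lA : Tendsto (fun r => -a + 2 * B * v r + c * (3 * u r ^ 2 + v r ^ 2)) (endFilter R)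
      (𝓝 (6 * c * T ^ 2)) := by
    have := ((tv.const_mul (2 * B)).const_add (-a)).add
      ((((tu.pow 2).const_mul 3).add (tv.pow 2)).const_mul c)
    convert this using 2
    rw [mul_pow, h3', h.a_eq]; ring
  have lD : Tendsto (fun r => -a - 2 * B * v r + c * (u r ^ 2 + 3 * v r ^ 2)) (endFilter R)
      (𝓝 (2 * c * T ^ 2 + 4 * B * T)) := by
    have := ((tv.const_mul (2 * B)).const_sub (-a)).add
      (((tu.pow 2).add ((tv.pow 2).const_mul 3)).const_mul c)
    convert this using 2
    rw [mul_pow, h3', h.a_eq]; ring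
  obtain ⟨r₁, hr₁⟩ := exists_mem_Iset h.R_pos
  have hκ' : 0 ≤ τ * (B + c * -T) := by
    apply ge_of_tendsto lκ
    filter_upwards [eventually_endFilter hr₁] with r hr
    exact hκ r hr.1
  set w := 2 * (√3 * T) * (τ * (B + c * -T)) with hw
  have hw0 : 0 ≤ w := by positivity
  have hdet : w ^ 2 < 6 * c * T ^ 2 * (2 * c * T ^ 2 + 4 * B * T) := by
    have : w ^ 2 = 12 * T ^ 2 * (B - c * T) ^ 2 := by
      rw [hw]
      linear_combination 4 * T ^ 2 * τ ^ 2 * (B - c * T) ^ 2 * h3' +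
        12 * T ^ 2 * (B - c * T) ^ 2 * hτ
    rw [this]
    have : 0 < 12 * T ^ 2 * B * (4 * c * T - B) := by
      have : 0 < 4 * c * T - B := by nlinarith
      positivity
    nlinarith
  refine ⟨2 * c * T ^ 2 + 4 * B * T + w, by positivity, 6 * c * T ^ 2 + w, by positivity,
    Eventually.and ?_ ?_⟩
  · have := (lW.mul_const (6 * c * T ^ 2 + w)).sub (lA.mul_const (2 * c * T ^ 2 + 4 * B * T + w))
    refine this.eventually_lt_const ?_
    nlinarith
  · have := (lW.mul_const (2 * c * T ^ 2 + 4 * B * T + w)).sub (lD.mul_const (6 * c * T ^ 2 + w))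
    refine this.eventually_lt_const ?_
    nlinarith

end IsProfile

namespace IsProfile

variable {a B c T : ℝ} {R : ℝ≥0∞} {u v p q : ℝ → ℝ}

/-- Stability rules out an interval on which `-u'` or `τ v'` is bounded below by a positive
constant. -/
theorem false_of_slope_lower_bound (h : IsProfile a B c T R u v p q)
    (hst : ProfileStable a B c R u v) {τ : ℝ} (hτ : τ ^ 2 = 1)
    (hκ : ∀ r ∈ Iset R, 0 ≤ τ * (B + c * v r)) (hvT : ∀ r ∈ Iset R, -τ * v r ≤ -τ * -T)
    {r₁ r₂ d : ℝ} (hr₁ : r₁ ∈ Iset R) (hr₂ : r₂ ∈ Iset R) (h12 : r₁ < r₂) (hd : 0 < d)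
    (hbd : ∀ r ∈ Icc r₁ r₂, 2 * d ≤ -p r ∨ 2 * d ≤ τ * q r) : False := by
  have hc := h.c_pos
  obtain ⟨m₁, hm₁, m₂, hm₂, hev⟩ := h.exists_weights hκ hτ
  obtain ⟨β₀, hβ₀, hbr⟩ := exists_of_eventually_endFilter h.R_pos hev
  obtain ⟨N, hN, hNb⟩ := h.potential_bound
  obtain ⟨K, hK, ρ, hρ, hKb⟩ := h.exists_origin_bounds
  have hτ1 : |τ| = 1 := by
    have : |τ| ^ 2 = 1 := by rw [sq_abs, hτ]
    nlinarith [abs_nonneg τ]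
  -- bounds of the slopes near the origin
  obtain ⟨C, hC, hCb⟩ : ∃ C > 0, ∀ r ∈ Iset R, r ≤ β₀ → -p r ≤ C ∧ τ * q r ≤ C := by
    have hq1 : ∀ᶠ r in 𝓝[>] (0 : ℝ), τ * q r < 1 := by
      have := h.tendsto_zero_q.const_mul τ
      rw [mul_zero] at this
      exact this.eventually_lt_const one_pos
    obtain ⟨α₀, hα₀, hα⟩ := exists_of_eventually_nhdsGT_zero h.R_pos
      (hq1.and (Ioo_mem_nhdsGT hρ.1))
    obtain ⟨C₁, hC₁⟩ := (isCompact_Icc (a := α₀) (b := β₀)).exists_bound_of_continuousOn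
      (h.continuousOn_p.mono (Icc_subset_Iset hα₀ hβ₀))
    obtain ⟨C₂, hC₂⟩ := (isCompact_Icc (a := α₀) (b := β₀)).exists_bound_of_continuousOn
      (h.continuousOn_q.mono (Icc_subset_Iset hα₀ hβ₀))
    refine ⟨1 + K + |C₁| + |C₂|, by positivity, fun r hr hrβ => ?_⟩
    rcases le_total r α₀ with hrα | hrα
    · obtain ⟨h1, h2⟩ := hα r hr hrα
      have h3 := (hKb r h2).2.2.1
      constructor
      · linarith [neg_abs_le (p r), abs_nonneg C₁, abs_nonneg C₂]
      · linarith [abs_nonneg C₁, abs_nonneg C₂]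
    · have h1 := hC₁ r ⟨hrα, hrβ⟩
      have h2 := hC₂ r ⟨hrα, hrβ⟩
      rw [Real.norm_eq_abs] at h1 h2
      constructor
      · linarith [neg_abs_le (p r), le_abs_self C₁, abs_nonneg C₂]
      · have : τ * q r ≤ |q r| := by
          calc τ * q r ≤ |τ * q r| := le_abs_self _
            _ = |q r| := by rw [abs_mul, hτ1, one_mul]
        linarith [abs_nonneg C₁, le_abs_self C₂]
  set M : ℝ := β₀ * (C * (N * m₂ + N * m₁) + C * (N * m₁ + N * m₂)) with hM
  have hβ00 : 0 < β₀ := hβ₀.1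
  have hM0 : 0 < M := by positivity
  have hr10 : 0 < r₁ := hr₁.1
  -- the key estimate for each small `δ`
  have key : ∀ δ, 0 < δ → δ * m₁ ≤ d → δ * m₂ ≤ d →
      d ^ 2 / r₂ * (r₂ - r₁) ≤ δ * M * β₀ := by
    intro δ hδ hδ1 hδ2
    have hδm1 : 0 < δ * m₁ := by positivity
    have hδm2 : 0 < δ * m₂ := by positivity
    obtain ⟨β, hβ, hβb⟩ := exists_of_eventually_endFilter h.R_pos
      ((h.eventually_neg_lt_p hδm1).and (h.eventually_neg_lt_mul_q hδm2 hvT))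
    have hzero : ∀ᶠ r in 𝓝[>] (0 : ℝ), -p r < δ * m₁ ∧ τ * q r < δ * m₂ := by
      have hq1 : ∀ᶠ r in 𝓝[>] (0 : ℝ), τ * q r < δ * m₂ := by
        have := h.tendsto_zero_q.const_mul τ
        rw [mul_zero] at this
        exact this.eventually_lt_const hδm2
      filter_upwards [hq1, Ioo_mem_nhdsGT hρ.1,
        Ioo_mem_nhdsGT (show (0 : ℝ) < δ * m₁ / K by positivity)] with r e1 e2 e3
      refine ⟨?_, e1⟩
      have := (hKb r e2).2.2.2
      have e4 := (lt_div_iff₀ hK).1 e3.2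
      linarith
    obtain ⟨α, hα, hαb⟩ := exists_of_eventually_nhdsGT_zero h.R_pos hzero
    have hX0 : ∀ r ∈ Iset R, r ∉ Ioo α β → -p r - δ * m₁ ≤ 0 := by
      intro r hr hn
      rcases le_or_gt r α with h1 | h1
      · linarith [(hαb r hr h1).1]
      · have h2 : β ≤ r := by by_contra! h3; exact hn ⟨h1, h3⟩
        linarith [(hβb r hr h2).1]
    have hZ0 : ∀ r ∈ Iset R, r ∉ Ioo α β → τ * q r - δ * m₂ ≤ 0 := by
      intro r hr hn
      rcases le_or_gt r α with h1 | h1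
      · linarith [(hαb r hr h1).2]
      · have h2 : β ≤ r := by by_contra! h3; exact hn ⟨h1, h3⟩
        linarith [(hβb r hr h2).2]
    have hin : ∀ r ∈ Icc r₁ r₂, r ∈ Ioo α β := by
      intro r hr
      by_contra hn
      have hI := Icc_subset_Iset hr₁ hr₂ hr
      rcases hbd r hr with e | e
      · linarith [hX0 r hI hn]
      · linarith [hZ0 r hI hn]
    have hαβ : α ≤ β := ((hin r₁ (left_mem_Icc.2 h12.le)).1.trans
      (hin r₁ (left_mem_Icc.2 h12.le)).2).le
    have hu := h.continuousOn_u
    have hv := h.continuousOn_v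
    have hp := h.continuousOn_p
    have hq := h.continuousOn_q
    have hne : ∀ r ∈ Iset R, r ≠ 0 := fun r hr => hr.1.ne'
    have hne2 : ∀ r ∈ Iset R, r ^ 2 ≠ 0 := fun r hr => pow_ne_zero 2 hr.1.ne'
    have main := hst.integral_posPart_nonneg hu hv hτ
      (W := fun r => 2 * u r * (τ * (B + c * v r)))
      (fun r hr => by linear_combination (-(2 * u r * (B + c * v r))) * hτ) hα hβ hαβ
      (X := fun r => -p r - δ * m₁) (Z := fun r => τ * q r - δ * m₂)
      (X' := fun r => -(-p r / r + u r / r ^ 2 +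
        u r * (-a + 2 * B * v r + c * (u r ^ 2 + v r ^ 2))))
      (Z' := fun r => τ * (-q r / r +
        (v r * (-a - B * v r + c * (u r ^ 2 + v r ^ 2)) + B * u r ^ 2)))
      (S := fun r => 2 * -p r / r + r * ((-a + 2 * B * v r + c * (3 * u r ^ 2 + v r ^ 2)) * -p r)
        - r * (2 * u r * (τ * (B + c * v r)) * (τ * q r)) + 2 * u r / r ^ 2)
      (S₂ := fun r => τ * q r / r + r * ((-a - 2 * B * v r + c * (u r ^ 2 + 3 * v r ^ 2)) *
        (τ * q r)) - r * (2 * u r * (τ * (B + c * v r)) * -p r))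
      (fun r hr => (h.hasDerivAt_p r hr).fun_neg.sub_const _)
      (fun r hr => ((h.hasDerivAt_q r hr).const_mul τ).sub_const _)
      (fun r hr => by
        have := (h.hasDerivAt_flux_p r hr).fun_neg
        simp only [← mul_neg] at this
        refine this.congr_deriv ?_
        linear_combination (r * (2 * u r * (B + c * v r) * q r)) * hτ)
      (fun r hr => by
        have := (h.hasDerivAt_flux_q r hr).const_mul τ
        exact (this.congr_of_eventuallyEq (Eventually.of_forall fun s => by ring)).congr_deriv (by ring))
      (by fun_prop (disch := assumption)) (by fun_prop (disch := assumption))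
      (by fun_prop (disch := assumption)) (by fun_prop (disch := assumption)) hX0 hZ0
    set g : ℝ → ℝ := fun r => -((Icc r₁ r₂).indicator (fun _ => d ^ 2 / r₂) r) +
      (Ioc 0 β₀).indicator (fun _ => δ * M) r with hg
    have gi1 : Integrable ((Icc r₁ r₂).indicator (fun _ : ℝ => d ^ 2 / r₂)) := by
      rw [integrable_indicator_iff measurableSet_Icc]; simp
    have gi2 : Integrable ((Ioc 0 β₀).indicator (fun _ : ℝ => δ * M)) := by
      rw [integrable_indicator_iff measurableSet_Ioc]
      exact integrableOn_const (by simp)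
    have hgi : Integrable g := gi1.neg.add gi2
    have hle := main.trans (intervalIntegral.integral_mono_on_of_le_Ioo (g := g) hαβ ?_
      hgi.intervalIntegrable ?_)
    · have hsplit : ∫ r in Ioc α β, g r =
          -(∫ r in Ioc α β, (Icc r₁ r₂).indicator (fun _ => d ^ 2 / r₂) r) +
            ∫ r in Ioc α β, (Ioc 0 β₀).indicator (fun _ => δ * M) r := by
        rw [← integral_neg]
        exact integral_add gi1.neg.integrableOn gi2.integrableOn
      rw [intervalIntegral.integral_of_le hαβ, hsplit, setIntegral_indicator measurableSet_Icc,
        setIntegral_indicator measurableSet_Ioc] at hle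
      have s1 : Ioc α β ∩ Icc r₁ r₂ = Icc r₁ r₂ :=
        inter_eq_right.2 fun r hr => Ioo_subset_Ioc_self (hin r hr)
      rw [s1, setIntegral_const, setIntegral_const, smul_eq_mul, smul_eq_mul,
        Real.volume_real_Icc_of_le h12.le] at hle
      have s2 : volume.real (Ioc α β ∩ Ioc 0 β₀) ≤ β₀ := by
        refine (measureReal_mono inter_subset_right (by simp)).trans ?_
        rw [Real.volume_real_Ioc_of_le hβ00.le, sub_zero]
      have := mul_le_mul_of_nonneg_right s2 (show 0 ≤ δ * M by positivity)
      linarith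
    · apply ContinuousOn.intervalIntegrable
      rw [uIcc_of_le hαβ]
      have hmono : Icc α β ⊆ Iset R := Icc_subset_Iset hα hβ
      refine ContinuousOn.mono ?_ hmono
      have c1 : ContinuousOn (fun r => max (-p r - δ * m₁) 0) (Iset R) :=
        (hp.neg.sub continuousOn_const).sup continuousOn_const
      have c2 : ContinuousOn (fun r => max (τ * q r - δ * m₂) 0) (Iset R) :=
        ((continuousOn_const.mul hq).sub continuousOn_const).sup continuousOn_const
      fun_prop (disch := assumption)
    · intro r hr
      have hI : r ∈ Iset R := Icc_subset_Iset hα hβ (Ioo_subset_Icc_self hr)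
      have hr0 := hI.1
      have hur := (h.u_pos r hI).le
      have hWr : 0 ≤ 2 * u r * (τ * (B + c * v r)) := by
        have := hκ r hI
        positivity
      refine (cooperative_pointwise_bound hr0 hur hWr hδ.le hm₁.le hm₂.le rfl rfl).trans ?_
      have x0 := le_max_right (-p r - δ * m₁) 0
      have z0 := le_max_right (τ * q r - δ * m₂) 0
      rw [hg]
      refine add_le_add (neg_le_neg ?_) ?_
      · by_cases hm : r ∈ Icc r₁ r₂
        · rw [indicator_of_mem hm]
          have : d ^ 2 ≤ max (-p r - δ * m₁) 0 ^ 2 + max (τ * q r - δ * m₂) 0 ^ 2 := by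
            rcases hbd r hm with e | e
            · have : d ≤ max (-p r - δ * m₁) 0 := le_trans (by linarith) (le_max_left _ _)
              nlinarith [sq_nonneg (max (τ * q r - δ * m₂) 0)]
            · have : d ≤ max (τ * q r - δ * m₂) 0 := le_trans (by linarith) (le_max_left _ _)
              nlinarith [sq_nonneg (max (-p r - δ * m₁) 0)]
          have := hm.2
          gcongr
        · rw [indicator_of_notMem hm]
          positivity
      · by_cases hm : r ∈ Ioc 0 β₀
        · rw [indicator_of_mem hm]
          obtain ⟨n1, n2, n3⟩ := hNb r hI
          have n3' : 2 * u r * (τ * (B + c * v r)) ≤ N := by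
            refine le_trans (le_abs_self _) (le_trans (le_of_eq ?_) n3)
            rw [abs_mul, abs_mul τ, hτ1, one_mul, ← abs_mul]
          obtain ⟨k1, k2⟩ := hCb r hI hm.2
          have x1 : max (-p r - δ * m₁) 0 ≤ C := max_le (by linarith) hC.le
          have z1 : max (τ * q r - δ * m₂) 0 ≤ C := max_le (by linarith) hC.le
          have b1 : 2 * u r * (τ * (B + c * v r)) * m₂ -
              (-a + 2 * B * v r + c * (3 * u r ^ 2 + v r ^ 2)) * m₁ ≤ N * m₂ + N * m₁ := by
            have e1 := mul_le_mul_of_nonneg_right n3' hm₂.le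
            have e2 := mul_le_mul_of_nonneg_right (abs_le.1 n1).1 hm₁.le
            linarith
          have b2 : 2 * u r * (τ * (B + c * v r)) * m₁ -
              (-a - 2 * B * v r + c * (u r ^ 2 + 3 * v r ^ 2)) * m₂ ≤ N * m₁ + N * m₂ := by
            have e1 := mul_le_mul_of_nonneg_right n3' hm₁.le
            have e2 := mul_le_mul_of_nonneg_right (abs_le.1 n2).1 hm₂.le
            linarith
          rw [hM]
          apply mul_le_mul_of_nonneg_left _ hδ.le
          have s1 : 0 ≤ C * (N * m₂ + N * m₁) + C * (N * m₁ + N * m₂) := by positivity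
          refine le_trans (mul_le_mul_of_nonneg_left ?_ hr0.le)
            (mul_le_mul_of_nonneg_right hm.2 s1)
          exact add_le_add
            ((mul_le_mul_of_nonneg_left b1 x0).trans (mul_le_mul_of_nonneg_right x1 (by positivity)))
            ((mul_le_mul_of_nonneg_left b2 z0).trans (mul_le_mul_of_nonneg_right z1 (by positivity)))
        · rw [indicator_of_notMem hm]
          have hb' : β₀ ≤ r := by by_contra! h3; exact hm ⟨hr0, h3.le⟩
          obtain ⟨b1, b2⟩ := hbr r hI hb'
          apply mul_nonpos_of_nonneg_of_nonpos hδ.le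
          apply mul_nonpos_of_nonneg_of_nonpos hr0.le
          exact add_nonpos (mul_nonpos_of_nonneg_of_nonpos x0 b1.le)
            (mul_nonpos_of_nonneg_of_nonpos z0 b2.le)
  have hL : 0 < d ^ 2 / r₂ * (r₂ - r₁) := by
    have h2 : 0 < r₂ := hr₂.1
    have : 0 < r₂ - r₁ := by linarith
    positivity
  set L := d ^ 2 / r₂ * (r₂ - r₁) with hLdef
  set δ := min (d / (m₁ + m₂)) (L / (2 * (M * β₀))) with hδdef
  have hδ : 0 < δ := lt_min (by positivity) (by positivity)
  have e1 : δ * (m₁ + m₂) ≤ d := (le_div_iff₀ (by positivity)).1 (min_le_left _ _)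
  have e2 : δ * (2 * (M * β₀)) ≤ L := (le_div_iff₀ (by positivity)).1 (min_le_right _ _)
  have := key δ hδ (by nlinarith) (by nlinarith)
  nlinarith

end IsProfile

/-- At an interior zero of a nonnegative function, the derivative of its flux is nonnegative. -/
theorem flux_deriv_nonneg_of_zero {R : ℝ≥0∞} {f f' : ℝ → ℝ} {r₀ m : ℝ} (hr₀ : r₀ ∈ Iset R)
    (hf : ∀ r ∈ Iset R, HasDerivAt f (f' r) r) (hf0 : ∀ r ∈ Iset R, 0 ≤ f r)
    (hz : f r₀ = 0) (hF : HasDerivAt (fun r => r * f' r) m r₀) : 0 ≤ m := by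
  by_contra! hm
  have hI := (isOpen_Iset (R := R)).mem_nhds hr₀
  have hmin : IsLocalMin f r₀ := by
    filter_upwards [hI] with r hr
    rw [hz]
    exact hf0 r hr
  have hd0 : f' r₀ = 0 := hmin.hasDerivAt_eq_zero (hf r₀ hr₀)
  have hs := eventually_nhdsWithin_sign_eq_of_deriv_neg (f := fun r => r * f' r) (x₀ := r₀)
    (by rw [hF.deriv]; exact hm) (by simp [hd0])
  obtain ⟨e, he, hball⟩ := Metric.eventually_nhds_iff.1 (hs.and hI)
  have hmem : ∀ r ∈ Icc r₀ (r₀ + e / 2), r ∈ Iset R ∧ (r₀ < r → f' r < 0) := by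
    intro r hr
    have hdist : dist r r₀ < e := by
      rw [Real.dist_eq, abs_of_nonneg (by linarith [hr.1])]
      linarith [hr.2]
    obtain ⟨h1, h2⟩ := hball hdist
    refine ⟨h2, fun h3 => ?_⟩
    rw [sign_neg (show r₀ - r < 0 by linarith), sign_eq_neg_one_iff] at h1
    exact (pos_iff_neg_of_mul_neg h1).1 h2.1
  have hanti : StrictAntiOn f (Icc r₀ (r₀ + e / 2)) := by
    apply strictAntiOn_of_deriv_neg (convex_Icc _ _)
    · exact fun r hr => (hf r (hmem r hr).1).continuousAt.continuousWithinAt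
    · rw [interior_Icc]
      intro r hr
      have := hmem r (Ioo_subset_Icc_self hr)
      rw [(hf r this.1).deriv]
      exact this.2 hr.1
  have h1 := hanti (left_mem_Icc.2 (by linarith)) (right_mem_Icc.2 (by linarith))
    (show r₀ < r₀ + e / 2 by linarith)
  have h2 := hf0 _ (hmem (r₀ + e / 2) (right_mem_Icc.2 (by linarith))).1
  linarith

namespace IsProfile

variable {a B c T : ℝ} {R : ℝ≥0∞} {u v p q : ℝ → ℝ}

theorem slopes_nonneg (h : IsProfile a B c T R u v p q) (hst : ProfileStable a B c R u v)
    {τ : ℝ} (hτ : τ ^ 2 = 1) (hκ : ∀ r ∈ Iset R, 0 ≤ τ * (B + c * v r))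
    (hvT : ∀ r ∈ Iset R, -τ * v r ≤ -τ * -T) {r : ℝ} (hr : r ∈ Iset R) :
    0 ≤ p r ∧ 0 ≤ -τ * q r := by
  have key : ∀ f : ℝ → ℝ, ContinuousOn f (Iset R) →
      (∀ s, f s ≤ -p s ∨ f s ≤ τ * q s) → f r ≤ 0 := by
    intro f hf hle
    by_contra! hpos
    have hI := (isOpen_Iset (R := R)).mem_nhds hr
    have hev : ∀ᶠ s in 𝓝 r, f r / 2 < f s :=
      (hf.continuousAt hI).eventually (lt_mem_nhds (by linarith))
    obtain ⟨e, he, hball⟩ := Metric.eventually_nhds_iff.1 (hev.and hI)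
    have hmem : ∀ s ∈ Icc r (r + e / 2), f r / 2 < f s ∧ s ∈ Iset R := by
      intro s hs
      apply hball
      rw [Real.dist_eq, abs_of_nonneg (by linarith [hs.1])]
      linarith [hs.2]
    refine h.false_of_slope_lower_bound hst hτ hκ hvT (d := f r / 4) hr
      (hmem _ (right_mem_Icc.2 (by linarith))).2 (by linarith) (by linarith) fun s hs => ?_
    have := (hmem s hs).1
    exact (hle s).imp (fun h1 => by linarith) (fun h1 => by linarith)
  constructor
  · have := key (fun s => -p s) h.continuousOn_p.neg (fun s => Or.inl le_rfl)
    linarith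
  · have := key (fun s => τ * q s) (continuousOn_const.mul h.continuousOn_q)
      (fun s => Or.inr le_rfl)
    linarith

theorem p_pos (h : IsProfile a B c T R u v p q) (hst : ProfileStable a B c R u v)
    {r : ℝ} (hr : r ∈ Iset R) : 0 < p r := by
  obtain ⟨τ, hτ, hκ, hvT⟩ := h.exists_sign
  have hs := fun s hs => h.slopes_nonneg hst hτ hκ hvT (r := s) hs
  refine lt_of_le_of_ne (hs r hr).1 fun h0 => ?_
  have h1 := flux_deriv_nonneg_of_zero hr h.hasDerivAt_p (fun s hs' => (hs s hs').1) h0.symm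
    (h.hasDerivAt_flux_p r hr)
  rw [← h0] at h1
  have hr0 := hr.1
  have hu := h.u_pos r hr
  have h2 : 0 < 2 * u r / r ^ 2 := by positivity
  have h3 : 0 ≤ r * (2 * u r * (τ * (B + c * v r)) * (-τ * q r)) := by
    have := hκ r hr
    have := (hs r hr).2
    positivity
  have h4 : r * (2 * u r * (τ * (B + c * v r)) * (-τ * q r)) =
      -(r * (2 * u r * (B + c * v r) * q r)) := by
    linear_combination (-(r * (2 * u r * (B + c * v r) * q r))) * hτ
  simp only [mul_zero, zero_div] at h1
  linarith

/-- Positive functions `z`, `u'`, `u / r` forming a supersolution of the linearized system. -/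
theorem exists_supersolution (h : IsProfile a B c T R u v p q)
    (hst : ProfileStable a B c R u v) : ∃ W z z' G : ℝ → ℝ,
    (∀ r ∈ Iset R, 0 ≤ W r) ∧ (∀ r ∈ Iset R, W r ^ 2 = (2 * u r * (B + c * v r)) ^ 2) ∧
    (∀ r ∈ Iset R, 0 < z r) ∧ (∀ r ∈ Iset R, HasDerivAt z (z' r) r) ∧
    (∀ r ∈ Iset R, HasDerivAt (fun r => r * z' r) (G r) r) ∧ ContinuousOn G (Iset R) ∧
    (∀ r ∈ Iset R, G r ≤ z r / r +
      r * ((-a - 2 * B * v r + c * (u r ^ 2 + 3 * v r ^ 2)) * z r) - r * (W r * p r)) ∧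
    (∀ r ∈ Iset R, 2 * p r / r + r * ((-a + 2 * B * v r + c * (3 * u r ^ 2 + v r ^ 2)) * p r) +
        r * (2 * u r * (B + c * v r) * q r) - 2 * u r / r ^ 2 ≤
      2 * p r / r + r * ((-a + 2 * B * v r + c * (3 * u r ^ 2 + v r ^ 2)) * p r) -
        r * (W r * z r) - 2 * u r / r ^ 2) := by
  have hc := h.c_pos
  have hu := h.continuousOn_u
  have hv := h.continuousOn_v
  have hp := h.continuousOn_p
  have hq := h.continuousOn_q
  have hne : ∀ r ∈ Iset R, r ≠ 0 := fun r hr => hr.1.ne'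
  rcases eq_or_ne (c * T) B with hcT | hcT
  · have hvr : ∀ r ∈ Iset R, v r = -T := fun r hr =>
      le_antisymm (h.v_le_neg_T hcT.ge r hr) (h.neg_T_le_v hcT.le r hr)
    have hz : ∀ r ∈ Iset R, B + c * v r = 0 := fun r hr => by
      rw [hvr r hr]
      linarith
    refine ⟨fun _ => 0, fun _ => 1, fun _ => 0, fun _ => 0, fun _ _ => le_rfl, fun r hr => ?_,
      fun _ _ => one_pos, fun r _ => hasDerivAt_const r _, fun r _ => ?_, continuousOn_const,
      fun r hr => ?_, fun r hr => ?_⟩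
    · rw [hz r hr]; ring
    · simpa using hasDerivAt_const r (0 : ℝ)
    · have hr0 := hr.1
      have h1 : -a - 2 * B * v r + c * (u r ^ 2 + 3 * v r ^ 2) = c * u r ^ 2 + 3 * c * T ^ 2 := by
        rw [hvr r hr, h.a_eq, ← hcT]
        ring
      rw [h1]
      have : 0 ≤ 1 / r + r * (c * u r ^ 2 + 3 * c * T ^ 2) := by positivity
      linarith
    · rw [hz r hr]
      linarith
  · obtain ⟨τ, hτ, hκ, hvT⟩ := h.exists_sign
    have hs := fun s hs => h.slopes_nonneg hst hτ hκ hvT (r := s) hs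
    have hτ0 : τ ≠ 0 := by rintro rfl; norm_num at hτ
    have hne' : ∀ r ∈ Iset R, B + c * v r ≠ 0 := by
      intro r hr
      rcases lt_or_gt_of_ne hcT with h1 | h1
      · nlinarith [h.neg_T_le_v h1.le r hr]
      · nlinarith [h.v_le_neg_T h1.le r hr]
    have hκ' : ∀ r ∈ Iset R, 0 < τ * (B + c * v r) := fun r hr =>
      lt_of_le_of_ne (hκ r hr) (mul_ne_zero hτ0 (hne' r hr)).symm
    have hflux : ∀ r ∈ Iset R, HasDerivAt (fun r => r * (-τ * (-q r / r +
        (v r * (-a - B * v r + c * (u r ^ 2 + v r ^ 2)) + B * u r ^ 2))))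
        (-τ * (q r / r + r * ((-a - 2 * B * v r + c * (u r ^ 2 + 3 * v r ^ 2)) * q r) +
        r * (2 * u r * (B + c * v r) * p r))) r := fun r hr =>
      ((h.hasDerivAt_flux_q r hr).const_mul (-τ)).congr_of_eventuallyEq
        (Eventually.of_forall fun s => by ring)
    refine ⟨fun r => 2 * u r * (τ * (B + c * v r)), fun r => -τ * q r, _, _, fun r hr => ?_,
      fun r hr => ?_, fun r hr => ?_, fun r hr => (h.hasDerivAt_q r hr).const_mul (-τ),
      hflux, ?_, fun r hr => ?_, fun r hr => ?_⟩
    · have := hκ r hr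
      have := h.u_pos r hr
      positivity
    · linear_combination (2 * u r * (B + c * v r)) ^ 2 * hτ
    · refine lt_of_le_of_ne (hs r hr).2 fun h0 => ?_
      have h1 := flux_deriv_nonneg_of_zero hr
        (fun s hs' => (h.hasDerivAt_q s hs').const_mul (-τ)) (fun s hs' => (hs s hs').2) h0.symm
        (hflux r hr)
      have hq0 : q r = 0 := by
        rcases mul_eq_zero.1 h0.symm with h2 | h2
        · exact absurd (neg_eq_zero.1 h2) hτ0
        · exact h2
      rw [hq0] at h1
      have hr0 := hr.1
      have h3 : 0 < r * (2 * u r * (τ * (B + c * v r)) * p r) := by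
        have := hκ' r hr
        have := h.u_pos r hr
        have := h.p_pos hst hr
        positivity
      simp only [mul_zero, zero_div] at h1
      nlinarith
    · fun_prop (disch := assumption)
    · apply le_of_eq
      ring
    · apply le_of_eq
      linear_combination (-(r * (2 * u r * (B + c * v r) * q r))) * hτ

end IsProfile

/-- Wirtinger's inequality on `[-π, π]`. -/
theorem wirtinger {f f' : ℝ → ℝ} (hf : ∀ x, HasDerivAt f (f' x) x) (hf' : Continuous f')
    (hper : f (-π) = f π) (hmean : ∫ x in -π..π, f x = 0) :
    ∫ x in -π..π, f x ^ 2 ≤ ∫ x in -π..π, f' x ^ 2 := by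
  have hab : -π < π := by linarith [pi_pos]
  have hfc : Continuous f := continuous_iff_continuousAt.2 fun x => (hf x).continuousAt
  have hmem : ∀ g : ℝ → ℝ, Continuous g →
      MemLp (fun x => (g x : ℂ)) 2 (volume.restrict (Ioc (-π) π)) := by
    intro g hg
    have hc : Continuous fun x => (g x : ℂ) := by fun_prop
    obtain ⟨K, hK⟩ := (isCompact_Icc (a := -π) (b := π)).exists_bound_of_continuousOn
      hc.continuousOn
    refine MemLp.of_bound hc.aestronglyMeasurable K ?_
    filter_upwards [ae_restrict_mem measurableSet_Ioc] with x hx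
    exact hK x (Ioc_subset_Icc_self hx)
  have s1 := hasSum_sq_fourierCoeffOn hab (hmem f hfc)
  have s2 := hasSum_sq_fourierCoeffOn hab (hmem f' hf')
  have hle := hasSum_le (fun n => ?_) s1 s2
  · have hpos : 0 < (π - -π)⁻¹ := by
      apply inv_pos.2
      linarith
    rw [smul_eq_mul, smul_eq_mul] at hle
    have := le_of_mul_le_mul_left hle hpos
    simpa only [Complex.norm_real, Real.norm_eq_abs, sq_abs] using this
  · rcases eq_or_ne n 0 with rfl | hn
    · have : fourierCoeffOn hab (fun x => (f x : ℂ)) 0 = 0 := by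
        rw [fourierCoeffOn_eq_integral]
        simp only [neg_zero, fourier_zero, one_smul]
        rw [intervalIntegral.integral_ofReal, hmean]
        simp
      rw [this]
      simp
    · have hcoef := fourierCoeffOn_of_hasDerivAt hab hn (f := fun x => (f x : ℂ))
        (f' := fun x => (f' x : ℂ)) (fun x _ => (hf x).ofReal_comp)
        ((Complex.continuous_ofReal.comp hf').intervalIntegrable _ _)
      rw [hcoef, hper, sub_self, mul_zero, zero_sub]
      have hn1 : (1 : ℝ) ≤ |(n : ℝ)| := by
        exact_mod_cast Int.one_le_abs hn
      have hnorm : ‖(1 : ℂ) / (-2 * π * Complex.I * n) * -((π - -π : ℝ) *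
          fourierCoeffOn hab (fun x => (f' x : ℂ)) n)‖ ≤
          ‖fourierCoeffOn hab (fun x => (f' x : ℂ)) n‖ := by
        have h2 : ‖((π - -π : ℝ) : ℂ)‖ = 2 * π := by
          rw [Complex.norm_real, Real.norm_eq_abs, abs_of_pos (by linarith)]
          ring
        rw [norm_mul, norm_neg, norm_mul, h2]
        simp only [norm_div, norm_one, norm_mul, norm_neg, Complex.norm_I, Complex.norm_intCast,
          Complex.norm_real, Real.norm_eq_abs, abs_of_pos pi_pos, Complex.norm_ofNat, mul_one]
        have hp := pi_pos
        have h3 : 1 / (2 * π * |(n : ℝ)|) * (2 * π *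
          ‖fourierCoeffOn hab (fun x => (f' x : ℂ)) n‖) =
            ‖fourierCoeffOn hab (fun x => (f' x : ℂ)) n‖ / |(n : ℝ)| := by
          field_simp
        rw [h3]
        exact div_le_self (norm_nonneg _) hn1
      push_cast at hnorm ⊢
      exact pow_le_pow_left₀ (norm_nonneg _) hnorm 2

theorem integral_sq_add {f g : ℝ → ℝ} (hf : Continuous f) (hg : Continuous g) (s t x y : ℝ) :
    ∫ θ in s..t, (x * f θ + y * g θ) ^ 2 = x ^ 2 * (∫ θ in s..t, f θ ^ 2) +
      2 * x * y * (∫ θ in s..t, f θ * g θ) + y ^ 2 * ∫ θ in s..t, g θ ^ 2 := by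
  rw [← intervalIntegral.integral_const_mul, ← intervalIntegral.integral_const_mul,
    ← intervalIntegral.integral_const_mul, ← intervalIntegral.integral_add,
    ← intervalIntegral.integral_add]
  · congr 1
    ext θ
    ring
  all_goals exact Continuous.intervalIntegrable (by fun_prop) _ _

theorem quadratic_integral_nonneg {f g : ℝ → ℝ} (hf : Continuous f) (hg : Continuous g)
    (x y : ℝ) : 0 ≤ x ^ 2 * (∫ θ in -π..π, f θ ^ 2) +
      2 * x * y * (∫ θ in -π..π, f θ * g θ) + y ^ 2 * ∫ θ in -π..π, g θ ^ 2 := by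
  rw [← integral_sq_add hf hg]
  exact intervalIntegral.integral_nonneg (by linarith [pi_pos]) fun θ _ => sq_nonneg _

/-- The angular inequality for a zero-mean pair of periodic functions. -/
theorem angular_inequality {f g f' g' : ℝ → ℝ} (hf : ∀ x, HasDerivAt f (f' x) x)
    (hg : ∀ x, HasDerivAt g (g' x) x) (hf' : Continuous f') (hg' : Continuous g')
    (hfp : f (-π) = f π) (hgp : g (-π) = g π)
    (hfm : ∫ x in -π..π, f x = 0) (hgm : ∫ x in -π..π, g x = 0) {t : ℝ} (ht : 0 < t) :
    2 * (1 - t) * (∫ x in -π..π, f x ^ 2) + 2 * (1 - 1 / t) * (∫ x in -π..π, g x ^ 2) ≤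
      (∫ x in -π..π, (f' x - g x) ^ 2) + ∫ x in -π..π, (g' x + f x) ^ 2 := by
  have hfc : Continuous f := continuous_iff_continuousAt.2 fun x => (hf x).continuousAt
  have hgc : Continuous g := continuous_iff_continuousAt.2 fun x => (hg x).continuousAt
  have e1 : ∫ x in -π..π, (f' x - g x) ^ 2 = (∫ x in -π..π, f' x ^ 2) -
      2 * (∫ x in -π..π, f' x * g x) + ∫ x in -π..π, g x ^ 2 := by
    have := integral_sq_add hf' hgc (-π) π 1 (-1)
    simp only [one_mul, neg_one_mul, ← sub_eq_add_neg] at this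
    rw [this]
    ring
  have e2 : ∫ x in -π..π, (g' x + f x) ^ 2 = (∫ x in -π..π, g' x ^ 2) +
      2 * (∫ x in -π..π, g' x * f x) + ∫ x in -π..π, f x ^ 2 := by
    have := integral_sq_add hg' hfc (-π) π 1 1
    simp only [one_mul] at this
    rw [this]
    ring
  have e3 : ∫ x in -π..π, f' x * g x = -∫ x in -π..π, g' x * f x := by
    have := intervalIntegral.integral_mul_deriv_eq_deriv_mul (a := -π) (b := π) (u := g) (v := f)
      (fun x _ => hg x) (fun x _ => hf x) (hg'.intervalIntegrable _ _) (hf'.intervalIntegrable _ _)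
    rw [hfp, hgp, sub_self, zero_sub] at this
    simp only [mul_comm (f' _)]
    exact this
  have w1 := wirtinger hf hf' hfp hfm
  have w2 := wirtinger hg hg' hgp hgm
  have q1 := quadratic_integral_nonneg hf' hgc t (-1)
  have q2 := quadratic_integral_nonneg hg' hfc 1 t
  rw [e1, e2]
  rw [e3] at q1 ⊢
  set F := ∫ x in -π..π, f x ^ 2
  set G := ∫ x in -π..π, g x ^ 2
  set F' := ∫ x in -π..π, f' x ^ 2
  set G' := ∫ x in -π..π, g' x ^ 2
  set Y := ∫ x in -π..π, g' x * f x
  have hs : 0 < 1 / t := by positivity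
  have hst : 1 / t * t = 1 := by field_simp
  set s := 1 / t
  have q1' : 0 ≤ t * F' + 2 * Y + s * G := by
    have := mul_nonneg hs.le q1
    have e : s * (t ^ 2 * F' + 2 * t * -1 * -Y + (-1) ^ 2 * G) = t * F' + 2 * Y + s * G := by
      linear_combination (t * F' + 2 * Y) * hst
    linarith
  have q2' : 0 ≤ s * G' + 2 * Y + t * F := by
    have := mul_nonneg hs.le q2
    have e : s * (1 ^ 2 * G' + 2 * 1 * t * Y + t ^ 2 * F) = s * G' + 2 * Y + t * F := by
      linear_combination (t * F + 2 * Y) * hst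
    linarith
  rcases le_total s 2 with h2 | h2
  · have r1 := mul_nonneg hs.le q1'
    have r2 := mul_nonneg (sub_nonneg.2 h2) q2'
    have r3 := mul_nonneg (sq_nonneg (1 - s)) (sub_nonneg.2 w2)
    have e4 : s * (t * F') = F' := by linear_combination F' * hst
    have e5 : s * (t * F) = F := by linear_combination F * hst
    nlinarith
  · have hn : 0 ≤ 1 - 2 * t := by nlinarith
    have r3 := mul_nonneg hn (sub_nonneg.2 w1)
    nlinarith

/-- The mean of a function over `[-π, π]`. -/
def angMean (f : ℝ → ℝ) : ℝ := (∫ θ in -π..π, f θ) / (2 * π)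

/-- The covariance integral of two functions over `[-π, π]`. -/
def angCov (f g : ℝ → ℝ) : ℝ := (∫ θ in -π..π, f θ * g θ) - 2 * π * (angMean f * angMean g)

theorem integral_eq_angMean (f : ℝ → ℝ) : ∫ θ in -π..π, f θ = 2 * π * angMean f := by
  have := pi_pos
  unfold angMean
  field_simp

theorem integral_sub_angMean {f : ℝ → ℝ} (hf : Continuous f) :
    ∫ θ in -π..π, (f θ - angMean f) = 0 := by
  rw [intervalIntegral.integral_sub (hf.intervalIntegrable _ _)
    (continuous_const.intervalIntegrable _ _), intervalIntegral.integral_const, smul_eq_mul,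
    integral_eq_angMean]
  ring

theorem integral_sub_mul_sub {f g : ℝ → ℝ} (hf : Continuous f) (hg : Continuous g) (m n : ℝ) :
    ∫ θ in -π..π, (f θ - m) * (g θ - n) = (∫ θ in -π..π, f θ * g θ) -
      n * (2 * π * angMean f) - m * (2 * π * angMean g) + 2 * π * (m * n) := by
  have h1 : (∫ θ in -π..π, (f θ - m) * (g θ - n)) =
      ∫ θ in -π..π, (f θ * g θ - n * f θ - m * g θ + m * n) := by
    congr 1
    ext θ
    ring
  rw [h1, intervalIntegral.integral_add, intervalIntegral.integral_sub,
    intervalIntegral.integral_sub, intervalIntegral.integral_const_mul,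
    intervalIntegral.integral_const_mul, intervalIntegral.integral_const, smul_eq_mul,
    integral_eq_angMean f, integral_eq_angMean g]
  · ring
  all_goals exact Continuous.intervalIntegrable (by fun_prop) _ _

theorem integral_center {f g : ℝ → ℝ} (hf : Continuous f) (hg : Continuous g) :
    ∫ θ in -π..π, (f θ - angMean f) * (g θ - angMean g) = angCov f g := by
  rw [integral_sub_mul_sub hf hg, angCov]
  ring

theorem integral_center_sq {f : ℝ → ℝ} (hf : Continuous f) :
    ∫ θ in -π..π, (f θ - angMean f) ^ 2 = angCov f f := by
  rw [← integral_center hf hf]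
  simp only [sq]

theorem angCov_quadratic_nonneg {f g : ℝ → ℝ} (hf : Continuous f) (hg : Continuous g)
    (x y : ℝ) : 0 ≤ x ^ 2 * angCov f f + 2 * x * y * angCov f g + y ^ 2 * angCov g g := by
  rw [← integral_center_sq hf, ← integral_center hf hg, ← integral_center_sq hg]
  exact quadratic_integral_nonneg (by fun_prop) (by fun_prop) x y

theorem angCov_self_nonneg {f : ℝ → ℝ} (hf : Continuous f) : 0 ≤ angCov f f := by
  simpa using angCov_quadratic_nonneg hf hf 1 0

theorem integral_sq_eq_angCov (f : ℝ → ℝ) :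
    ∫ θ in -π..π, f θ ^ 2 = angCov f f + 2 * π * angMean f ^ 2 := by
  simp only [angCov, sq]
  ring

theorem angCov_le_integral_deriv_sq {f f' : ℝ → ℝ} (hf : ∀ x, HasDerivAt f (f' x) x)
    (hf' : Continuous f') (hfp : f (-π) = f π) :
    angCov f f ≤ ∫ θ in -π..π, f' θ ^ 2 := by
  have hfc : Continuous f := continuous_iff_continuousAt.2 fun x => (hf x).continuousAt
  rw [← integral_center_sq hfc]
  exact wirtinger (fun x => (hf x).sub_const _) hf' (by simp [hfp]) (integral_sub_angMean hfc)

theorem angular_inequality_angCov {f g f' g' : ℝ → ℝ} (hf : ∀ x, HasDerivAt f (f' x) x)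
    (hg : ∀ x, HasDerivAt g (g' x) x) (hf' : Continuous f') (hg' : Continuous g')
    (hfp : f (-π) = f π) (hgp : g (-π) = g π) {t : ℝ} (ht : 0 < t) :
    2 * (1 - t) * angCov f f + 2 * (1 - 1 / t) * angCov g g +
      2 * π * (angMean f ^ 2 + angMean g ^ 2) ≤
      (∫ x in -π..π, (f' x - g x) ^ 2) + ∫ x in -π..π, (g' x + f x) ^ 2 := by
  have hfc : Continuous f := continuous_iff_continuousAt.2 fun x => (hf x).continuousAt
  have hgc : Continuous g := continuous_iff_continuousAt.2 fun x => (hg x).continuousAt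
  have key := angular_inequality (fun x => (hf x).sub_const (angMean f))
    (fun x => (hg x).sub_const (angMean g)) hf' hg' (by simp [hfp]) (by simp [hgp])
    (integral_sub_angMean hfc) (integral_sub_angMean hgc) ht
  rw [integral_center_sq hfc, integral_center_sq hgc] at key
  have mean0 : ∀ {φ φ' : ℝ → ℝ}, (∀ x, HasDerivAt φ (φ' x) x) → Continuous φ' →
      φ (-π) = φ π → ∫ x in -π..π, φ' x = 0 := by
    intro φ φ' h1 h2 h3
    rw [intervalIntegral.integral_eq_sub_of_hasDerivAt (fun x _ => h1 x)
      (h2.intervalIntegrable _ _), h3, sub_self]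
  have aux : ∀ {φ' ψ : ℝ → ℝ} (s : ℝ), s ^ 2 = 1 → Continuous φ' → Continuous ψ →
      ∫ x in -π..π, φ' x = 0 → ∫ x in -π..π, (φ' x + s * (ψ x - angMean ψ)) ^ 2 =
        (∫ x in -π..π, (φ' x + s * ψ x) ^ 2) - 2 * π * angMean ψ ^ 2 := by
    intro φ' ψ s hs h1 h2 h3
    have i1 := integral_sq_add (f := φ') (g := fun x => ψ x - angMean ψ) h1 (by fun_prop) (-π) π 1 s
    have i2 := integral_sq_add h1 h2 (-π) π 1 s
    simp only [one_mul] at i1 i2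
    rw [i1, i2, integral_center_sq h2, integral_sq_eq_angCov ψ]
    have i3 : ∫ x in -π..π, φ' x * (ψ x - angMean ψ) = ∫ x in -π..π, φ' x * ψ x := by
      have := integral_sub_mul_sub h1 h2 0 (angMean ψ)
      rw [← integral_eq_angMean, h3] at this
      simpa using this
    rw [i3]
    linear_combination (-(2 * π * angMean ψ ^ 2)) * hs
  have a1 := aux (-1) (by norm_num) hf' hgc (mean0 hf hf' hfp)
  have a2 := aux 1 (by norm_num) hg' hfc (mean0 hg hg' hgp)
  simp only [neg_one_mul, one_mul, ← sub_eq_add_neg] at a1 a2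
  rw [a1, a2] at key
  linarith

/-- Lower bound of the energy density integrated over a circle. -/
theorem circle_energy_lower_bound {r : ℝ} (hr : 0 < r) {w₀ w₁ w₂ t₀ t₁ t₂ d₀ d₁ d₂ : ℝ → ℝ}
    (h₀ : ∀ x, HasDerivAt w₀ (t₀ x) x) (h₁ : ∀ x, HasDerivAt w₁ (t₁ x) x)
    (h₂ : ∀ x, HasDerivAt w₂ (t₂ x) x) (ht₀ : Continuous t₀) (ht₁ : Continuous t₁)
    (ht₂ : Continuous t₂) (hd₀ : Continuous d₀) (hd₁ : Continuous d₁) (hd₂ : Continuous d₂)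
    (hp₀ : w₀ (-π) = w₀ π) (hp₁ : w₁ (-π) = w₁ π) (hp₂ : w₂ (-π) = w₂ π)
    {V₀ V₁ V₂ V W s t y₀ y₁ y₂ : ℝ} (hW : 0 ≤ W) (hWV : W ^ 2 = V ^ 2) (hs : 0 < s) (ht : 0 < t) :
    2 * π * (r * (angMean d₁ ^ 2 + angMean w₁ ^ 2 / r ^ 2 + angMean d₀ ^ 2 + V₁ * angMean w₁ ^ 2 +
        V₀ * angMean w₀ ^ 2 + 2 * V * (angMean w₀ * angMean w₁))) +
      2 * π * (r * angMean d₂ ^ 2 + angMean w₂ ^ 2 / r + r * V₂ * angMean w₂ ^ 2) +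
      (2 * r * y₀ * angCov w₀ d₀ +
        (1 / r + r * V₀ - r * W * s - r * y₀ ^ 2) * angCov w₀ w₀) +
      (2 * r * y₁ * angCov w₁ d₁ +
        (2 * (1 - t) / r + r * V₁ - r * W / s - r * y₁ ^ 2) * angCov w₁ w₁) +
      (2 * r * y₂ * angCov w₂ d₂ +
        (2 * (1 - 1 / t) / r + r * V₂ - r * y₂ ^ 2) * angCov w₂ w₂) ≤
    r * ((∫ x in -π..π, d₀ x ^ 2) + (∫ x in -π..π, d₁ x ^ 2) + ∫ x in -π..π, d₂ x ^ 2) +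
      ((∫ x in -π..π, t₀ x ^ 2) + (∫ x in -π..π, (t₁ x - w₂ x) ^ 2) +
        ∫ x in -π..π, (t₂ x + w₁ x) ^ 2) / r +
      r * (V₀ * (∫ x in -π..π, w₀ x ^ 2) + V₁ * (∫ x in -π..π, w₁ x ^ 2) +
        V₂ * (∫ x in -π..π, w₂ x ^ 2) + 2 * V * ∫ x in -π..π, w₀ x * w₁ x) := by
  have c₀ : Continuous w₀ := continuous_iff_continuousAt.2 fun x => (h₀ x).continuousAt
  have c₁ : Continuous w₁ := continuous_iff_continuousAt.2 fun x => (h₁ x).continuousAt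
  have c₂ : Continuous w₂ := continuous_iff_continuousAt.2 fun x => (h₂ x).continuousAt
  have ang := angular_inequality_angCov h₁ h₂ ht₁ ht₂ hp₁ hp₂ ht
  have ang0 := angCov_le_integral_deriv_sq h₀ ht₀ hp₀
  have q0 := angCov_quadratic_nonneg c₀ hd₀ y₀ (-1)
  have q1 := angCov_quadratic_nonneg c₁ hd₁ y₁ (-1)
  have q2 := angCov_quadratic_nonneg c₂ hd₂ y₂ (-1)
  have cross : 0 ≤ W * s * angCov w₀ w₀ + W / s * angCov w₁ w₁ + 2 * V * angCov w₀ w₁ := by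
    have e : ∀ σ : ℝ, σ ^ 2 = 1 → 0 ≤ s * angCov w₀ w₀ + 1 / s * angCov w₁ w₁ +
        2 * σ * angCov w₀ w₁ := by
      intro σ hσ
      have h1 := mul_nonneg (one_div_pos.2 hs).le (angCov_quadratic_nonneg c₀ c₁ s σ)
      have h2 : 1 / s * (s ^ 2 * angCov w₀ w₀ + 2 * s * σ * angCov w₀ w₁ +
          σ ^ 2 * angCov w₁ w₁) = s * angCov w₀ w₀ + 1 / s * angCov w₁ w₁ +
          2 * σ * angCov w₀ w₁ := by
        rw [hσ]
        field_simp
        ring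
      linarith
    rcases sq_eq_sq_iff_eq_or_eq_neg.1 hWV with h | h
    · have := mul_nonneg hW (e 1 (by norm_num))
      rw [← h]
      calc (0 : ℝ) ≤ _ := this
        _ = _ := by ring
    · have := mul_nonneg hW (e (-1) (by norm_num))
      have hV : V = -W := by linarith
      rw [hV]
      calc (0 : ℝ) ≤ _ := this
        _ = _ := by ring
  have w01 : ∫ x in -π..π, w₀ x * w₁ x = angCov w₀ w₁ + 2 * π * (angMean w₀ * angMean w₁) := by
    rw [angCov]
    ring
  simp only [integral_sq_eq_angCov d₀, integral_sq_eq_angCov d₁, integral_sq_eq_angCov d₂,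
    integral_sq_eq_angCov w₀, integral_sq_eq_angCov w₁, integral_sq_eq_angCov w₂, w01]
  have A := div_le_div_of_nonneg_right (add_le_add ang0 ang) hr.le
  have Q := mul_nonneg hr.le (add_nonneg (add_nonneg (add_nonneg q0 q1) q2) cross)
  have hri : 1 / r * r = 1 := by field_simp
  have hA : ∀ x : ℝ, r * (x / r ^ 2) = x / r := by
    intro x
    field_simp
  refine le_of_sub_nonneg (le_trans (add_nonneg (sub_nonneg.2 A) Q) (le_of_eq ?_))
  have e1 : r * (angMean w₁ ^ 2 / r ^ 2) = angMean w₁ ^ 2 / r := hA _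
  simp only [mul_add, e1]
  ring

theorem continuous_circle_integral {F : ℝ → ℝ → ℝ} (hF : Continuous (Function.uncurry F)) :
    Continuous fun r => ∫ θ in -π..π, F r θ :=
  intervalIntegral.continuous_parametric_intervalIntegral_of_continuous' hF _ _

theorem hasDerivAt_circle_integral {F F' : ℝ → ℝ → ℝ}
    (hF : ∀ r θ, HasDerivAt (fun s => F s θ) (F' r θ) r) (hFc : Continuous (Function.uncurry F))
    (hF' : Continuous (Function.uncurry F')) (r : ℝ) :
    HasDerivAt (fun r => ∫ θ in -π..π, F r θ) (∫ θ in -π..π, F' r θ) r := by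
  obtain ⟨K, hK⟩ := ((isCompact_Icc (a := r - 1) (b := r + 1)).prod
    (isCompact_uIcc (a := -π) (b := π))).exists_bound_of_continuousOn hF'.continuousOn
  have hc : ∀ s, Continuous (F s) := fun s => hFc.comp (by fun_prop : Continuous fun θ => (s, θ))
  have hc' : ∀ s, Continuous (F' s) := fun s =>
    hF'.comp (by fun_prop : Continuous fun θ => (s, θ))
  refine (intervalIntegral.hasDerivAt_integral_of_dominated_loc_of_deriv_le
    (s := Icc (r - 1) (r + 1)) (bound := fun _ => K) (Icc_mem_nhds (by linarith) (by linarith))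
    (Eventually.of_forall fun s => (hc s).aestronglyMeasurable) ((hc r).intervalIntegrable _ _)
    (hc' r).aestronglyMeasurable (Eventually.of_forall fun θ hθ s hs => ?_)
    (continuous_const.intervalIntegrable _ _)
    (Eventually.of_forall fun θ _ s _ => hF s θ)).2
  exact hK (s, θ) ⟨hs, uIoc_subset_uIcc hθ⟩

/-- A continuously differentiable function `w` of polar coordinates `(r, θ)`, with partial
derivatives `d = ∂w/∂r` and `t = ∂w/∂θ`, taking equal values at `θ = ±π`. -/
structure IsPolarField (w d t : ℝ → ℝ → ℝ) : Prop where
  hasDerivAt_r : ∀ r θ, HasDerivAt (fun s => w s θ) (d r θ) r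
  hasDerivAt_t : ∀ r θ, HasDerivAt (w r) (t r θ) θ
  cont : Continuous (Function.uncurry w)
  cont_d : Continuous (Function.uncurry d)
  cont_t : Continuous (Function.uncurry t)
  periodic : ∀ r, w r (-π) = w r π

namespace IsPolarField

variable {w d t : ℝ → ℝ → ℝ}

theorem slice_w (h : IsPolarField w d t) (r : ℝ) : Continuous (w r) :=
  h.cont.comp (by fun_prop : Continuous fun θ => (r, θ))

theorem slice_d (h : IsPolarField w d t) (r : ℝ) : Continuous (d r) :=
  h.cont_d.comp (by fun_prop : Continuous fun θ => (r, θ))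

theorem slice_t (h : IsPolarField w d t) (r : ℝ) : Continuous (t r) :=
  h.cont_t.comp (by fun_prop : Continuous fun θ => (r, θ))

theorem hasDerivAt_angMean (h : IsPolarField w d t) (r : ℝ) :
    HasDerivAt (fun r => angMean (w r)) (angMean (d r)) r :=
  (hasDerivAt_circle_integral h.hasDerivAt_r h.cont h.cont_d r).div_const _

theorem continuous_angMean_d (h : IsPolarField w d t) : Continuous fun r => angMean (d r) :=
  (continuous_circle_integral h.cont_d).div_const _

theorem hasDerivAt_angCov (h : IsPolarField w d t) (r : ℝ) :
    HasDerivAt (fun r => angCov (w r) (w r)) (2 * angCov (w r) (d r)) r := by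
  have h1 := hasDerivAt_circle_integral (F := fun r θ => w r θ * w r θ)
    (F' := fun r θ => d r θ * w r θ + w r θ * d r θ)
    (fun r θ => (h.hasDerivAt_r r θ).mul (h.hasDerivAt_r r θ)) (h.cont.mul h.cont)
    ((h.cont_d.mul h.cont).add (h.cont.mul h.cont_d)) r
  have hm := h.hasDerivAt_angMean r
  refine (h1.sub ((hm.mul hm).const_mul (2 * π))).congr_deriv ?_
  rw [intervalIntegral.integral_add, angCov]
  · simp only [mul_comm (d r _)]
    ring
  · exact ((h.slice_d r).mul (h.slice_w r)).intervalIntegrable _ _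
  · exact ((h.slice_w r).mul (h.slice_d r)).intervalIntegrable _ _

end IsPolarField

/-- The second variation density in polar coordinates, integrated over the circle of radius
`r`. -/
def circleEnergy (V₀ V₁ V₂ V : ℝ → ℝ) (w₀ d₀ t₀ w₁ d₁ t₁ w₂ d₂ t₂ : ℝ → ℝ → ℝ) (r : ℝ) : ℝ :=
  r * ((∫ x in -π..π, d₀ r x ^ 2) + (∫ x in -π..π, d₁ r x ^ 2) + ∫ x in -π..π, d₂ r x ^ 2) +
    ((∫ x in -π..π, t₀ r x ^ 2) + (∫ x in -π..π, (t₁ r x - w₂ r x) ^ 2) +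
      ∫ x in -π..π, (t₂ r x + w₁ r x) ^ 2) / r +
    r * (V₀ r * (∫ x in -π..π, w₀ r x ^ 2) + V₁ r * (∫ x in -π..π, w₁ r x ^ 2) +
      V₂ r * (∫ x in -π..π, w₂ r x ^ 2) + 2 * V r * ∫ x in -π..π, w₀ r x * w₁ r x)

theorem continuousOn_circleEnergy {V₀ V₁ V₂ V : ℝ → ℝ} {w₀ d₀ t₀ w₁ d₁ t₁ w₂ d₂ t₂ : ℝ → ℝ → ℝ}
    {I : Set ℝ} (hI : ∀ r ∈ I, r ≠ 0) (hV₀ : ContinuousOn V₀ I) (hV₁ : ContinuousOn V₁ I)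
    (hV₂ : ContinuousOn V₂ I) (hV : ContinuousOn V I) (h₀ : IsPolarField w₀ d₀ t₀)
    (h₁ : IsPolarField w₁ d₁ t₁) (h₂ : IsPolarField w₂ d₂ t₂) :
    ContinuousOn (circleEnergy V₀ V₁ V₂ V w₀ d₀ t₀ w₁ d₁ t₁ w₂ d₂ t₂) I := by
  have a1 := (continuous_circle_integral (F := fun r x => d₀ r x ^ 2) (h₀.cont_d.fun_pow 2)).continuousOn
    (s := I)
  have a2 := (continuous_circle_integral (F := fun r x => d₁ r x ^ 2) (h₁.cont_d.fun_pow 2)).continuousOn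
    (s := I)
  have a3 := (continuous_circle_integral (F := fun r x => d₂ r x ^ 2) (h₂.cont_d.fun_pow 2)).continuousOn
    (s := I)
  have b1 := (continuous_circle_integral (F := fun r x => t₀ r x ^ 2) (h₀.cont_t.fun_pow 2)).continuousOn
    (s := I)
  have b2 := (continuous_circle_integral (F := fun r x => (t₁ r x - w₂ r x) ^ 2)
    ((h₁.cont_t.fun_sub h₂.cont).fun_pow 2)).continuousOn (s := I)
  have b3 := (continuous_circle_integral (F := fun r x => (t₂ r x + w₁ r x) ^ 2)
    ((h₂.cont_t.fun_add h₁.cont).fun_pow 2)).continuousOn (s := I)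
  have c1 := (continuous_circle_integral (F := fun r x => w₀ r x ^ 2) (h₀.cont.fun_pow 2)).continuousOn
    (s := I)
  have c2 := (continuous_circle_integral (F := fun r x => w₁ r x ^ 2) (h₁.cont.fun_pow 2)).continuousOn
    (s := I)
  have c3 := (continuous_circle_integral (F := fun r x => w₂ r x ^ 2) (h₂.cont.fun_pow 2)).continuousOn
    (s := I)
  have c4 := (continuous_circle_integral (F := fun r x => w₀ r x * w₁ r x)
    (h₀.cont.mul h₁.cont)).continuousOn (s := I)
  unfold circleEnergy
  fun_prop (disch := assumption)

namespace IsProfile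

variable {a B c T : ℝ} {R : ℝ≥0∞} {u v p q : ℝ → ℝ}

/-- Stability of the profile implies nonnegativity of the full second variation for fields
supported away from the origin. -/
theorem integral_circleEnergy_nonneg (h : IsProfile a B c T R u v p q)
    (hst : ProfileStable a B c R u v) {w₀ d₀ t₀ w₁ d₁ t₁ w₂ d₂ t₂ : ℝ → ℝ → ℝ}
    (h₀ : IsPolarField w₀ d₀ t₀) (h₁ : IsPolarField w₁ d₁ t₁) (h₂ : IsPolarField w₂ d₂ t₂)
    {α β : ℝ} (hα : α ∈ Iset R) (hβ : β ∈ Iset R) (hαβ : α ≤ β)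
    (hs₀ : ∀ r, r ∉ Ioo α β → w₀ r = 0) (hs₁ : ∀ r, r ∉ Ioo α β → w₁ r = 0)
    (hs₂ : ∀ r, r ∉ Ioo α β → w₂ r = 0) :
    0 ≤ ∫ r in α..β, circleEnergy
      (fun r => -a - 2 * B * v r + c * (u r ^ 2 + 3 * v r ^ 2))
      (fun r => -a + 2 * B * v r + c * (3 * u r ^ 2 + v r ^ 2))
      (fun r => -a + 2 * B * v r + c * (u r ^ 2 + v r ^ 2))
      (fun r => 2 * u r * (B + c * v r)) w₀ d₀ t₀ w₁ d₁ t₁ w₂ d₂ t₂ r := by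
  obtain ⟨W, z, z', G, hW, hWV, hz, hz', hG, -, hG0, hG1⟩ := h.exists_supersolution hst
  have hu := h.continuousOn_u
  have hv := h.continuousOn_v
  have hp := h.continuousOn_p
  have hne : ∀ r ∈ Iset R, r ≠ 0 := fun r hr => hr.1.ne'
  have hsub : Icc α β ⊆ Iset R := Icc_subset_Iset hα hβ
  have mean0 : angMean 0 = 0 := by simp [angMean]
  have cov0 : angCov 0 0 = 0 := by simp [angCov, angMean]
  set V₀ : ℝ → ℝ := fun r => -a - 2 * B * v r + c * (u r ^ 2 + 3 * v r ^ 2) with hV₀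
  set V₁ : ℝ → ℝ := fun r => -a + 2 * B * v r + c * (3 * u r ^ 2 + v r ^ 2) with hV₁
  set V₂ : ℝ → ℝ := fun r => -a + 2 * B * v r + c * (u r ^ 2 + v r ^ 2) with hV₂
  set V : ℝ → ℝ := fun r => 2 * u r * (B + c * v r) with hV
  have cE : ContinuousOn (circleEnergy V₀ V₁ V₂ V w₀ d₀ t₀ w₁ d₁ t₁ w₂ d₂ t₂) (Iset R) :=
    continuousOn_circleEnergy hne (by fun_prop) (by fun_prop) (by fun_prop) (by fun_prop) h₀ h₁ h₂
  have prof := hst α β (fun r => angMean (w₁ r)) (fun r => angMean (w₀ r))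
    (fun r => angMean (d₁ r)) (fun r => angMean (d₀ r)) hα hβ hαβ h₁.hasDerivAt_angMean
    h₀.hasDerivAt_angMean h₁.continuous_angMean_d h₀.continuous_angMean_d
    (fun r hr => by rw [hs₁ r fun hr' => hr (Ioo_subset_Icc_self hr'), mean0])
    (fun r hr => by rw [hs₀ r fun hr' => hr (Ioo_subset_Icc_self hr'), mean0])
  set D : ℝ → ℝ := fun r => (angMean (d₁ r) ^ 2 + angMean (w₁ r) ^ 2 / r ^ 2 + angMean (d₀ r) ^ 2
      + V₁ r * angMean (w₁ r) ^ 2 + V₀ r * angMean (w₀ r) ^ 2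
      + 4 * u r * angMean (w₁ r) * angMean (w₀ r) * (B + c * v r)) * r with hD
  have cD : ContinuousOn D (Iset R) := by
    have k1 := (continuous_iff_continuousAt.2
      fun r => (h₁.hasDerivAt_angMean r).continuousAt).continuousOn (s := Iset R)
    have k0 := (continuous_iff_continuousAt.2
      fun r => (h₀.hasDerivAt_angMean r).continuousAt).continuousOn (s := Iset R)
    have l1 := h₁.continuous_angMean_d.continuousOn (s := Iset R)
    have l0 := h₀.continuous_angMean_d.continuousOn (s := Iset R)
    have hne2 : ∀ r ∈ Iset R, r ^ 2 ≠ 0 := fun r hr => pow_ne_zero 2 hr.1.ne'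
    fun_prop (disch := assumption)
  set Ψ : ℝ → ℝ := fun r => r * z' r / z r * angCov (w₀ r) (w₀ r) +
    r * (-p r / r + u r / r ^ 2 + u r * (-a + 2 * B * v r + c * (u r ^ 2 + v r ^ 2))) / p r *
      angCov (w₁ r) (w₁ r) +
    (p r - u r / r) / (u r / r) * angCov (w₂ r) (w₂ r) +
    2 * π * (r * p r / u r * angMean (w₂ r) ^ 2) with hΨ
  have hΨ0 : ∀ r, r ∉ Ioo α β → Ψ r = 0 := by
    intro r hr
    simp only [hΨ, hs₀ r hr, hs₁ r hr, hs₂ r hr, mean0, cov0]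
    ring
  have hΨd : ∀ r ∈ Iset R, ∃ ψ, HasDerivAt Ψ ψ r ∧
      ψ ≤ circleEnergy V₀ V₁ V₂ V w₀ d₀ t₀ w₁ d₁ t₁ w₂ d₂ t₂ r - 2 * π * D r := by
    intro r hr
    have hr0 : 0 < r := hr.1
    have hur := h.u_pos r hr
    have hpr := h.p_pos hst hr
    have hzr := hz r hr
    have hup : 0 < u r / r := by positivity
    have du := h.hasDerivAt_u r hr
    have dp := h.hasDerivAt_p r hr
    have dur := du.div (hasDerivAt_id' r) hr0.ne'
    have D0 := ((hG r hr).div (hz' r hr) hzr.ne').mul (h₀.hasDerivAt_angCov r)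
    have D1 := ((h.hasDerivAt_flux_p r hr).div dp hpr.ne').mul (h₁.hasDerivAt_angCov r)
    have D2 := ((dp.sub dur).div dur hup.ne').mul (h₂.hasDerivAt_angCov r)
    have D3 := ((((hasDerivAt_id' r).mul dp).div du hur.ne').mul
      ((h₂.hasDerivAt_angMean r).pow 2)).const_mul (2 * π)
    refine ⟨_, ((D0.add D1).add D2).add D3, ?_⟩
    have low := circle_energy_lower_bound hr0 (h₀.hasDerivAt_t r) (h₁.hasDerivAt_t r)
      (h₂.hasDerivAt_t r) (h₀.slice_t r) (h₁.slice_t r) (h₂.slice_t r) (h₀.slice_d r)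
      (h₁.slice_d r) (h₂.slice_d r) (h₀.periodic r) (h₁.periodic r) (h₂.periodic r)
      (V₀ := V₀ r) (V₁ := V₁ r) (V₂ := V₂ r) (V := V r) (W := W r) (s := p r / z r)
      (t := u r / r / p r) (y₀ := z' r / z r) (y₁ := (-p r / r + u r / r ^ 2 +
        u r * (-a + 2 * B * v r + c * (u r ^ 2 + v r ^ 2))) / p r)
      (y₂ := (p r - u r / r) / r / (u r / r)) (hW r hr) (hWV r hr) (by positivity) (by positivity)
    have n0 := angCov_self_nonneg (h₀.slice_w r)
    have n1 := angCov_self_nonneg (h₁.slice_w r)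
    have s0 := mul_le_mul_of_nonneg_right (div_le_div_of_nonneg_right (hG0 r hr) hzr.le) n0
    have s1 := mul_le_mul_of_nonneg_right (div_le_div_of_nonneg_right (hG1 r hr) hpr.le) n1
    have s3 := mul_nonneg (mul_nonneg (mul_nonneg zero_le_two pi_pos.le) hr0.le)
      (sq_nonneg (angMean (d₂ r) - p r / u r * angMean (w₂ r)))
    refine le_trans (le_of_sub_nonneg (le_trans (add_nonneg (add_nonneg (sub_nonneg.2 s0)
      (sub_nonneg.2 s1)) s3) (le_of_eq ?_))) (sub_le_sub_right low (2 * π * D r))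
    simp only [hD, hV, Pi.pow_apply, Pi.mul_apply, Pi.div_apply, Pi.sub_apply]
    generalize angCov (w₀ r) (w₀ r) = N₀
    generalize angCov (w₁ r) (w₁ r) = N₁
    generalize angCov (w₂ r) (w₂ r) = N₂
    generalize angCov (w₀ r) (d₀ r) = M₀
    generalize angCov (w₁ r) (d₁ r) = M₁
    generalize angCov (w₂ r) (d₂ r) = M₂
    generalize angMean (w₀ r) = m₀
    generalize angMean (w₁ r) = m₁
    generalize angMean (w₂ r) = m₂
    generalize angMean (d₀ r) = l₀
    generalize angMean (d₁ r) = l₁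
    generalize angMean (d₂ r) = l₂
    simp only [hV₀, hV₁, hV₂]
    field_simp
    ring
  have hle := intervalIntegral.sub_le_integral_of_hasDeriv_right_of_le (g := Ψ)
    (φ := fun r => circleEnergy V₀ V₁ V₂ V w₀ d₀ t₀ w₁ d₁ t₁ w₂ d₂ t₂ r - 2 * π * D r)
    (g' := deriv Ψ) hαβ ?_ ?_ ?_ ?_
  · rw [hΨ0 α (by simp), hΨ0 β (by simp), intervalIntegral.integral_sub,
      intervalIntegral.integral_const_mul] at hle
    · have := mul_nonneg (mul_nonneg zero_le_two pi_pos.le) prof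
      linarith
    · exact (cE.mono (by rwa [uIcc_of_le hαβ])).intervalIntegrable
    · exact ((continuousOn_const.mul cD).mono (by rwa [uIcc_of_le hαβ])).intervalIntegrable
  · intro r hr
    obtain ⟨ψ, hψ, -⟩ := hΨd r (hsub hr)
    exact hψ.continuousAt.continuousWithinAt
  · intro r hr
    obtain ⟨ψ, hψ, -⟩ := hΨd r (hsub (Ioo_subset_Icc_self hr))
    rw [hψ.deriv]
    exact hψ.hasDerivWithinAt
  · exact ((cE.sub (continuousOn_const.mul cD)).mono hsub).integrableOn_Icc
  · intro r hr
    obtain ⟨ψ, hψ, hle⟩ := hΨd r (hsub (Ioo_subset_Icc_self hr))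
    rw [hψ.deriv]
    exact hle

end IsProfile

theorem smoothTransition_hasDerivAt (x : ℝ) :
    HasDerivAt smoothTransition (deriv smoothTransition x) x :=
  ((smoothTransition.contDiff (n := 1)).differentiable one_ne_zero x).hasDerivAt

theorem continuous_deriv_smoothTransition : Continuous (deriv smoothTransition) :=
  (smoothTransition.contDiff (n := 1)).continuous_deriv le_rfl

theorem exists_deriv_smoothTransition_le : ∃ L, 0 ≤ L ∧ ∀ x, deriv smoothTransition x ≤ L := by
  obtain ⟨L, hL⟩ := (isCompact_Icc (a := (0 : ℝ)) (b := 1)).exists_bound_of_continuousOn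
    continuous_deriv_smoothTransition.continuousOn
  have hL0 : 0 ≤ L := (norm_nonneg _).trans (hL 0 (by simp))
  refine ⟨L, hL0, fun x => ?_⟩
  by_cases hx : x ∈ Icc (0 : ℝ) 1
  · exact (le_abs_self _).trans (hL x hx)
  · have : deriv smoothTransition x = 0 := by
      rcases lt_or_ge x 0 with h | h
      · have : smoothTransition =ᶠ[𝓝 x] fun _ => 0 := by
          filter_upwards [Iio_mem_nhds h] with y hy using smoothTransition.zero_of_nonpos hy.le
        rw [this.deriv_eq, deriv_const]
      · have h1 : 1 < x := by
          by_contra! h1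
          exact hx ⟨h, h1⟩
        have : smoothTransition =ᶠ[𝓝 x] fun _ => 1 := by
          filter_upwards [Ioi_mem_nhds h1] with y hy using smoothTransition.one_of_one_le hy.le
        rw [this.deriv_eq, deriv_const]
    rw [this]
    exact hL0

/-- Logarithmic cutoff functions at the origin. -/
theorem exists_log_cutoff : ∃ (χ χ' : ℕ → ℝ → ℝ) (α δ : ℕ → ℝ),
    (∀ n, 0 < α n) ∧ Tendsto α atTop (𝓝 0) ∧ (∀ n, 0 ≤ δ n) ∧ Tendsto δ atTop (𝓝 0) ∧
    (∀ n r, HasDerivAt (χ n) (χ' n r) r) ∧ (∀ n, Continuous (χ' n)) ∧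
    (∀ n r, r ≤ α n → χ n r = 0) ∧ (∀ n r, 0 ≤ χ n r) ∧ (∀ n r, χ n r ≤ 1) ∧
    (∀ n r, 0 ≤ χ' n r) ∧ (∀ n r, r * χ' n r ≤ δ n) ∧
    (∀ r, 0 < r → ∀ᶠ n in atTop, χ n r = 1) := by
  obtain ⟨L, hL0, hL⟩ := exists_deriv_smoothTransition_le
  have hinf : Tendsto (fun n : ℕ => (n : ℝ) + 1) atTop atTop :=
    tendsto_atTop_add_const_right _ _ tendsto_natCast_atTop_atTop
  set f : ℕ → ℝ → ℝ := fun n r => smoothTransition (2 + log r / (n + 1)) with hf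
  set f' : ℕ → ℝ → ℝ := fun n r =>
    deriv smoothTransition (2 + log r / (n + 1)) * (r⁻¹ / (n + 1)) with hf'
  set α : ℕ → ℝ := fun n => exp (-(2 * ((n : ℝ) + 1))) with hα
  have hα0 : ∀ n, 0 < α n := fun n => exp_pos _
  have hsub : ∀ n, Ici (α n) ⊆ Ioi 0 := fun n r hr => (hα0 n).trans_le hr
  have hfd : ∀ n, ∀ r ∈ Ioi (0 : ℝ), HasDerivAt (f n) (f' n r) r := by
    intro n r hr
    exact (smoothTransition_hasDerivAt _).comp r
      (((hasDerivAt_log (ne_of_gt hr)).div_const ((n : ℝ) + 1)).const_add 2)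
  have hfz' : ∀ n, ∀ r ∈ Ioi (0 : ℝ), r ≤ α n → f n r = 0 := by
    intro n r hr hrK
    apply smoothTransition.zero_of_nonpos
    have h1 : log r ≤ -(2 * ((n : ℝ) + 1)) := by
      have := log_le_log hr hrK
      rwa [hα, log_exp] at this
    have hn : (0 : ℝ) < (n : ℝ) + 1 := by positivity
    have : log r / ((n : ℝ) + 1) ≤ -2 := by
      rw [div_le_iff₀ hn]
      linarith
    linarith
  have hfz : ∀ n, ∀ r ∈ Ioi (0 : ℝ), r ∉ Ici (α n) → f n r = 0 := by
    intro n r hr hrK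
    exact hfz' n r hr (not_le.1 hrK).le
  have hf'c : ∀ n, ContinuousOn (f' n) (Ioi 0) := by
    intro n
    have hne : ∀ r ∈ Ioi (0 : ℝ), r ≠ 0 := fun r hr => ne_of_gt hr
    refine (continuous_deriv_smoothTransition.comp_continuousOn
      (continuousOn_const.add ((continuousOn_log.mono hne).div_const _))).mul
      ((continuousOn_inv₀.mono hne).div_const _)
  have hf'0 : ∀ n, ∀ r ∈ Ioi (0 : ℝ), 0 ≤ f' n r := fun n r hr =>
    mul_nonneg (smoothTransition.monotone.deriv_nonneg) (div_nonneg (inv_nonneg.2 (le_of_lt hr))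
      (by positivity))
  refine ⟨fun n => (Ici (α n)).indicator (f n), fun n => (Ici (α n)).indicator (f' n), α,
    fun n => L / ((n : ℝ) + 1), hα0, ?_, fun n => by positivity, hinf.const_div_atTop L,
    fun n => hasDerivAt_indicator isOpen_Ioi isClosed_Ici (hsub n) (hfd n) (hfz n),
    fun n => continuous_indicator_deriv isOpen_Ioi isClosed_Ici (hsub n) (hfd n) (hfz n) (hf'c n),
    ?_, ?_, ?_, ?_, ?_, ?_⟩
  · exact tendsto_exp_neg_atTop_nhds_zero.comp (hinf.const_mul_atTop two_pos)
  · intro n r hr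
    beta_reduce
    by_cases h : r ∈ Ici (α n)
    · rw [indicator_of_mem h]
      exact hfz' n r (hsub n h) hr
    · exact indicator_of_notMem h _
  · exact fun n r => indicator_nonneg (fun r _ => smoothTransition.nonneg _) r
  · exact fun n r => indicator_apply_le' (fun _ => smoothTransition.le_one _)
      (fun _ => zero_le_one)
  · exact fun n r => indicator_nonneg (fun r hr => hf'0 n r (hsub n hr)) r
  · intro n r
    beta_reduce
    by_cases h : r ∈ Ici (α n)
    · have hr : 0 < r := hsub n h
      rw [indicator_of_mem h]
      have : r * f' n r = deriv smoothTransition (2 + log r / (n + 1)) / (n + 1) := by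
        simp only [hf']
        field_simp
      rw [this]
      gcongr
      exact hL _
    · rw [indicator_of_notMem h, mul_zero]
      positivity
  · intro r hr
    have e1 : ∀ᶠ n : ℕ in atTop, -log r ≤ (n : ℝ) + 1 := hinf.eventually_ge_atTop _
    filter_upwards [e1] with n hn
    have hn0 : (0 : ℝ) < (n : ℝ) + 1 := by positivity
    have hm : r ∈ Ici (α n) := by
      rw [mem_Ici, hα, ← le_log_iff_exp_le hr]
      linarith
    rw [indicator_of_mem hm]
    apply smoothTransition.one_of_one_le
    have : -1 ≤ log r / ((n : ℝ) + 1) := by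
      rw [le_div_iff₀ hn0]
      linarith
    linarith

theorem IsPolarField.mul_radial {w d t : ℝ → ℝ → ℝ} (h : IsPolarField w d t) {χ χ' : ℝ → ℝ}
    (hχ : ∀ r, HasDerivAt χ (χ' r) r) (hχ' : Continuous χ') :
    IsPolarField (fun r θ => χ r * w r θ) (fun r θ => χ' r * w r θ + χ r * d r θ)
      (fun r θ => χ r * t r θ) := by
  have hc : Continuous χ := continuous_iff_continuousAt.2 fun r => (hχ r).continuousAt
  have hc1 : Continuous fun x : ℝ × ℝ => χ x.1 := hc.comp continuous_fst
  have hc2 : Continuous fun x : ℝ × ℝ => χ' x.1 := hχ'.comp continuous_fst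
  exact ⟨fun r θ => (hχ r).mul (h.hasDerivAt_r r θ), fun r θ => (h.hasDerivAt_t r θ).const_mul _,
    hc1.mul h.cont, (hc2.mul h.cont).add (hc1.mul h.cont_d), hc1.mul h.cont_t,
    fun r => by rw [h.periodic r]⟩

theorem circleEnergy_mul_radial {V₀ V₁ V₂ V : ℝ → ℝ} {w₀ d₀ t₀ w₁ d₁ t₁ w₂ d₂ t₂ : ℝ → ℝ → ℝ}
    (h₀ : IsPolarField w₀ d₀ t₀) (h₁ : IsPolarField w₁ d₁ t₁) (h₂ : IsPolarField w₂ d₂ t₂)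
    (χ χ' : ℝ → ℝ) (r : ℝ) :
    circleEnergy V₀ V₁ V₂ V (fun r θ => χ r * w₀ r θ) (fun r θ => χ' r * w₀ r θ + χ r * d₀ r θ)
      (fun r θ => χ r * t₀ r θ) (fun r θ => χ r * w₁ r θ)
      (fun r θ => χ' r * w₁ r θ + χ r * d₁ r θ) (fun r θ => χ r * t₁ r θ)
      (fun r θ => χ r * w₂ r θ) (fun r θ => χ' r * w₂ r θ + χ r * d₂ r θ)
      (fun r θ => χ r * t₂ r θ) r =
    χ r ^ 2 * circleEnergy V₀ V₁ V₂ V w₀ d₀ t₀ w₁ d₁ t₁ w₂ d₂ t₂ r +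
      (2 * (χ r * (r * χ' r)) * ((∫ x in -π..π, w₀ r x * d₀ r x) + (∫ x in -π..π, w₁ r x * d₁ r x) +
        ∫ x in -π..π, w₂ r x * d₂ r x) + χ' r * (r * χ' r) * ((∫ x in -π..π, w₀ r x ^ 2) +
        (∫ x in -π..π, w₁ r x ^ 2) + ∫ x in -π..π, w₂ r x ^ 2)) := by
  simp only [circleEnergy]
  rw [integral_sq_add (h₀.slice_w r) (h₀.slice_d r), integral_sq_add (h₁.slice_w r) (h₁.slice_d r),
    integral_sq_add (h₂.slice_w r) (h₂.slice_d r)]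
  have e1 : ∀ x, (χ r * t₁ r x - χ r * w₂ r x) ^ 2 = χ r ^ 2 * (t₁ r x - w₂ r x) ^ 2 :=
    fun x => by ring
  have e2 : ∀ x, (χ r * t₂ r x + χ r * w₁ r x) ^ 2 = χ r ^ 2 * (t₂ r x + w₁ r x) ^ 2 :=
    fun x => by ring
  have e3 : ∀ x, χ r * w₀ r x * (χ r * w₁ r x) = χ r ^ 2 * (w₀ r x * w₁ r x) := fun x => by ring
  simp only [e1, e2, e3, mul_pow, intervalIntegral.integral_const_mul]
  ring

namespace IsProfile

variable {a B c T : ℝ} {R : ℝ≥0∞} {u v p q : ℝ → ℝ}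

/-- Stability of the profile implies nonnegativity of the full second variation, including for
fields that do not vanish near the origin. -/
theorem integral_circleEnergy_nonneg_of_integrable (h : IsProfile a B c T R u v p q)
    (hst : ProfileStable a B c R u v) {w₀ d₀ t₀ w₁ d₁ t₁ w₂ d₂ t₂ : ℝ → ℝ → ℝ}
    (h₀ : IsPolarField w₀ d₀ t₀) (h₁ : IsPolarField w₁ d₁ t₁) (h₂ : IsPolarField w₂ d₂ t₂)
    {β : ℝ} (hβ : β ∈ Iset R) (hs₀ : ∀ r, β ≤ r → w₀ r = 0) (hs₁ : ∀ r, β ≤ r → w₁ r = 0)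
    (hs₂ : ∀ r, β ≤ r → w₂ r = 0)
    (hint : IntervalIntegrable (circleEnergy
      (fun r => -a - 2 * B * v r + c * (u r ^ 2 + 3 * v r ^ 2))
      (fun r => -a + 2 * B * v r + c * (3 * u r ^ 2 + v r ^ 2))
      (fun r => -a + 2 * B * v r + c * (u r ^ 2 + v r ^ 2))
      (fun r => 2 * u r * (B + c * v r)) w₀ d₀ t₀ w₁ d₁ t₁ w₂ d₂ t₂) volume 0 β) :
    0 ≤ ∫ r in (0 : ℝ)..β, circleEnergy
      (fun r => -a - 2 * B * v r + c * (u r ^ 2 + 3 * v r ^ 2))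
      (fun r => -a + 2 * B * v r + c * (3 * u r ^ 2 + v r ^ 2))
      (fun r => -a + 2 * B * v r + c * (u r ^ 2 + v r ^ 2))
      (fun r => 2 * u r * (B + c * v r)) w₀ d₀ t₀ w₁ d₁ t₁ w₂ d₂ t₂ r := by
  obtain ⟨χ, χ', α, δ, hα0, hα, hδ0, hδ, hχ, hχ', hχz, hχ0, hχ1, hχ'0, hχδ, hχe⟩ := exists_log_cutoff
  have hu := h.continuousOn_u
  have hv := h.continuousOn_v
  have hβ0 : 0 < β := hβ.1
  have hne : ∀ r ∈ Iset R, r ≠ 0 := fun r hr => hr.1.ne'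
  set V₀ : ℝ → ℝ := fun r => -a - 2 * B * v r + c * (u r ^ 2 + 3 * v r ^ 2) with hV₀
  set V₁ : ℝ → ℝ := fun r => -a + 2 * B * v r + c * (3 * u r ^ 2 + v r ^ 2) with hV₁
  set V₂ : ℝ → ℝ := fun r => -a + 2 * B * v r + c * (u r ^ 2 + v r ^ 2) with hV₂
  set V : ℝ → ℝ := fun r => 2 * u r * (B + c * v r) with hV
  set e := circleEnergy V₀ V₁ V₂ V w₀ d₀ t₀ w₁ d₁ t₁ w₂ d₂ t₂ with he
  have ce : ContinuousOn e (Iset R) :=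
    continuousOn_circleEnergy hne (by fun_prop) (by fun_prop) (by fun_prop) (by fun_prop) h₀ h₁ h₂
  have hχc : ∀ n, Continuous (χ n) := fun n =>
    continuous_iff_continuousAt.2 fun r => (hχ n r).continuousAt
  set C : ℝ → ℝ := fun r => (∫ x in -π..π, w₀ r x * d₀ r x) + (∫ x in -π..π, w₁ r x * d₁ r x) +
        ∫ x in -π..π, w₂ r x * d₂ r x with hC
  set S : ℝ → ℝ := fun r => (∫ x in -π..π, w₀ r x ^ 2) +
        (∫ x in -π..π, w₁ r x ^ 2) + ∫ x in -π..π, w₂ r x ^ 2 with hS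
  have cC : Continuous C :=
    ((continuous_circle_integral (F := fun r x => w₀ r x * d₀ r x) (h₀.cont.mul h₀.cont_d)).add
    (continuous_circle_integral (F := fun r x => w₁ r x * d₁ r x) (h₁.cont.mul h₁.cont_d))).add
    (continuous_circle_integral (F := fun r x => w₂ r x * d₂ r x) (h₂.cont.mul h₂.cont_d))
  have cS : Continuous S :=
    ((continuous_circle_integral (F := fun r x => w₀ r x ^ 2) (h₀.cont.fun_pow 2)).add
    (continuous_circle_integral (F := fun r x => w₁ r x ^ 2) (h₁.cont.fun_pow 2))).add
    (continuous_circle_integral (F := fun r x => w₂ r x ^ 2) (h₂.cont.fun_pow 2))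
  obtain ⟨K₁, hK₁⟩ := (isCompact_Icc (a := 0) (b := β)).exists_bound_of_continuousOn cC.continuousOn
  obtain ⟨K₂, hK₂⟩ := (isCompact_Icc (a := 0) (b := β)).exists_bound_of_continuousOn cS.continuousOn
  have hK₁0 : 0 ≤ K₁ := (norm_nonneg _).trans (hK₁ 0 (by simp [hβ0.le]))
  have hK₂0 : 0 ≤ K₂ := (norm_nonneg _).trans (hK₂ 0 (by simp [hβ0.le]))
  have lim : Tendsto (fun n => (∫ r in (0 : ℝ)..β, χ n r ^ 2 * e r) +
      (2 * δ n * K₁ * β + δ n * K₂)) atTop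
      (𝓝 ((∫ r in (0 : ℝ)..β, e r) + (2 * 0 * K₁ * β + 0 * K₂))) := by
    refine Tendsto.add ?_ ((((hδ.const_mul 2).mul_const _).mul_const _).add (hδ.mul_const _))
    refine intervalIntegral.tendsto_integral_filter_of_dominated_convergence (fun r => ‖e r‖)
      (Eventually.of_forall fun n => ?_) (Eventually.of_forall fun n =>
        Eventually.of_forall fun r _ => ?_) hint.norm (Eventually.of_forall fun r hr => ?_)
    · exact ((hχc n).pow 2).aestronglyMeasurable.mul hint.def'.aestronglyMeasurable
    · rw [norm_mul, norm_pow, norm_eq_abs, abs_of_nonneg (hχ0 n r)]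
      exact mul_le_of_le_one_left (norm_nonneg _) (pow_le_one₀ (hχ0 n r) (hχ1 n r))
    · rw [uIoc_of_le hβ0.le] at hr
      refine tendsto_const_nhds.congr' ?_
      filter_upwards [hχe r hr.1] with n hn
      rw [hn, one_pow, one_mul]
  rw [show (∫ r in (0 : ℝ)..β, e r) = (∫ r in (0 : ℝ)..β, e r) + (2 * 0 * K₁ * β + 0 * K₂) by ring]
  refine ge_of_tendsto lim ?_
  filter_upwards [hα.eventually_le_const hβ0] with n hn
  have hαm : α n ∈ Iset R := Iset_of_le hβ (hα0 n) hn
  have hsub : Icc (α n) β ⊆ Iset R := Icc_subset_Iset hαm hβ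
  have hz : ∀ w : ℝ → ℝ → ℝ, (∀ r, β ≤ r → w r = 0) → ∀ r, r ∉ Ioo (α n) β →
      (fun θ => χ n r * w r θ) = 0 := by
    intro w hw r hr
    rcases le_or_gt r (α n) with h | h
    · ext θ
      simp [hχz n r h]
    · ext θ
      simp [hw r (not_lt.1 fun h' => hr ⟨h, h'⟩)]
  have g₀ := h₀.mul_radial (hχ n) (hχ' n)
  have g₁ := h₁.mul_radial (hχ n) (hχ' n)
  have g₂ := h₂.mul_radial (hχ n) (hχ' n)
  have key := h.integral_circleEnergy_nonneg hst g₀ g₁ g₂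
    hαm hβ hn (hz _ hs₀) (hz _ hs₁) (hz _ hs₂)
  have cE := continuousOn_circleEnergy (V₀ := V₀) (V₁ := V₁) (V₂ := V₂) (V := V) hne
    (by fun_prop) (by fun_prop) (by fun_prop) (by fun_prop) g₀ g₁ g₂
  have cF : ContinuousOn (fun r => χ n r ^ 2 * e r) (Icc (α n) β) :=
    ((hχc n).pow 2).continuousOn.mul (ce.mono hsub)
  have hle : ∫ r in (α n)..β, _ ≤ ∫ r in (α n)..β,
      (χ n r ^ 2 * e r + (2 * δ n * K₁ + δ n * K₂ * χ' n r)) :=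
    intervalIntegral.integral_mono_on hn ((cE.mono (by rwa [uIcc_of_le hn])).intervalIntegrable)
    (ContinuousOn.intervalIntegrable (by
      rw [uIcc_of_le hn]
      exact cF.add (continuousOn_const.add (continuousOn_const.mul (hχ' n).continuousOn))))
    fun r hr => by
      rw [circleEnergy_mul_radial h₀ h₁ h₂]
      have hr0 : 0 < r := (hα0 n).trans_le hr.1
      have b1 := hK₁ r ⟨hr0.le, hr.2⟩
      have b2 := hK₂ r ⟨hr0.le, hr.2⟩
      have i1 : χ n r * (r * χ' n r) ≤ δ n :=
        (mul_le_of_le_one_left (mul_nonneg hr0.le (hχ'0 n r)) (hχ1 n r)).trans (hχδ n r)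
      have i2 : χ n r * (r * χ' n r) * C r ≤ δ n * K₁ :=
        mul_le_mul_of_nonneg i1 ((le_abs_self _).trans b1)
          (mul_nonneg (hχ0 n r) (mul_nonneg hr0.le (hχ'0 n r))) hK₁0
      have i3 : χ' n r * (r * χ' n r) * S r ≤ χ' n r * δ n * K₂ :=
        mul_le_mul_of_nonneg (mul_le_mul_of_nonneg_left (hχδ n r) (hχ'0 n r))
          ((le_abs_self _).trans b2)
          (mul_nonneg (hχ'0 n r) (mul_nonneg hr0.le (hχ'0 n r))) hK₂0
      refine add_le_add_right ?_ _
      linarith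
  have e0 : ∫ r in (0 : ℝ)..(α n), χ n r ^ 2 * e r = 0 := by
    refine intervalIntegral.integral_zero_ae (Eventually.of_forall fun r hr => ?_)
    rw [uIoc_of_le (hα0 n).le] at hr
    rw [hχz n r hr.2]
    ring
  have iE : IntervalIntegrable (fun r => χ n r ^ 2 * e r) volume 0 β :=
    hint.continuousOn_mul ((hχc n).pow 2).continuousOn
  rw [← intervalIntegral.integral_add_adjacent_intervals (b := α n)
    (iE.mono_set (by rw [uIcc_of_le (hα0 n).le, uIcc_of_le hβ0.le]; exact Icc_subset_Icc_right hn))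
    (iE.mono_set (by rw [uIcc_of_le hn, uIcc_of_le hβ0.le]; exact Icc_subset_Icc_left (hα0 n).le)),
    e0, zero_add]
  have iχ := ((hχ' n).intervalIntegrable (μ := volume) (α n) β)
  rw [intervalIntegral.integral_add (cF.mono (by rw [uIcc_of_le hn])).intervalIntegrable
    (intervalIntegrable_const.add (iχ.const_mul _)),
    intervalIntegral.integral_add intervalIntegrable_const (iχ.const_mul _),
    intervalIntegral.integral_const, intervalIntegral.integral_const_mul,
    intervalIntegral.integral_eq_sub_of_hasDerivAt (fun r _ => hχ n r) iχ, hχz n _ le_rfl,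
    smul_eq_mul] at hle
  have j1 : (β - α n) * (2 * δ n * K₁) ≤ β * (2 * δ n * K₁) :=
    mul_le_mul_of_nonneg_right (by linarith [hα0 n])
      (mul_nonneg (mul_nonneg zero_le_two (hδ0 n)) hK₁0)
  have j2 : δ n * K₂ * χ n β ≤ δ n * K₂ :=
    mul_le_of_le_one_right (mul_nonneg (hδ0 n) hK₂0) (hχ1 n β)
  linarith

end IsProfile

theorem sPlus_pos {a2 b2 c2 : ℝ} (hb : 0 < b2) (hc : 0 < c2) : 0 < sPlus a2 b2 c2 := by
  unfold sPlus
  have := sqrt_nonneg (b2 ^ 2 + 24 * a2 * c2)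
  positivity

theorem sPlus_quadratic {a2 b2 c2 : ℝ} (ha : 0 ≤ a2) (hc : 0 < c2) :
    2 * c2 * sPlus a2 b2 c2 ^ 2 - b2 * sPlus a2 b2 c2 = 3 * a2 := by
  unfold sPlus
  have := sq_sqrt (show 0 ≤ b2 ^ 2 + 24 * a2 * c2 by positivity)
  set D := √(b2 ^ 2 + 24 * a2 * c2)
  field_simp
  linear_combination 2 * this

namespace ProfileSolution

variable {a2 b2 c2 : ℝ} {k : ℤ} {R : ℝ≥0∞} {u v : ℝ → ℝ}

theorem _root_.ContDiffOn.hasDerivAt_and_deriv {f : ℝ → ℝ} {s : Set ℝ} (hf : ContDiffOn ℝ 2 f s)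
    (hs : IsOpen s) {r : ℝ} (hr : r ∈ s) :
    HasDerivAt f (deriv f r) r ∧ HasDerivAt (deriv f) (deriv (deriv f) r) r := by
  have h1 : ContDiffOn ℝ 1 (deriv f) s := hf.deriv_of_isOpen hs (by norm_num)
  exact ⟨((hf.differentiableOn two_ne_zero r hr).differentiableAt (hs.mem_nhds hr)).hasDerivAt,
    ((h1.differentiableOn one_ne_zero r hr).differentiableAt (hs.mem_nhds hr)).hasDerivAt⟩

theorem isProfile (ha : 0 ≤ a2) (hb : 0 < b2) (hc : 0 < c2) (hk : (k : ℝ) ^ 2 = 1) (hR : 0 < R)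
    (h : ProfileSolution a2 b2 c2 k R u v) (hu : ∀ r ∈ Iset R, 0 < u r)
    (hv : ∀ r ∈ Iset R, v r < 0) :
    IsProfile a2 (b2 / √6) c2 (sPlus a2 b2 c2 / √6) R u v (deriv u) (deriv v) := by
  have h6 : √6 ^ 2 = 6 := sq_sqrt (by norm_num)
  have h6p : 0 < √6 := by positivity
  refine ⟨by positivity, hc, div_pos (sPlus_pos hb hc) h6p, ha, ?_, hR, hu, hv,
    fun r hr => (h.smooth_u.hasDerivAt_and_deriv (isOpen_Iset R) hr).1,
    fun r hr => (h.smooth_v.hasDerivAt_and_deriv (isOpen_Iset R) hr).1, fun r hr => ?_,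
    fun r hr => ?_, h.bc0_u, h.bc0_v, ?_, h.bcR_v⟩
  · have := sPlus_quadratic (b2 := b2) ha hc
    field_simp
    rw [h6]
    linarith
  · refine (h.smooth_u.hasDerivAt_and_deriv (isOpen_Iset R) hr).2.congr_deriv ?_
    have := h.ode_u r hr
    rw [hk, hfun] at this
    linear_combination this
  · refine (h.smooth_v.hasDerivAt_and_deriv (isOpen_Iset R) hr).2.congr_deriv ?_
    have := h.ode_v r hr
    rw [gfun] at this
    linear_combination this
  · convert h.bcR_u using 2
    rw [show (6 : ℝ) = 2 * 3 by norm_num, sqrt_mul zero_le_two]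
    field_simp

theorem profileStable (hk : (k : ℝ) ^ 2 = 1)
    (hstab : ∀ ξ η : ℝ → ℝ, ContDiff ℝ 1 ξ → ContDiff ℝ 1 η →
      HasCompactSupport ξ → HasCompactSupport η →
      tsupport ξ ⊆ Iset R → tsupport η ⊆ Iset R → 0 ≤ Bform a2 b2 c2 k R u v ξ η) :
    ProfileStable a2 (b2 / √6) c2 R u v := by
  intro α β ξ η ξ' η' hα hβ hαβ hξ hη hξ' hη' hξs hηs
  have dξ : deriv ξ = ξ' := funext fun r => (hξ r).deriv
  have dη : deriv η = η' := funext fun r => (hη r).deriv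
  have hsub : Icc α β ⊆ Iset R := Icc_subset_Iset hα hβ
  have tξ : tsupport ξ ⊆ Icc α β :=
    closure_minimal (fun r hr => by_contra fun h => hr (hξs r h)) isClosed_Icc
  have tη : tsupport η ⊆ Icc α β :=
    closure_minimal (fun r hr => by_contra fun h => hr (hηs r h)) isClosed_Icc
  have key := hstab ξ η
    (contDiff_one_iff_deriv.2 ⟨fun r => (hξ r).differentiableAt, by rwa [dξ]⟩)
    (contDiff_one_iff_deriv.2 ⟨fun r => (hη r).differentiableAt, by rwa [dη]⟩)
    (isCompact_Icc.of_isClosed_subset (isClosed_tsupport _) tξ)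
    (isCompact_Icc.of_isClosed_subset (isClosed_tsupport _) tη) (tξ.trans hsub) (tη.trans hsub)
  rw [Bform, setIntegral_eq_of_subset_of_forall_sdiff_eq_zero (isOpen_Iset R).measurableSet hsub,
    integral_Icc_eq_integral_Ioc, ← intervalIntegral.integral_of_le hαβ] at key
  · refine key.trans_eq (intervalIntegral.integral_congr fun r _ => ?_)
    simp only [hk, dξ, dη]
    ring
  · intro r hr
    have d1 : deriv ξ r = 0 := by
      by_contra hne
      exact hr.2 (tξ (support_deriv_subset hne))
    have d2 : deriv η r = 0 := by
      by_contra hne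
      exact hr.2 (tη (support_deriv_subset hne))
    simp [d1, d2, hξs r hr.2, hηs r hr.2]

end ProfileSolution

/-- The point of the plane with polar coordinates `(r, θ)`. -/
def polarPt (r θ : ℝ) : EuclideanSpace ℝ (Fin 2) :=
  (r * cos θ) • EuclideanSpace.single 0 1 + (r * sin θ) • EuclideanSpace.single 1 1

theorem polarPt_zero_apply (r θ : ℝ) : polarPt r θ 0 = r * cos θ := by simp [polarPt]

theorem polarPt_one_apply (r θ : ℝ) : polarPt r θ 1 = r * sin θ := by simp [polarPt]

theorem norm_polarPt {r : ℝ} (hr : 0 ≤ r) (θ : ℝ) : ‖polarPt r θ‖ = r := by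
  rw [EuclideanSpace.norm_eq, Fin.sum_univ_two, polarPt_zero_apply, polarPt_one_apply]
  rw [norm_eq_abs, norm_eq_abs, sq_abs, sq_abs, mul_pow, mul_pow, ← mul_add, cos_sq_add_sin_sq,
    mul_one, sqrt_sq hr]

theorem continuous_polarPt : Continuous (Function.uncurry polarPt) := by
  unfold polarPt
  fun_prop

/-- Change of variables from the plane to polar coordinates. -/
theorem integral_polarPt {f : EuclideanSpace ℝ (Fin 2) → ℝ} (hf : Integrable f) :
    IntegrableOn (fun r => ∫ θ in -π..π, r * f (polarPt r θ)) (Ioi 0) ∧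
      ∫ x, f x = ∫ r in Ioi (0 : ℝ), ∫ θ in -π..π, r * f (polarPt r θ) := by
  have mp := (EuclideanSpace.volume_preserving_symm_measurableEquiv_toLp (Fin 2)).symm.comp
    (volume_preserving_finTwoArrow ℝ).symm
  set g : ℝ × ℝ → EuclideanSpace ℝ (Fin 2) := (MeasurableEquiv.toLp 2 (Fin 2 → ℝ)).symm.symm ∘
    MeasurableEquiv.finTwoArrow.symm with hg
  have me : MeasurableEmbedding g := (MeasurableEquiv.measurableEmbedding _).comp
    (MeasurableEquiv.measurableEmbedding _)
  have hgp : ∀ p, g (polarCoord.symm p) = polarPt p.1 p.2 := by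
    intro p
    ext i
    fin_cases i
    · simp [hg, polarPt_zero_apply]
    · simp [hg, polarPt_one_apply]
  have i1 : Integrable (f ∘ g) := (mp.integrable_comp_emb me).2 hf
  have i2 : IntegrableOn (fun p : ℝ × ℝ => p.1 * f (polarPt p.1 p.2)) polarCoord.target := by
    have := (integrableOn_image_iff_integrableOn_abs_det_fderiv_smul volume
      polarCoord.open_target.measurableSet
      (fun p _ => (hasFDerivAt_polarCoord_symm p).hasFDerivWithinAt) polarCoord.symm.injOn
      (f ∘ g)).1 i1.integrableOn
    refine this.congr_fun (fun p hp => ?_) polarCoord.open_target.measurableSet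
    simp only [det_fderivPolarCoordSymm, Function.comp_apply, hgp, smul_eq_mul]
    rw [abs_of_pos hp.1]
  have hI : ∀ r, ∫ θ in -π..π, r * f (polarPt r θ) = ∫ θ in Ioo (-π) π, r * f (polarPt r θ) :=
    fun r => by rw [intervalIntegral.integral_of_le (by linarith [pi_pos]),
      integral_Ioc_eq_integral_Ioo]
  simp only [hI]
  rw [polarCoord_target] at i2
  constructor
  · rw [IntegrableOn, Measure.volume_eq_prod, ← Measure.prod_restrict] at i2
    exact i2.integral_prod_left
  · rw [← mp.integral_comp me, ← integral_comp_polarCoord_symm, polarCoord_target]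
    simp only [hgp, smul_eq_mul]
    exact setIntegral_prod _ i2

namespace IsPolarField

variable {w d t w' d' t' : ℝ → ℝ → ℝ}

theorem add (h : IsPolarField w d t) (h' : IsPolarField w' d' t') :
    IsPolarField (fun r θ => w r θ + w' r θ) (fun r θ => d r θ + d' r θ)
      (fun r θ => t r θ + t' r θ) :=
  ⟨fun r θ => (h.hasDerivAt_r r θ).add (h'.hasDerivAt_r r θ),
    fun r θ => (h.hasDerivAt_t r θ).add (h'.hasDerivAt_t r θ), h.cont.add h'.cont,
    h.cont_d.add h'.cont_d, h.cont_t.add h'.cont_t, fun r => by rw [h.periodic, h'.periodic]⟩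

theorem mul_angular (h : IsPolarField w d t) {φ φ' : ℝ → ℝ} (hφ : ∀ θ, HasDerivAt φ (φ' θ) θ)
    (hφ' : Continuous φ') (hp : φ (-π) = φ π) :
    IsPolarField (fun r θ => w r θ * φ θ) (fun r θ => d r θ * φ θ)
      (fun r θ => t r θ * φ θ + w r θ * φ' θ) := by
  have hc : Continuous φ := continuous_iff_continuousAt.2 fun r => (hφ r).continuousAt
  have hc1 : Continuous fun x : ℝ × ℝ => φ x.2 := hc.comp continuous_snd
  have hc2 : Continuous fun x : ℝ × ℝ => φ' x.2 := hφ'.comp continuous_snd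
  exact ⟨fun r θ => (h.hasDerivAt_r r θ).mul_const _, fun r θ => (h.hasDerivAt_t r θ).mul (hφ θ),
    h.cont.mul hc1, h.cont_d.mul hc1, (h.cont_t.mul hc1).add (h.cont.mul hc2),
    fun r => by rw [h.periodic, hp]⟩

theorem _root_.ContDiff.isPolarField {f : EuclideanSpace ℝ (Fin 2) → ℝ} (hf : ContDiff ℝ 1 f) :
    IsPolarField (fun r θ => f (polarPt r θ))
      (fun r θ => fderiv ℝ f (polarPt r θ) (EuclideanSpace.single 0 1) * cos θ +
        fderiv ℝ f (polarPt r θ) (EuclideanSpace.single 1 1) * sin θ)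
      (fun r θ => r * (fderiv ℝ f (polarPt r θ) (EuclideanSpace.single 1 1) * cos θ -
        fderiv ℝ f (polarPt r θ) (EuclideanSpace.single 0 1) * sin θ)) := by
  have hd : ∀ x, HasFDerivAt f (fderiv ℝ f x) x := fun x =>
    (hf.differentiable one_ne_zero x).hasFDerivAt
  have hc : ∀ e, Continuous fun x : ℝ × ℝ => fderiv ℝ f (polarPt x.1 x.2) e := fun e =>
    ((hf.continuous_fderiv one_ne_zero).clm_apply continuous_const).comp continuous_polarPt
  refine ⟨fun r θ => ?_, fun r θ => ?_, hf.continuous.comp continuous_polarPt, ?_, ?_, ?_⟩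
  · have h1 : HasDerivAt (fun s => polarPt s θ) (((1 : ℝ) * cos θ) • EuclideanSpace.single 0 1 +
        ((1 : ℝ) * sin θ) • EuclideanSpace.single 1 1) r :=
      (((hasDerivAt_id' r).mul_const (cos θ)).smul_const _).add
        (((hasDerivAt_id' r).mul_const (sin θ)).smul_const _)
    refine ((hd _).comp_hasDerivAt r h1).congr_deriv ?_
    rw [map_add, map_smul, map_smul, smul_eq_mul, smul_eq_mul]
    ring
  · have h1 : HasDerivAt (polarPt r) ((r * -sin θ) • EuclideanSpace.single 0 1 +
        (r * cos θ) • EuclideanSpace.single 1 1) θ :=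
      (((hasDerivAt_cos θ).const_mul r).smul_const _).add
        (((hasDerivAt_sin θ).const_mul r).smul_const _)
    refine ((hd _).comp_hasDerivAt θ h1).congr_deriv ?_
    rw [map_add, map_smul, map_smul, smul_eq_mul, smul_eq_mul]
    ring
  · have h0 := hc (EuclideanSpace.single 0 1)
    have h1 := hc (EuclideanSpace.single 1 1)
    unfold Function.uncurry
    fun_prop
  · have h0 := hc (EuclideanSpace.single 0 1)
    have h1 := hc (EuclideanSpace.single 1 1)
    unfold Function.uncurry
    fun_prop
  · intro r
    simp [polarPt]

end IsPolarField

theorem exists_support_radius {R : ℝ≥0∞} (hR : 0 < R) {K : Set (EuclideanSpace ℝ (Fin 2))}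
    (hK : IsCompact K) (hKR : K ⊆ ball2 R) : ∃ β ∈ Iset R, ∀ x ∈ K, ‖x‖ < β := by
  rcases K.eq_empty_or_nonempty with rfl | hne
  · obtain ⟨β, hβ⟩ := exists_mem_Iset hR
    exact ⟨β, hβ, by simp⟩
  · obtain ⟨x, hx, hmax⟩ := hK.exists_isMaxOn hne continuous_norm.continuousOn
    obtain ⟨b, hb1, hb2⟩ := exists_between (show ENNReal.ofReal ‖x‖ < R from hKR hx)
    have hb : b ≠ ⊤ := (hb2.trans_le le_top).ne
    have hlt : ‖x‖ < b.toReal := (ENNReal.ofReal_lt_iff_lt_toReal (norm_nonneg _) hb).1 hb1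
    exact ⟨b.toReal, ⟨(norm_nonneg _).trans_lt hlt, by rwa [ENNReal.ofReal_toReal hb]⟩,
      fun y hy => (hmax hy).trans_lt hlt⟩

theorem circleEnergy_eq_integral {V₀ V₁ V₂ V : ℝ → ℝ} {w₀ d₀ t₀ w₁ d₁ t₁ w₂ d₂ t₂ : ℝ → ℝ → ℝ}
    (h₀ : IsPolarField w₀ d₀ t₀) (h₁ : IsPolarField w₁ d₁ t₁) (h₂ : IsPolarField w₂ d₂ t₂)
    (r : ℝ) : circleEnergy V₀ V₁ V₂ V w₀ d₀ t₀ w₁ d₁ t₁ w₂ d₂ t₂ r =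
      ∫ x in -π..π, (r * (d₀ r x ^ 2 + d₁ r x ^ 2 + d₂ r x ^ 2) +
        (t₀ r x ^ 2 + (t₁ r x - w₂ r x) ^ 2 + (t₂ r x + w₁ r x) ^ 2) / r +
        r * (V₀ r * w₀ r x ^ 2 + V₁ r * w₁ r x ^ 2 + V₂ r * w₂ r x ^ 2 +
          2 * V r * (w₀ r x * w₁ r x))) := by
  have a0 := h₀.slice_d r
  have a1 := h₁.slice_d r
  have a2 := h₂.slice_d r
  have b0 := h₀.slice_t r
  have b1 := h₁.slice_t r
  have b2 := h₂.slice_t r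
  have c0 := h₀.slice_w r
  have c1 := h₁.slice_w r
  have c2 := h₂.slice_w r
  unfold circleEnergy
  rw [intervalIntegral.integral_add, intervalIntegral.integral_add,
    intervalIntegral.integral_const_mul, intervalIntegral.integral_const_mul,
    intervalIntegral.integral_div, intervalIntegral.integral_add, intervalIntegral.integral_add,
    intervalIntegral.integral_add, intervalIntegral.integral_add, intervalIntegral.integral_add,
    intervalIntegral.integral_add, intervalIntegral.integral_add,
    intervalIntegral.integral_const_mul, intervalIntegral.integral_const_mul,
    intervalIntegral.integral_const_mul, intervalIntegral.integral_const_mul]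
  all_goals exact Continuous.intervalIntegrable (by fun_prop) _ _

/-- The potential part of the second variation density, in the moving frame adapted to `Q`. -/
theorem potential_density {b2 k : ℝ} (a2 c2 u v x y z C S : ℝ) (hk : k ^ 2 = 1)
    (hCS : C ^ 2 + S ^ 2 = 1) {Q P : Matrix (Fin 3) (Fin 3) ℝ}
    (hQ : Q = !![u * C / √2 - √(3 / 2) * v / 3, k * u * S / √2, 0;
      k * u * S / √2, -(u * C / √2) - √(3 / 2) * v / 3, 0; 0, 0, 2 * (√(3 / 2) * v) / 3])
    (hP : P = !![x, y, 0; y, z, 0; 0, 0, -x - z]) {w₀ w₁ w₂ : ℝ}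
    (h₀ : w₀ = -√(3 / 2) * (x + z)) (h₁ : w₁ = (x - z) / √2 * C + k * √2 * y * S)
    (h₂ : w₂ = (x - z) / √2 * -S + k * √2 * y * C) :
    -a2 * (P * P).trace - 2 * b2 * (P * P * Q).trace +
        c2 * ((Q * Q).trace * (P * P).trace + 2 * (Q * P).trace ^ 2) =
      (-a2 - 2 * (b2 / √6) * v + c2 * (u ^ 2 + 3 * v ^ 2)) * w₀ ^ 2 +
      (-a2 + 2 * (b2 / √6) * v + c2 * (3 * u ^ 2 + v ^ 2)) * w₁ ^ 2 +
      (-a2 + 2 * (b2 / √6) * v + c2 * (u ^ 2 + v ^ 2)) * w₂ ^ 2 +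
      2 * (2 * u * (b2 / √6 + c2 * v)) * (w₀ * w₁) := by
  set m := √(3 / 2) with hm
  set n := √2 / 2 with hn
  have hm2 : m ^ 2 = 3 / 2 := sq_sqrt (by norm_num)
  have h22 : √2 ^ 2 = 2 := sq_sqrt (by norm_num)
  have hn2 : n ^ 2 = 1 / 2 := by
    rw [hn, div_pow, h22]
    norm_num
  have h2n : √2 = 2 * n := by rw [hn]; ring
  have hdiv : ∀ t, t / √2 = t * n := fun t => by
    rw [hn]
    field_simp
    rw [h22]
  have hb : b2 / √6 = b2 * (m / 3) := by
    have : √6 = m * 2 := by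
      rw [hm, show (6 : ℝ) = 3 / 2 * 2 ^ 2 by norm_num, sqrt_mul (by norm_num),
        sqrt_sq (by norm_num)]
    have hm0 : m ≠ 0 := by
      rw [hm]
      positivity
    rw [this]
    field_simp
    linear_combination -2 * b2 * hm2
  rw [hdiv, h2n] at h₁ h₂
  simp only [hdiv] at hQ
  have tPP : (P * P).trace = w₀ ^ 2 + (w₁ ^ 2 + w₂ ^ 2) := by
    have e : w₁ ^ 2 + w₂ ^ 2 = ((x - z) ^ 2 + 4 * y ^ 2) / 2 := by
      rw [h₁, h₂]
      linear_combination ((x - z) ^ 2 * n ^ 2 + k ^ 2 * 4 * n ^ 2 * y ^ 2) * hCS +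
        ((x - z) ^ 2 + 4 * k ^ 2 * y ^ 2) * hn2 + 2 * y ^ 2 * hk
    rw [e, h₀, hP]
    simp [Matrix.trace_fin_three]
    linear_combination -(x + z) ^ 2 * hm2
  have tQQ : (Q * Q).trace = u ^ 2 + v ^ 2 := by
    rw [hQ]
    simp [Matrix.trace_fin_three]
    linear_combination 2 / 3 * v ^ 2 * hm2 + 2 * u ^ 2 * n ^ 2 * hCS + 2 * u ^ 2 * hn2 +
      2 * u ^ 2 * S ^ 2 * n ^ 2 * hk
  have tQP : (Q * P).trace = v * w₀ + u * w₁ := by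
    rw [hQ, hP, h₀, h₁]
    simp [Matrix.trace_fin_three]
    ring
  have tPPQ : (P * P * Q).trace =
      m / 3 * (v * w₀ ^ 2 - v * (w₁ ^ 2 + w₂ ^ 2) - 2 * u * (w₀ * w₁)) := by
    have e : v * (w₁ ^ 2 + w₂ ^ 2) = v * ((P * P).trace - w₀ ^ 2) := by
      rw [tPP]
      ring
    rw [e, h₀, h₁, hP, hQ]
    simp [Matrix.trace_fin_three]
    linear_combination (-(2 / 3) * m * v * (x + z) ^ 2 -
      2 / 3 * u * (x + z) * ((x - z) * n * C + k * (2 * n) * y * S)) * hm2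
  rw [tPP, tQQ, tQP, tPPQ, hb]
  ring

theorem gradSq_eq {P : EuclideanSpace ℝ (Fin 2) → Matrix (Fin 3) (Fin 3) ℝ}
    {x : EuclideanSpace ℝ (Fin 2)} {k : ℝ} (hk : k ^ 2 = 1)
    (h00 : DifferentiableAt ℝ (fun y => P y 0 0) x)
    (h01 : DifferentiableAt ℝ (fun y => P y 0 1) x) (h11 : DifferentiableAt ℝ (fun y => P y 1 1) x)
    (hP : ∀ x, P x = !![P x 0 0, P x 0 1, 0; P x 0 1, P x 1 1, 0; 0, 0, -P x 0 0 - P x 1 1]) :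
    gradSq P x = ∑ α : Fin 2,
      ((fderiv ℝ (fun y => -√(3 / 2) * (P y 0 0 + P y 1 1)) x (EuclideanSpace.single α 1)) ^ 2 +
      (fderiv ℝ (fun y => (P y 0 0 - P y 1 1) / √2) x (EuclideanSpace.single α 1)) ^ 2 +
      (fderiv ℝ (fun y => k * √2 * P y 0 1) x (EuclideanSpace.single α 1)) ^ 2) := by
  have e02 : ∀ y, P y 0 2 = 0 := fun y => congrFun (congrFun (hP y) 0) 2
  have e12 : ∀ y, P y 1 2 = 0 := fun y => congrFun (congrFun (hP y) 1) 2
  have e20 : ∀ y, P y 2 0 = 0 := fun y => congrFun (congrFun (hP y) 2) 0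
  have e21 : ∀ y, P y 2 1 = 0 := fun y => congrFun (congrFun (hP y) 2) 1
  have e10 : ∀ y, P y 1 0 = P y 0 1 := fun y => congrFun (congrFun (hP y) 1) 0
  have e22 : ∀ y, P y 2 2 = -P y 0 0 - P y 1 1 := fun y => congrFun (congrFun (hP y) 2) 2
  have f0 : fderiv ℝ (fun y => -√(3 / 2) * (P y 0 0 + P y 1 1)) x =
      -√(3 / 2) • (fderiv ℝ (fun y => P y 0 0) x + fderiv ℝ (fun y => P y 1 1) x) :=
    ((h00.hasFDerivAt.add h11.hasFDerivAt).const_mul _).fderiv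
  have f1 : fderiv ℝ (fun y => (P y 0 0 - P y 1 1) / √2) x =
      (√2)⁻¹ • (fderiv ℝ (fun y => P y 0 0) x - fderiv ℝ (fun y => P y 1 1) x) := by
    simp only [div_eq_inv_mul]
    exact ((h00.hasFDerivAt.sub h11.hasFDerivAt).const_mul _).fderiv
  have f2 : fderiv ℝ (fun y => k * √2 * P y 0 1) x = (k * √2) • fderiv ℝ (fun y => P y 0 1) x :=
    (h01.hasFDerivAt.const_mul _).fderiv
  have f3 : fderiv ℝ (fun y => -P y 0 0 - P y 1 1) x =
      -fderiv ℝ (fun y => P y 0 0) x - fderiv ℝ (fun y => P y 1 1) x :=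
    (h00.hasFDerivAt.neg.sub h11.hasFDerivAt).fderiv
  unfold gradSq
  refine Finset.sum_congr rfl fun α _ => ?_
  simp only [Fin.sum_univ_three, e02, e12, e20, e21, e10, e22, f0, f1, f2, f3, fderiv_fun_const,
    Pi.zero_apply, zero_apply, smul_apply,
    add_apply, sub_apply, neg_apply,
    smul_eq_mul, mul_pow, inv_pow, neg_sq, hk]
  rw [sq_sqrt (by norm_num : (0 : ℝ) ≤ 3 / 2), sq_sqrt zero_le_two]
  ring

theorem Qmap_polarPt (k : ℤ) (u v : ℝ → ℝ) {r : ℝ} (hr : 0 < r) (θ : ℝ) :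
    Qmap k u v (polarPt r θ) =
      !![u r * cos θ / √2 - √(3 / 2) * v r / 3, k * u r * sin θ / √2, 0;
        k * u r * sin θ / √2, -(u r * cos θ / √2) - √(3 / 2) * v r / 3, 0;
        0, 0, 2 * (√(3 / 2) * v r) / 3] := by
  have hn := norm_polarPt hr.le θ
  have hne : polarPt r θ ≠ 0 := by
    rw [← norm_ne_zero_iff, hn]
    exact hr.ne'
  rw [Qmap, hn, if_neg hne]
  ext i j
  fin_cases i <;> fin_cases j <;>
    simp [Mk, E0base, polarPt_zero_apply, polarPt_one_apply] <;> field_simp <;> ring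

theorem polar_gradient_density {r C S : ℝ} (hr : r ≠ 0) (hCS : C ^ 2 + S ^ 2 = 1)
    (f₁ f₂ x₀ y₀ x₁ y₁ x₂ y₂ : ℝ) :
    r * ((x₀ * C + y₀ * S) ^ 2 + ((x₁ * C + y₁ * S) * C + (x₂ * C + y₂ * S) * S) ^ 2 +
        ((x₁ * C + y₁ * S) * -S + (x₂ * C + y₂ * S) * C) ^ 2) +
      ((r * (y₀ * C - x₀ * S)) ^ 2 +
        ((r * (y₁ * C - x₁ * S) * C + f₁ * -S) + (r * (y₂ * C - x₂ * S) * S + f₂ * C) -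
          (f₁ * -S + f₂ * C)) ^ 2 +
        ((r * (y₁ * C - x₁ * S) * -S + f₁ * -C) + (r * (y₂ * C - x₂ * S) * C + f₂ * -S) +
          (f₁ * C + f₂ * S)) ^ 2) / r =
      r * ((x₀ ^ 2 + x₁ ^ 2 + x₂ ^ 2) + (y₀ ^ 2 + y₁ ^ 2 + y₂ ^ 2)) := by
  have e : ∀ x y : ℝ, (x * C + y * S) ^ 2 + (y * C - x * S) ^ 2 = x ^ 2 + y ^ 2 := fun x y => by
    linear_combination (x ^ 2 + y ^ 2) * hCS
  have e' : ∀ x y : ℝ, (x * C + y * S) ^ 2 + (x * -S + y * C) ^ 2 = x ^ 2 + y ^ 2 := fun x y => by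
    linear_combination (x ^ 2 + y ^ 2) * hCS
  have h1 := e' (x₁ * C + y₁ * S) (x₂ * C + y₂ * S)
  have h2 := e' (y₁ * C - x₁ * S) (y₂ * C - x₂ * S)
  field_simp
  linear_combination r ^ 2 * (e x₀ y₀ + h1 + h2 + e x₁ y₁ + e x₂ y₂)

/-- The second variation density. -/
def variationDensity (a2 b2 c2 : ℝ) (Q P : EuclideanSpace ℝ (Fin 2) → Matrix (Fin 3) (Fin 3) ℝ)
    (x : EuclideanSpace ℝ (Fin 2)) : ℝ :=
  gradSq P x - a2 * (P x * P x).trace - 2 * b2 * (P x * P x * Q x).trace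
      + c2 * ((Q x * Q x).trace * (P x * P x).trace + 2 * ((Q x * P x).trace) ^ 2)

theorem variationDensity_eq_zero {a2 b2 c2 : ℝ}
    {Q P : EuclideanSpace ℝ (Fin 2) → Matrix (Fin 3) (Fin 3) ℝ} {x : EuclideanSpace ℝ (Fin 2)}
    (hx : x ∉ tsupport P) : variationDensity a2 b2 c2 Q P x = 0 := by
  have h0 : P =ᶠ[𝓝 x] 0 := notMem_tsupport_iff_eventuallyEq.1 hx
  have hd : ∀ i j, fderiv ℝ (fun y => P y i j) x = 0 := fun i j => by
    have : (fun y => P y i j) =ᶠ[𝓝 x] fun _ => 0 := h0.mono fun y hy => by simp [hy]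
    rw [this.fderiv_eq, fderiv_fun_const]
    rfl
  have hPx : P x = 0 := h0.self_of_nhds
  simp [variationDensity, gradSq, hd, hPx]

theorem eq_of_symm_traceless {M : Matrix (Fin 3) (Fin 3) ℝ} (hs : M.IsSymm) (ht : M.trace = 0)
    (h02 : M 0 2 = 0) (h12 : M 1 2 = 0) :
    M = !![M 0 0, M 0 1, 0; M 0 1, M 1 1, 0; 0, 0, -M 0 0 - M 1 1] := by
  rw [Matrix.trace_fin_three] at ht
  have h10 : M 1 0 = M 0 1 := hs.apply 0 1
  have h20 : M 2 0 = 0 := (hs.apply 0 2).trans h02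
  have h21 : M 2 1 = 0 := (hs.apply 1 2).trans h12
  have h22 : M 2 2 = -M 0 0 - M 1 1 := by linarith
  ext i j
  fin_cases i <;> fin_cases j <;> simp [h02, h12, h10, h20, h21, h22]

/-- The second variation on `V₁` is nonnegative as soon as it is a convergent integral. -/
theorem Lform_nonneg_of_integrable {a2 b2 c2 T : ℝ} {k : ℤ} {R : ℝ≥0∞} {u v p q : ℝ → ℝ}
    (h : IsProfile a2 (b2 / √6) c2 T R u v p q) (hst : ProfileStable a2 (b2 / √6) c2 R u v)
    (hk : (k : ℝ) ^ 2 = 1) {P : EuclideanSpace ℝ (Fin 2) → Matrix (Fin 3) (Fin 3) ℝ}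
    (hPd : ∀ i j, ContDiff ℝ 1 fun x => P x i j) (hPc : HasCompactSupport P)
    (hPs : tsupport P ⊆ ball2 R)
    (hP : ∀ x, P x = !![P x 0 0, P x 0 1, 0; P x 0 1, P x 1 1, 0; 0, 0, -P x 0 0 - P x 1 1])
    (hint : Integrable (variationDensity a2 b2 c2 (Qmap k u v) P)) :
    0 ≤ ∫ x, variationDensity a2 b2 c2 (Qmap k u v) P x := by
  obtain ⟨β, hβ, hβK⟩ := exists_support_radius h.R_pos hPc hPs
  have hβ0 : 0 < β := hβ.1
  have F₀ := ((contDiff_const (c := -√(3 / 2))).mul ((hPd 0 0).add (hPd 1 1))).isPolarField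
  have F₁ := (((hPd 0 0).sub (hPd 1 1)).div_const (√2)).isPolarField
  have F₂ := ((contDiff_const (c := (k : ℝ) * √2)).mul (hPd 0 1)).isPolarField
  have hnc : ∀ θ, HasDerivAt (fun θ => -sin θ) (-cos θ) θ := fun θ => (hasDerivAt_sin θ).fun_neg
  have G₁ := (F₁.mul_angular hasDerivAt_cos continuous_sin.neg (by simp)).add
    (F₂.mul_angular hasDerivAt_sin continuous_cos (by simp))
  have G₂ := (F₁.mul_angular hnc continuous_cos.neg (by simp)).add
    (F₂.mul_angular hasDerivAt_cos continuous_sin.neg (by simp))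
  have far : ∀ r, β ≤ r → ∀ θ, polarPt r θ ∉ tsupport P := fun r hr θ hm => by
    have := hβK _ hm
    rw [norm_polarPt (hβ0.le.trans hr)] at this
    linarith
  have far' : ∀ r, β ≤ r → ∀ θ i j, P (polarPt r θ) i j = 0 := fun r hr θ i j => by
    rw [image_eq_zero_of_notMem_tsupport (far r hr θ)]
    rfl
  set V₀ : ℝ → ℝ := fun r => -a2 - 2 * (b2 / √6) * v r + c2 * (u r ^ 2 + 3 * v r ^ 2) with hV₀
  set V₁ : ℝ → ℝ := fun r => -a2 + 2 * (b2 / √6) * v r + c2 * (3 * u r ^ 2 + v r ^ 2) with hV₁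
  set V₂ : ℝ → ℝ := fun r => -a2 + 2 * (b2 / √6) * v r + c2 * (u r ^ 2 + v r ^ 2) with hV₂
  set V : ℝ → ℝ := fun r => 2 * u r * (b2 / √6 + c2 * v r) with hV
  have dens : ∀ r, 0 < r →
      ∫ θ in -π..π, r * variationDensity a2 b2 c2 (Qmap k u v) P (polarPt r θ) =
      circleEnergy V₀ V₁ V₂ V _ _ _ _ _ _ _ _ _ r := fun r hr => by
    rw [circleEnergy_eq_integral F₀ G₁ G₂]
    refine intervalIntegral.integral_congr fun θ _ => ?_
    beta_reduce
    rw [polar_gradient_density hr.ne' (cos_sq_add_sin_sq θ), variationDensity,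
      gradSq_eq hk ((hPd 0 0).differentiable one_ne_zero _)
        ((hPd 0 1).differentiable one_ne_zero _) ((hPd 1 1).differentiable one_ne_zero _) hP,
      Fin.sum_univ_two]
    have pot := potential_density (b2 := b2) a2 c2 (u r) (v r) _ _ _ _ _ hk
      (cos_sq_add_sin_sq θ) (Qmap_polarPt k u v hr θ) (hP (polarPt r θ)) rfl rfl rfl
    rw [← pot]
    ring
  obtain ⟨hi, he⟩ := integral_polarPt hint
  have hz : ∀ r ∈ Ioi (0 : ℝ) \ Ioc 0 β,
      ∫ θ in -π..π, r * variationDensity a2 b2 c2 (Qmap k u v) P (polarPt r θ) = 0 := by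
    intro r hr
    have hr' : β ≤ r := by
      by_contra! hlt
      exact hr.2 ⟨hr.1, hlt.le⟩
    simp [variationDensity_eq_zero (far r hr' _)]
  rw [he, setIntegral_eq_of_subset_of_forall_sdiff_eq_zero measurableSet_Ioi
    Ioc_subset_Ioi_self hz, setIntegral_congr_fun measurableSet_Ioc fun r hr => dens r hr.1,
    ← intervalIntegral.integral_of_le hβ0.le]
  refine h.integral_circleEnergy_nonneg_of_integrable hst F₀ G₁ G₂ hβ ?_ ?_ ?_ ?_
  · intro r hr
    ext θ
    simp [far' r hr]
  · intro r hr
    ext θ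
    simp [far' r hr]
  · intro r hr
    ext θ
    simp [far' r hr]
  · rw [intervalIntegrable_iff_integrableOn_Ioc_of_le hβ0.le]
    exact (hi.mono_set Ioc_subset_Ioi_self).congr_fun (fun r hr => dens r hr.1) measurableSet_Ioc

/-- **Stability on the subspace `V₁`**: under the hypotheses of the stability theorem, the
second variation `L[Q](P)` is nonnegative for every smooth compactly supported
`P : B_R → S₀` whose `(1,3)` and `(2,3)` entries vanish identically. -/
theorem stmt6 (a2 b2 c2 : ℝ) (ha : 0 ≤ a2) (hb : 0 < b2) (hc : 0 < c2)
    (k : ℤ) (hk : k = 1 ∨ k = -1) (R : ℝ≥0∞) (hR : 0 < R)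
    (u v : ℝ → ℝ) (hsol : ProfileSolution a2 b2 c2 k R u v)
    (hu : ∀ r ∈ Iset R, 0 < u r) (hv : ∀ r ∈ Iset R, v r < 0)
    (hstab : ∀ ξ η : ℝ → ℝ, ContDiff ℝ 1 ξ → ContDiff ℝ 1 η →
      HasCompactSupport ξ → HasCompactSupport η →
      tsupport ξ ⊆ Iset R → tsupport η ⊆ Iset R →
      0 ≤ Bform a2 b2 c2 k R u v ξ η)
    (P : EuclideanSpace ℝ (Fin 2) → Matrix (Fin 3) (Fin 3) ℝ)
    (hPsmooth : ∀ i j, ContDiff ℝ (⊤ : ℕ∞) fun x => P x i j)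
    (hPc : HasCompactSupport P) (hPs : tsupport P ⊆ ball2 R)
    (hPsym : ∀ x, (P x).IsSymm) (hPtr : ∀ x, (P x).trace = 0)
    (hP13 : ∀ x, P x 0 2 = 0) (hP23 : ∀ x, P x 1 2 = 0) :
    0 ≤ Lform a2 b2 c2 R (Qmap k u v) P := by
  have hk2 : (k : ℝ) ^ 2 = 1 := by rcases hk with rfl | rfl <;> simp
  have hL : Lform a2 b2 c2 R (Qmap k u v) P =
      ∫ x, variationDensity a2 b2 c2 (Qmap k u v) P x :=
    setIntegral_eq_integral_of_forall_compl_eq_zero fun x hx =>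
      variationDensity_eq_zero fun h => hx (hPs h)
  rw [hL]
  by_cases hint : Integrable (variationDensity a2 b2 c2 (Qmap k u v) P)
  · exact Lform_nonneg_of_integrable (hsol.isProfile ha hb hc hk2 hR hu hv)
      (ProfileSolution.profileStable hk2 hstab) hk2
      (fun i j => (hPsmooth i j).of_le (by exact_mod_cast le_top)) hPc hPs
      (fun x => eq_of_symm_traceless (hPsym x) (hPtr x) (hP13 x) (hP23 x)) hint
  · rw [integral_undef hint]

end
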